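/- arXiv:2011.02931 — 4 statements merged into one kernel-verified Lean document; each statement's English description precedes it below -/
import Mathlib

section
/- Let ω be a positive superharmonic function on the open unit disk 𝔻. Then every f ∈ 𝒟_ω can be written as f = g₁ + g₂, where g₁, g₂ ∈ 𝒟_ω and neither g₁ nor g₂ has a zero in 𝔻. -/
open MeasureTheory

noncomputable section

/-- The open unit disk in `ℂ`. -/
def unitDisk : Set ℂ := Metric.ball 0 1

/-- A function on the unit disk is holomorphic if it extends to a function on `ℂ`
that is holomorphic on the disk. -/
def HolOn (f : unitDisk → ℂ) : Prop :=
  ∃ F : ℂ → ℂ, DifferentiableOn ℂ F unitDisk ∧ ∀ z : unitDisk, f z = F z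

/-- `ω : ℂ → ℝ` is superharmonic on the unit disk: lower semicontinuous there, and
satisfying the super-mean-value inequality
`(1/2π) ∫₀^{2π} ω(z₀ + r e^{iθ}) dθ ≤ ω z₀` whenever the closed disk of centre `z₀`
and radius `r > 0` is contained in the unit disk.  (The circle integral of the
positive function `ω` is taken as a lower Lebesgue integral.) -/
def SuperharmonicOn (ω : ℂ → ℝ) : Prop :=
  LowerSemicontinuousOn ω unitDisk ∧
  ∀ (z₀ : ℂ) (r : ℝ), 0 < r → Metric.closedBall z₀ r ⊆ unitDisk →
    (∫⁻ θ in Set.Ioc (0 : ℝ) (2 * Real.pi),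
        ENNReal.ofReal (ω (z₀ + (r : ℂ) * Complex.exp ((θ : ℂ) * Complex.I))))
      ≤ ENNReal.ofReal (2 * Real.pi * ω z₀)

/-- Membership in the weighted Dirichlet space `𝒟_ω`: `f` is holomorphic on the unit
disk and `∫_𝔻 |f′(z)|² ω(z) dA(z) < ∞`. -/
def dirichletMem (ω : ℂ → ℝ) (f : unitDisk → ℂ) : Prop :=
  ∃ F : ℂ → ℂ, DifferentiableOn ℂ F unitDisk ∧ (∀ z : unitDisk, f z = F z) ∧
    (∫⁻ z in unitDisk, ENNReal.ofReal (‖deriv F z‖ ^ 2 * ω z)) < ⊤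

open Metric Set Filter Topology
open scoped ENNReal Real

/-! ### Circle averages and polar coordinates -/

lemma ofReal_integral_le_lintegral_ofReal {α : Type*} [MeasurableSpace α] {μ : Measure α}
    {f : α → ℝ} (hf : Integrable f μ) :
    ENNReal.ofReal (∫ x, f x ∂μ) ≤ ∫⁻ x, ENNReal.ofReal (f x) ∂μ := by
  calc ENNReal.ofReal (∫ x, f x ∂μ) ≤ ENNReal.ofReal (∫ x, max (f x) 0 ∂μ) :=
        ENNReal.ofReal_le_ofReal (integral_mono hf hf.pos_part fun x => le_max_left _ _)
    _ = ∫⁻ x, ENNReal.ofReal (max (f x) 0) ∂μ :=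
        ofReal_integral_eq_lintegral_ofReal hf.pos_part (ae_of_all _ fun x => le_max_right _ _)
    _ = ∫⁻ x, ENNReal.ofReal (f x) ∂μ := by simp [ENNReal.ofReal_max]

lemma two_pi_mul_circleAverage (h : ℂ → ℝ) (z : ℂ) (ε : ℝ) :
    2 * π * Real.circleAverage h z ε = ∫ θ in Ioc (0 : ℝ) (2 * π), h (circleMap z ε θ) := by
  rw [Real.circleAverage_def, intervalIntegral.integral_of_le Real.two_pi_pos.le, smul_eq_mul,
    ← mul_assoc, mul_inv_cancel₀ Real.two_pi_pos.ne', one_mul]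

lemma CircleIntegrable.integrable_Ioc {h : ℂ → ℝ} {z : ℂ} {ε : ℝ} (hh : CircleIntegrable h z ε) :
    Integrable (fun θ => h (circleMap z ε θ)) (volume.restrict (Ioc (0 : ℝ) (2 * π))) := by
  have := hh.1
  exact this

lemma ofReal_circleAverage_le {h : ℂ → ℝ} {z : ℂ} {ε : ℝ} (hh : CircleIntegrable h z ε) :
    ENNReal.ofReal (2 * π * Real.circleAverage h z ε) ≤
      ∫⁻ θ in Ioc (0 : ℝ) (2 * π), ENNReal.ofReal (h (circleMap z ε θ)) := by
  rw [two_pi_mul_circleAverage]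
  exact ofReal_integral_le_lintegral_ofReal hh.integrable_Ioc

lemma ofReal_circleAverage_eq {h : ℂ → ℝ} {z : ℂ} {ε : ℝ} (hh : CircleIntegrable h z ε)
    (h0 : ∀ w ∈ sphere z |ε|, 0 ≤ h w) :
    ENNReal.ofReal (2 * π * Real.circleAverage h z ε) =
      ∫⁻ θ in Ioc (0 : ℝ) (2 * π), ENNReal.ofReal (h (circleMap z ε θ)) := by
  rw [two_pi_mul_circleAverage]
  exact ofReal_integral_eq_lintegral_ofReal hh.integrable_Ioc
    (ae_of_all _ fun θ => h0 _ (circleMap_mem_sphere' _ _ _))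

lemma lintegral_ball_eq_polar {h : ℂ → ℝ≥0∞} (hh : Measurable h) (z : ℂ) (d : ℝ) :
    ∫⁻ w in ball z d, h w = ∫⁻ ρ in Ioo (0 : ℝ) d, ENNReal.ofReal ρ *
      ∫⁻ θ in Ioc (0 : ℝ) (2 * π), h (circleMap z ρ θ) := by
  have hcm : Measurable fun p : ℝ × ℝ => circleMap z p.1 p.2 := by
    unfold circleMap; fun_prop
  have h1 : ∫⁻ w in ball z d, h w
      = ∫⁻ w, (ball z d).indicator h (z - w) := by
    rw [lintegral_sub_left_eq_self ((ball z d).indicator h) z,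
      lintegral_indicator measurableSet_ball]
  have h2 : ∀ p : ℝ × ℝ, z - Complex.polarCoord.symm p = circleMap z p.1 (p.2 + π) := by
    intro p
    simp only [Complex.polarCoord_symm_apply, circleMap]
    push_cast
    rw [add_mul, Complex.exp_add, Complex.exp_pi_mul_I, Complex.exp_mul_I]
    ring
  have hm : Measurable fun p : ℝ × ℝ =>
      ENNReal.ofReal p.1 * (ball z d).indicator h (circleMap z p.1 (p.2 + π)) := by
    refine (by fun_prop : Measurable fun p : ℝ × ℝ => ENNReal.ofReal p.1).mul
      ((hh.indicator measurableSet_ball).comp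
        (hcm.comp (by fun_prop : Measurable fun p : ℝ × ℝ => (p.1, p.2 + π))))
  rw [h1, ← Complex.lintegral_comp_polarCoord_symm]
  simp only [h2, smul_eq_mul, polarCoord_target]
  rw [Measure.volume_eq_prod, setLIntegral_prod _ hm.aemeasurable]
  have h3 : ∀ ρ ∈ Ioi (0 : ℝ),
      ∫⁻ θ in Ioo (-π) π, ENNReal.ofReal ρ * (ball z d).indicator h (circleMap z ρ (θ + π))
      = (Ioo (0 : ℝ) d).indicator (fun ρ => ENNReal.ofReal ρ *
          ∫⁻ θ in Ioc (0 : ℝ) (2 * π), h (circleMap z ρ θ)) ρ := by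
    intro ρ hρ
    have hρ' : (0 : ℝ) < ρ := hρ
    have hcmρ : Measurable fun θ : ℝ => circleMap z ρ θ := by unfold circleMap; fun_prop
    by_cases hd : ρ < d
    · rw [indicator_of_mem (show ρ ∈ Ioo 0 d from ⟨hρ, hd⟩), lintegral_const_mul]
      · congr 1
        have hin : ∀ θ, circleMap z ρ θ ∈ ball z d := fun θ => by
          rw [mem_ball, dist_eq_norm, circleMap_sub_center, norm_circleMap_zero, abs_of_pos hρ']
          exact hd
        simp only [indicator_of_mem (hin _)]
        have hmp := (measurePreserving_add_right (volume : Measure ℝ) π)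
        have := hmp.setLIntegral_comp_preimage (s := Ioo 0 (2 * π)) measurableSet_Ioo
          (f := fun θ => h (circleMap z ρ θ)) (hh.comp hcmρ)
        rw [← restrict_Ioo_eq_restrict_Ioc, ← this]
        congr 2
        ext θ
        simp only [mem_Ioo, mem_preimage]
        constructor <;> rintro ⟨a, b⟩ <;> constructor <;> linarith
      · exact (hh.indicator measurableSet_ball).comp (hcmρ.comp (by fun_prop))
    · rw [indicator_of_notMem (fun h => hd h.2)]
      have hin : ∀ θ, circleMap z ρ θ ∉ ball z d := fun θ => by
        rw [mem_ball, dist_eq_norm, circleMap_sub_center, norm_circleMap_zero, abs_of_pos hρ']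
        exact hd
      simp [indicator_of_notMem (hin _)]
  rw [setLIntegral_congr_fun measurableSet_Ioi h3, setLIntegral_indicator measurableSet_Ioo]
  congr 2
  ext ρ
  simp only [mem_inter_iff, mem_Ioo, mem_Ioi]
  tauto

lemma lintegral_Ioo_ofReal {d : ℝ} (hd : 0 ≤ d) :
    ∫⁻ ρ in Ioo (0 : ℝ) d, ENNReal.ofReal ρ = ENNReal.ofReal (d ^ 2 / 2) := by
  rw [restrict_Ioo_eq_restrict_Ioc, ← ofReal_integral_eq_lintegral_ofReal]
  · rw [← intervalIntegral.integral_of_le hd, integral_id]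
    simp
  · exact (continuous_id.integrableOn_Icc (a := 0) (b := d)).mono_set Ioc_subset_Icc_self
  · exact (ae_restrict_mem measurableSet_Ioc).mono fun x hx => hx.1.le

lemma le_lintegral_ball_of_le_circle {h : ℂ → ℝ≥0∞} (hh : Measurable h) {z : ℂ} {d c : ℝ}
    (hd : 0 ≤ d)
    (hc : ∀ ρ ∈ Ioo 0 d, ENNReal.ofReal (2 * π * c) ≤
      ∫⁻ θ in Ioc (0 : ℝ) (2 * π), h (circleMap z ρ θ)) :
    ENNReal.ofReal (π * d ^ 2 * c) ≤ ∫⁻ w in ball z d, h w := by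
  rw [lintegral_ball_eq_polar hh]
  calc ENNReal.ofReal (π * d ^ 2 * c) = ENNReal.ofReal (d ^ 2 / 2 * (2 * π * c)) := by
        congr 1; ring
    _ = ∫⁻ ρ in Ioo (0 : ℝ) d, ENNReal.ofReal ρ * ENNReal.ofReal (2 * π * c) := by
        rw [lintegral_mul_const _ (by fun_prop), lintegral_Ioo_ofReal hd,
          ENNReal.ofReal_mul (by positivity)]
    _ ≤ _ := setLIntegral_mono' measurableSet_Ioo fun ρ hρ => by gcongr; exact hc ρ hρ

lemma lintegral_ball_le_of_circle_le {h : ℂ → ℝ≥0∞} (hh : Measurable h) {z : ℂ} {d c : ℝ}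
    (hd : 0 ≤ d)
    (hc : ∀ ρ ∈ Ioo 0 d, ∫⁻ θ in Ioc (0 : ℝ) (2 * π), h (circleMap z ρ θ) ≤
      ENNReal.ofReal (2 * π * c)) :
    ∫⁻ w in ball z d, h w ≤ ENNReal.ofReal (π * d ^ 2 * c) := by
  rw [lintegral_ball_eq_polar hh]
  calc _ ≤ ∫⁻ ρ in Ioo (0 : ℝ) d, ENNReal.ofReal ρ * ENNReal.ofReal (2 * π * c) :=
        setLIntegral_mono' measurableSet_Ioo fun ρ hρ => by gcongr; exact hc ρ hρ
    _ = ENNReal.ofReal (d ^ 2 / 2 * (2 * π * c)) := by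
        rw [lintegral_mul_const _ (by fun_prop), lintegral_Ioo_ofReal hd,
          ← ENNReal.ofReal_mul (by positivity)]
    _ = ENNReal.ofReal (π * d ^ 2 * c) := by congr 1; ring

/-! ### Averages of squared moduli of holomorphic functions -/

lemma circleAverage_norm_sq_eq {f : ℂ → ℂ} {z : ℂ} {ε : ℝ}
    (hf : DifferentiableOn ℂ f (closedBall z |ε|)) :
    Real.circleAverage (fun w => ‖f w‖ ^ 2) z ε
      = ‖f z‖ ^ 2 + Real.circleAverage (fun w => ‖f w - f z‖ ^ 2) z ε := by
  have hfs : ContinuousOn f (sphere z |ε|) := hf.continuousOn.mono sphere_subset_closedBall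
  have hmean : Real.circleAverage f z ε = f z :=
    (hf.mono closure_ball_subset_closedBall).diffContOnCl.circleAverage
  set L : ℂ →L[ℝ] ℝ := Complex.reCLM.comp
    ((ContinuousLinearMap.mul ℝ ℂ) (2 * (starRingEnd ℂ) (f z))) with hL
  have hLmean : Real.circleAverage (fun w => L (f w)) z ε = L (f z) := by
    have := L.circleAverage_comp_comm hfs.circleIntegrable'
    rw [hmean] at this
    exact this
  have hLa : ∀ w, L w = 2 * ((starRingEnd ℂ) (f z) * w).re := fun w => by
    simp [hL, mul_assoc]
  have key : ∀ w, ‖f w‖ ^ 2 = ‖f w - f z‖ ^ 2 + (L (f w) - ‖f z‖ ^ 2) := fun w => by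
    rw [hLa, Complex.sq_norm, Complex.sq_norm, Complex.sq_norm]
    simp only [Complex.normSq_apply, Complex.sub_re, Complex.sub_im, Complex.mul_re,
      Complex.conj_re, Complex.conj_im]
    ring
  have hLz : L (f z) = 2 * ‖f z‖ ^ 2 := by
    rw [hLa, Complex.sq_norm]
    simp only [Complex.normSq_apply, Complex.mul_re, Complex.conj_re, Complex.conj_im]
    ring
  have hi1 : CircleIntegrable (fun w => ‖f w - f z‖ ^ 2) z ε :=
    ContinuousOn.circleIntegrable' (by fun_prop)
  have hi2 : CircleIntegrable (fun w => L (f w)) z ε :=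
    ContinuousOn.circleIntegrable' (L.continuous.comp_continuousOn hfs)
  have hi3 : CircleIntegrable (fun _ : ℂ => ‖f z‖ ^ 2) z ε :=
    ContinuousOn.circleIntegrable' (by fun_prop)
  have hi4 : CircleIntegrable (fun w => L (f w) - ‖f z‖ ^ 2) z ε :=
    ContinuousOn.circleIntegrable' ((L.continuous.comp_continuousOn hfs).sub (by fun_prop))
  rw [Real.circleAverage_congr_sphere (f₁ := fun w => ‖f w‖ ^ 2) (fun w _ => key w),
    Real.circleAverage_fun_add hi1 hi4, Real.circleAverage_fun_sub hi2 hi3, hLmean,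
    Real.circleAverage_const, hLz]
  ring

lemma norm_sq_le_circleAverage {f : ℂ → ℂ} {z : ℂ} {ε : ℝ}
    (hf : DifferentiableOn ℂ f (closedBall z |ε|)) :
    ‖f z‖ ^ 2 ≤ Real.circleAverage (fun w => ‖f w‖ ^ 2) z ε := by
  rw [circleAverage_norm_sq_eq hf]
  have : 0 ≤ Real.circleAverage (fun w => ‖f w - f z‖ ^ 2) z ε :=
    Real.circleAverage_nonneg_of_nonneg fun w _ => by positivity
  linarith

/-- The sub-mean-value property of `‖f‖ ^ 2` over disks. -/
lemma norm_sq_mul_le_lintegral_ball {f : ℂ → ℂ} {z : ℂ} {d : ℝ} (hd : 0 ≤ d)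
    (hf : DifferentiableOn ℂ f (ball z d)) :
    ENNReal.ofReal (π * d ^ 2 * ‖f z‖ ^ 2) ≤
      ∫⁻ w in ball z d, ENNReal.ofReal (‖f w‖ ^ 2) := by
  classical
  set h : ℂ → ℝ≥0∞ := (ball z d).piecewise (fun w => ENNReal.ofReal (‖f w‖ ^ 2)) 0 with hh
  have hm : Measurable h := by
    refine ContinuousOn.measurable_piecewise ?_ continuousOn_const measurableSet_ball
    exact ENNReal.continuous_ofReal.comp_continuousOn (hf.continuousOn.norm.pow 2)
  have := le_lintegral_ball_of_le_circle hm (z := z) (d := d) (c := ‖f z‖ ^ 2) hd ?_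
  · refine this.trans_eq (setLIntegral_congr_fun measurableSet_ball fun w hw => ?_)
    simp [hh, hw]
  · intro ρ hρ
    have hsub : closedBall z |ρ| ⊆ ball z d := by
      rw [abs_of_pos hρ.1]; exact closedBall_subset_ball hρ.2
    have hfρ := hf.mono hsub
    have hci : CircleIntegrable (fun w => ‖f w‖ ^ 2) z ρ :=
      ContinuousOn.circleIntegrable'
        ((hfρ.continuousOn.mono sphere_subset_closedBall).norm.pow 2)
    calc ENNReal.ofReal (2 * π * ‖f z‖ ^ 2)
        ≤ ENNReal.ofReal (2 * π * Real.circleAverage (fun w => ‖f w‖ ^ 2) z ρ) := by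
          gcongr; exact norm_sq_le_circleAverage hfρ
      _ ≤ _ := ofReal_circleAverage_le hci
      _ = _ := by
          refine lintegral_congr fun θ => ?_
          have : circleMap z ρ θ ∈ ball z d :=
            hsub (sphere_subset_closedBall (circleMap_mem_sphere' _ _ _))
          simp [hh, this]

lemma circleAverage_norm_sq_id (z : ℂ) (ε : ℝ) :
    Real.circleAverage (fun w : ℂ => ‖w‖ ^ 2) z ε = ‖z‖ ^ 2 + ε ^ 2 := by
  have := circleAverage_norm_sq_eq (f := fun w => w) (z := z) (ε := ε) differentiableOn_id
  rw [this]
  congr 1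
  rw [Real.circleAverage_congr_sphere (f₂ := fun _ => ε ^ 2), Real.circleAverage_const]
  intro w hw
  simp only [mem_sphere, dist_eq_norm] at hw
  simp [hw]

lemma circleAverage_norm_pow_four (z : ℂ) (ε : ℝ) :
    Real.circleAverage (fun w : ℂ => ‖w‖ ^ 4) z ε
      = ‖z‖ ^ 4 + ε ^ 2 * (4 * ‖z‖ ^ 2 + ε ^ 2) := by
  have h1 := circleAverage_norm_sq_eq (f := fun w => w ^ 2) (z := z) (ε := ε)
    (by fun_prop)
  have h2 := circleAverage_norm_sq_eq (f := fun w => w + z) (z := z) (ε := ε)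
    (by fun_prop)
  have h3 : Real.circleAverage (fun w => ‖w + z - (z + z)‖ ^ 2) z ε = ε ^ 2 := by
    rw [Real.circleAverage_congr_sphere (f₂ := fun _ => ε ^ 2), Real.circleAverage_const]
    intro w hw
    simp only [mem_sphere, dist_eq_norm] at hw
    simp [hw]
  have h4 : Real.circleAverage (fun w => ‖w ^ 2 - z ^ 2‖ ^ 2) z ε
      = ε ^ 2 * Real.circleAverage (fun w => ‖w + z‖ ^ 2) z ε := by
    rw [← smul_eq_mul, ← Real.circleAverage_fun_smul]
    refine Real.circleAverage_congr_sphere fun w hw => ?_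
    simp only [mem_sphere, dist_eq_norm] at hw
    simp only [sq_sub_sq, norm_mul, mul_pow, hw, sq_abs, smul_eq_mul]
    ring
  rw [h3, ← two_mul, norm_mul] at h2
  rw [h4, h2] at h1
  simp only [norm_pow] at h1
  ring_nf at h1 ⊢
  simp only [Complex.norm_ofNat] at h1
  rw [h1]
  ring

/-- Uniform second order expansion of circle averages of `‖f‖ ^ 2`. -/
lemma exists_circleAverage_norm_sq_expansion {f : ℂ → ℂ} {r R : ℝ} (hr : r < R)
    (hf : DifferentiableOn ℂ f (ball 0 R)) :
    ∃ C : ℝ, 0 ≤ C ∧ ∀ ε : ℝ, |ε| ≤ 1 → r + |ε| ≤ (r + R) / 2 → ∀ z ∈ closedBall (0 : ℂ) r,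
      |Real.circleAverage (fun w => ‖f w‖ ^ 2) z ε - ‖f z‖ ^ 2 - ε ^ 2 * ‖deriv f z‖ ^ 2|
        ≤ C * |ε| ^ 3 := by
  set r' := (r + R) / 2 with hr'
  have hr'R : closedBall (0 : ℂ) r' ⊆ ball 0 R := closedBall_subset_ball (by linarith)
  have hf' : DifferentiableOn ℂ (deriv f) (ball 0 R) := hf.deriv isOpen_ball
  have hf'' : DifferentiableOn ℂ (deriv (deriv f)) (ball 0 R) := hf'.deriv isOpen_ball
  obtain ⟨A, hA⟩ := (isCompact_closedBall (0 : ℂ) r').exists_bound_of_continuousOn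
    (hf'.continuousOn.mono hr'R)
  obtain ⟨B, hB⟩ := (isCompact_closedBall (0 : ℂ) r').exists_bound_of_continuousOn
    (hf''.continuousOn.mono hr'R)
  have hAd : ∀ w ∈ closedBall (0 : ℂ) r', DifferentiableAt ℂ f w := fun w hw =>
    hf.differentiableAt (isOpen_ball.mem_nhds (hr'R hw))
  have hBd : ∀ w ∈ closedBall (0 : ℂ) r', DifferentiableAt ℂ (deriv f) w := fun w hw =>
    hf'.differentiableAt (isOpen_ball.mem_nhds (hr'R hw))
  have hB0 : 0 ≤ |B| := abs_nonneg _
  have hA0 : 0 ≤ |A| := abs_nonneg _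
  refine ⟨2 * |A| * |B| + |B| ^ 2, by positivity, fun ε hε1 hε z hz => ?_⟩
  have hεb : closedBall z |ε| ⊆ closedBall 0 r' := by
    refine closedBall_subset_closedBall' ?_
    have := mem_closedBall.1 hz
    linarith
  have hzr' : z ∈ closedBall 0 r' := hεb (mem_closedBall_self (abs_nonneg ε))
  have hR : ∀ w ∈ closedBall z |ε|, ‖f w - f z - (w - z) * deriv f z‖ ≤ |B| * |ε| ^ 2 := by
    intro w hw
    have hd : ∀ v ∈ closedBall z |ε|, HasDerivWithinAt (fun v => f v - v * deriv f z)
        (deriv f v - deriv f z) (closedBall z |ε|) v := fun v hv => by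
      have h1 := (hAd v (hεb hv)).hasDerivAt
      have h2 := (hasDerivAt_id v).mul_const (deriv f z)
      simpa using (h1.fun_sub h2).hasDerivWithinAt
    have hbd : ∀ v ∈ closedBall z |ε|, ‖deriv f v - deriv f z‖ ≤ |B| * |ε| := fun v hv => by
      have h1 := Convex.norm_image_sub_le_of_norm_deriv_le (f := deriv f) (C := |B|) hBd
        (fun x hx => (hB x hx).trans (le_abs_self B)) (convex_closedBall _ _) hzr' (hεb hv)
      refine h1.trans ?_
      gcongr
      exact mem_closedBall_iff_norm.1 hv
    have h1 := (convex_closedBall z |ε|).norm_image_sub_le_of_norm_hasDerivWithin_le hd hbd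
      (mem_closedBall_self (abs_nonneg ε)) hw
    have h2 : f w - w * deriv f z - (f z - z * deriv f z) = f w - f z - (w - z) * deriv f z := by
      ring
    simp only [h2] at h1
    refine h1.trans ?_
    rw [pow_two, ← mul_assoc]
    gcongr
    exact mem_closedBall_iff_norm.1 hw
  have hdiff : DifferentiableOn ℂ f (closedBall z |ε|) := hf.mono (hεb.trans hr'R)
  rw [circleAverage_norm_sq_eq hdiff]
  have hcs : ContinuousOn f (sphere z |ε|) :=
    hdiff.continuousOn.mono sphere_subset_closedBall
  have hconst : ε ^ 2 * ‖deriv f z‖ ^ 2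
      = Real.circleAverage (fun _ : ℂ => ε ^ 2 * ‖deriv f z‖ ^ 2) z ε :=
    (Real.circleAverage_const _ _ _).symm
  have hci1 : CircleIntegrable (fun w => ‖f w - f z‖ ^ 2) z ε :=
    ContinuousOn.circleIntegrable' (by fun_prop)
  have hci2 : CircleIntegrable (fun _ : ℂ => ε ^ 2 * ‖deriv f z‖ ^ 2) z ε :=
    ContinuousOn.circleIntegrable' (by fun_prop)
  rw [add_sub_cancel_left, hconst, ← Real.circleAverage_fun_sub hci1 hci2]
  refine (Real.abs_circleAverage_le_circleAverage_abs).trans ?_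
  refine Real.circleAverage_mono_on_of_le_circle
    (ContinuousOn.circleIntegrable' (by fun_prop : ContinuousOn
      (fun w => ‖f w - f z‖ ^ 2 - ε ^ 2 * ‖deriv f z‖ ^ 2) (sphere z |ε|)).abs) fun w hw => ?_
  have hw' := sphere_subset_closedBall hw
  have hwz : ‖w - z‖ = |ε| := by simpa [dist_eq_norm] using hw
  have h1 := hR w hw'
  set a := f w - f z with ha
  set b := (w - z) * deriv f z with hb
  have hbn : ‖b‖ = |ε| * ‖deriv f z‖ := by rw [hb, norm_mul, hwz]
  have hbA : ‖b‖ ≤ |ε| * |A| := by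
    rw [hbn]; gcongr; exact (hA z hzr').trans (le_abs_self A)
  have h2 : |‖a‖ - ‖b‖| ≤ |B| * |ε| ^ 2 := (abs_norm_sub_norm_le a b).trans h1
  have h3 : ‖a‖ ^ 2 - ε ^ 2 * ‖deriv f z‖ ^ 2 = (‖a‖ - ‖b‖) * (2 * ‖b‖ + (‖a‖ - ‖b‖)) := by
    have : ε ^ 2 * ‖deriv f z‖ ^ 2 = ‖b‖ ^ 2 := by rw [hbn, mul_pow, sq_abs]
    rw [this]; ring
  simp only [Pi.abs_apply]
  rw [h3, abs_mul]
  have h4 : |2 * ‖b‖ + (‖a‖ - ‖b‖)| ≤ 2 * (|ε| * |A|) + |B| * |ε| := by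
    refine (abs_add_le _ _).trans (add_le_add ?_ (h2.trans ?_))
    · rw [abs_of_nonneg (by positivity)]; gcongr
    · gcongr
      nlinarith [abs_nonneg ε]
  calc |‖a‖ - ‖b‖| * |2 * ‖b‖ + (‖a‖ - ‖b‖)|
      ≤ (|B| * |ε| ^ 2) * (2 * (|ε| * |A|) + |B| * |ε|) := by gcongr
    _ = _ := by ring

/-! ### Comparison of weighted Dirichlet integrals -/

section

lemma lintegral_mul_circle_swap {W p : ℂ → ℝ≥0∞} (hW : Measurable W) (hp : Measurable p) (ε : ℝ) :
    ∫⁻ z, W z * ∫⁻ θ in Ioc (0 : ℝ) (2 * π), p (circleMap z (-ε) θ)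
      = ∫⁻ z, p z * ∫⁻ θ in Ioc (0 : ℝ) (2 * π), W (circleMap z ε θ) := by
  have hc : ∀ ε : ℝ, Measurable fun x : ℂ × ℝ => circleMap x.1 ε x.2 := fun ε => by
    unfold circleMap; fun_prop
  have hc1 : ∀ (z : ℂ) (ε : ℝ), Measurable fun θ : ℝ => circleMap z ε θ := fun z ε => by
    unfold circleMap; fun_prop
  have e1 : ∀ z, W z * ∫⁻ θ in Ioc (0 : ℝ) (2 * π), p (circleMap z (-ε) θ)
      = ∫⁻ θ in Ioc (0 : ℝ) (2 * π), W z * p (circleMap z (-ε) θ) := fun z =>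
    (lintegral_const_mul _ (hp.comp (hc1 z _))).symm
  have e2 : ∀ z, p z * ∫⁻ θ in Ioc (0 : ℝ) (2 * π), W (circleMap z ε θ)
      = ∫⁻ θ in Ioc (0 : ℝ) (2 * π), p z * W (circleMap z ε θ) := fun z =>
    (lintegral_const_mul _ (hW.comp (hc1 z _))).symm
  simp_rw [e1, e2]
  have m1 : Measurable (Function.uncurry fun (z : ℂ) (θ : ℝ) => W z * p (circleMap z (-ε) θ)) :=
    (hW.comp measurable_fst).fun_mul (hp.comp (hc _))
  have m2 : Measurable (Function.uncurry fun (z : ℂ) (θ : ℝ) => p z * W (circleMap z ε θ)) :=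
    (hp.comp measurable_fst).fun_mul (hW.comp (hc _))
  rw [lintegral_lintegral_swap m1.aemeasurable, lintegral_lintegral_swap m2.aemeasurable]
  refine lintegral_congr fun θ => ?_
  rw [← lintegral_add_right_eq_self (fun z => W z * p (circleMap z (-ε) θ)) (circleMap 0 ε θ)]
  refine lintegral_congr fun z => ?_
  rw [mul_comm]
  congr 2
  · simp [circleMap]
  · simp [circleMap]

variable {W q : ℂ → ℝ≥0∞} {C : ℝ≥0∞} {r : ℝ} {f F : ℂ → ℂ}

/-- The comparison of weighted Dirichlet integrals on a superlevel set of `‖F‖ ^ 2 - ‖f‖ ^ 2`. -/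
lemma lintegral_deriv_superlevel_le (hW : Measurable W) (hq : Measurable q)
    (hC : C ≠ ∞) (hr0 : 0 < r) (hr : r < 1)
    (hWq : ∀ (z : ℂ) (ε : ℝ), 0 < ε → closedBall z ε ⊆ unitDisk →
      (∫⁻ θ in Ioc (0 : ℝ) (2 * π), W (circleMap z ε θ))
        + ENNReal.ofReal (2 * π) * (ENNReal.ofReal ε ^ 2 * q z)
        ≤ ENNReal.ofReal (2 * π) * (W z + C * ENNReal.ofReal ε ^ 4))
    (hWfin : ∫⁻ z in ball 0 r, W z ≠ ∞)
    (hf : DifferentiableOn ℂ f unitDisk) (hF : DifferentiableOn ℂ F unitDisk)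
    (hs : ∀ z ∈ sphere (0 : ℂ) r, ‖f z‖ = ‖F z‖) {δ : ℝ} (hδ : 0 < δ) :
    (∫⁻ z in ball 0 r ∩ {z | δ < ‖F z‖ ^ 2 - ‖f z‖ ^ 2},
        W z * ENNReal.ofReal (‖deriv F z‖ ^ 2))
      + ∫⁻ z in ball 0 r, ENNReal.ofReal (‖F z‖ ^ 2 - ‖f z‖ ^ 2 - δ) * q z
      ≤ ∫⁻ z in ball 0 r, W z * ENNReal.ofReal (‖deriv f z‖ ^ 2) := by
  classical
  set g : ℂ → ℝ := fun z => ‖F z‖ ^ 2 - ‖f z‖ ^ 2 with hg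
  have hcb : closedBall (0 : ℂ) r ⊆ unitDisk := closedBall_subset_ball hr
  have hgU : ContinuousOn g unitDisk :=
    (hF.continuousOn.norm.pow 2).sub (hf.continuousOn.norm.pow 2)
  have hgc : ContinuousOn g (closedBall 0 r) := hgU.mono hcb
  set K : Set ℂ := ball 0 r ∩ {z | δ < g z} with hK
  have hKo : IsOpen K :=
    (hgc.mono ball_subset_closedBall).isOpen_inter_preimage isOpen_ball isOpen_Ioi
  have hKm : MeasurableSet K := hKo.measurableSet
  have hKsub : K ⊆ ball 0 r := inter_subset_left
  set p : ℂ → ℝ≥0∞ := (ball (0 : ℂ) r).piecewise (fun z => ENNReal.ofReal (g z - δ)) 0 with hp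
  have hpm : Measurable p := by
    refine ContinuousOn.measurable_piecewise ?_ continuousOn_const measurableSet_ball
    exact ENNReal.continuous_ofReal.comp_continuousOn
      ((hgc.mono ball_subset_closedBall).sub continuousOn_const)
  have hpb : ∀ z ∈ ball (0 : ℂ) r, p z = ENNReal.ofReal (g z - δ) := fun z hz => by
    simp only [hp, piecewise_eq_of_mem _ _ _ hz]
  have hp0 : ∀ z ∉ ball (0 : ℂ) r, p z = 0 := fun z hz => by
    simp only [hp, piecewise_eq_of_notMem _ _ _ hz]; rfl
  have hpK : ∀ z ∉ K, p z = 0 := fun z hz => by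
    by_cases hzb : z ∈ ball (0 : ℂ) r
    · rw [hpb z hzb, ENNReal.ofReal_eq_zero]
      have : ¬ δ < g z := fun h => hz ⟨hzb, h⟩
      linarith
    · exact hp0 z hzb
  -- `p` is bounded
  obtain ⟨M, hM⟩ := (isCompact_closedBall (0 : ℂ) r).exists_bound_of_continuousOn hgc
  have hpM : ∀ z, p z ≤ ENNReal.ofReal M := fun z => by
    by_cases hzb : z ∈ ball (0 : ℂ) r
    · rw [hpb z hzb]
      refine ENNReal.ofReal_le_ofReal ?_
      have := hM z (ball_subset_closedBall hzb)
      have := (le_abs_self _).trans this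
      linarith
    · simp [hp0 z hzb]
  -- `K` stays away from the circle
  obtain ⟨r₁, hr₁0, hr₁, hKr₁⟩ : ∃ r₁, 0 ≤ r₁ ∧ r₁ < r ∧ K ⊆ closedBall 0 r₁ := by
    have hK'c : IsCompact (closedBall (0 : ℂ) r ∩ g ⁻¹' Ici δ) :=
      (isCompact_closedBall _ _).of_isClosed_subset
        (hgc.preimage_isClosed_of_isClosed isClosed_closedBall isClosed_Ici) inter_subset_left
    have hKK' : K ⊆ closedBall (0 : ℂ) r ∩ g ⁻¹' Ici δ := fun z hz =>
      ⟨ball_subset_closedBall hz.1, show δ ≤ g z from le_of_lt (show δ < g z from hz.2)⟩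
    rcases (closedBall (0 : ℂ) r ∩ g ⁻¹' Ici δ).eq_empty_or_nonempty with he | hne
    · exact ⟨0, le_rfl, hr0, (hKK'.trans he.subset).trans (empty_subset _)⟩
    · obtain ⟨x, hx, hxm⟩ := hK'c.exists_isMaxOn hne continuous_norm.continuousOn
      refine ⟨‖x‖, norm_nonneg _, ?_, fun z hz => ?_⟩
      · refine lt_of_le_of_ne (by simpa using hx.1) fun h => ?_
        have h1 : δ ≤ g x := hx.2
        have h2 : g x = 0 := by simp [hg, hs x (by simpa using h)]
        linarith
      · simpa using hxm (hKK' hz)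
  -- second order expansions
  obtain ⟨Cf, hCf0, hCf⟩ := exists_circleAverage_norm_sq_expansion hr₁
    (hf.mono (ball_subset_closedBall.trans hcb))
  obtain ⟨CF, hCF0, hCF⟩ := exists_circleAverage_norm_sq_expansion hr₁
    (hF.mono (ball_subset_closedBall.trans hcb))
  set C' := Cf + CF with hC'
  have hC'0 : 0 ≤ C' := add_nonneg hCf0 hCF0
  set ε₀ := min 1 ((r - r₁) / 2) with hε₀
  have hε₀0 : 0 < ε₀ := lt_min one_pos (by linarith)
  set A := ∫⁻ z in K, W z * p z with hA
  set X := ∫⁻ z in K, W z * ENNReal.ofReal (‖deriv F z‖ ^ 2) with hX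
  set Y := ∫⁻ z in ball 0 r, p z * q z with hY
  set Z := ∫⁻ z in K, W z * ENNReal.ofReal (‖deriv f z‖ ^ 2) with hZ
  set T := ∫⁻ z in K, W z with hT
  set P := ∫⁻ z in ball 0 r, p z with hP
  have hTfin : T ≠ ∞ := ne_top_of_le_ne_top hWfin (lintegral_mono_set hKsub)
  have hAfin : A ≠ ∞ := by
    refine ne_top_of_le_ne_top (ENNReal.mul_ne_top hTfin (ENNReal.ofReal_ne_top (r := M))) ?_
    rw [hT, ← lintegral_mul_const _ hW]
    exact lintegral_mono fun z => by gcongr; exact hpM z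
  have hPfin : P ≠ ∞ := by
    refine ne_top_of_le_ne_top (b := ∫⁻ z in ball (0 : ℂ) r, ENNReal.ofReal M) ?_
      (lintegral_mono fun z => hpM z)
    rw [setLIntegral_const]
    exact ENNReal.mul_ne_top ENNReal.ofReal_ne_top measure_ball_lt_top.ne
  have h2π : ENNReal.ofReal (2 * π) ≠ 0 := by simp [Real.pi_pos]
  have h2π' : ENNReal.ofReal (2 * π) ≠ ∞ := ENNReal.ofReal_ne_top
  have hmain : ∀ ε, 0 < ε → ε < ε₀ →
      X + Y ≤ Z + ENNReal.ofReal ε * (ENNReal.ofReal C' * T + C * P) := by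
    intro ε hε hεε₀
    have hε1 : ε ≤ 1 := (hεε₀.trans_le (min_le_left _ _)).le
    have hεr : ε ≤ (r - r₁) / 2 := (hεε₀.trans_le (min_le_right _ _)).le
    set e := ENNReal.ofReal ε with he
    have he0 : e ≠ 0 := by simp [he, hε]
    have het : e ≠ ∞ := ENNReal.ofReal_ne_top
    have he1 : e ≤ 1 := by simpa [he] using hε1
    set Mp : ℂ → ℝ≥0∞ := fun z => ∫⁻ θ in Ioc (0 : ℝ) (2 * π), p (circleMap z (-ε) θ) with hMp
    have hpt : ∀ z ∈ K, ENNReal.ofReal (2 * π) * (p z + e ^ 2 * ENNReal.ofReal (‖deriv F z‖ ^ 2))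
        ≤ Mp z + ENNReal.ofReal (2 * π) *
          (e ^ 2 * ENNReal.ofReal (‖deriv f z‖ ^ 2) + ENNReal.ofReal C' * e ^ 3) := by
      intro z hz
      have hzr₁ := hKr₁ hz
      have habs : |(-ε)| = ε := by rw [abs_neg, abs_of_pos hε]
      have hsub : closedBall z |(-ε)| ⊆ ball 0 r := by
        rw [habs]
        refine (closedBall_subset_ball' (ε₂ := r) ?_)
        have := mem_closedBall.1 hzr₁
        linarith
      have h1 := hCf (-ε) (by rwa [habs]) (by rw [habs]; linarith) z hzr₁
      have h2 := hCF (-ε) (by rwa [habs]) (by rw [habs]; linarith) z hzr₁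
      rw [habs, neg_sq] at h1 h2
      have hcF : ContinuousOn (fun w => ‖F w‖ ^ 2) (sphere z |(-ε)|) :=
        (hF.continuousOn.norm.pow 2).mono
          (((sphere_subset_closedBall.trans hsub).trans ball_subset_closedBall).trans hcb)
      have hcf : ContinuousOn (fun w => ‖f w‖ ^ 2) (sphere z |(-ε)|) :=
        (hf.continuousOn.norm.pow 2).mono
          (((sphere_subset_closedBall.trans hsub).trans ball_subset_closedBall).trans hcb)
      have hgavg : Real.circleAverage (fun w => g w - δ) z (-ε)
          = Real.circleAverage (fun w => ‖F w‖ ^ 2) z (-ε)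
            - Real.circleAverage (fun w => ‖f w‖ ^ 2) z (-ε) - δ := by
        have hcg : ContinuousOn g (sphere z |(-ε)|) := hcF.fun_sub hcf
        rw [Real.circleAverage_fun_sub hcg.circleIntegrable'
          continuousOn_const.circleIntegrable', Real.circleAverage_const, hg,
          Real.circleAverage_fun_sub hcF.circleIntegrable' hcf.circleIntegrable']
      have h3 : ENNReal.ofReal (2 * π * Real.circleAverage (fun w => g w - δ) z (-ε)) ≤ Mp z := by
        refine (ofReal_circleAverage_le
          ((hcF.fun_sub hcf).fun_sub continuousOn_const).circleIntegrable').trans_eq ?_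
        refine lintegral_congr fun θ => ?_
        rw [hpb _ (hsub (sphere_subset_closedBall (circleMap_mem_sphere' _ _ _)))]
      have h4 : g z - δ + ε ^ 2 * ‖deriv F z‖ ^ 2
          ≤ Real.circleAverage (fun w => g w - δ) z (-ε)
            + (ε ^ 2 * ‖deriv f z‖ ^ 2 + C' * ε ^ 3) := by
        rw [hgavg, hC']
        have h1' := (abs_le.1 h1).2
        have h2' := (abs_le.1 h2).1
        simp only [hg]
        linarith
      have hgz : 0 ≤ g z - δ := by have : δ < g z := hz.2; linarith
      rw [hpb z (hKsub hz), he, ← ENNReal.ofReal_pow hε.le, ← ENNReal.ofReal_pow hε.le,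
        ← ENNReal.ofReal_mul (by positivity), ← ENNReal.ofReal_mul (by positivity),
        ← ENNReal.ofReal_mul hC'0, ← ENNReal.ofReal_add hgz (by positivity),
        ← ENNReal.ofReal_add (by positivity) (by positivity),
        ← ENNReal.ofReal_mul (by positivity), ← ENNReal.ofReal_mul (by positivity)]
      calc _ ≤ ENNReal.ofReal (2 * π * Real.circleAverage (fun w => g w - δ) z (-ε)
            + 2 * π * (ε ^ 2 * ‖deriv f z‖ ^ 2 + C' * ε ^ 3)) := by
            refine ENNReal.ofReal_le_ofReal ?_
            rw [← mul_add]
            gcongr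
        _ ≤ _ := ENNReal.ofReal_add_le
        _ ≤ _ := by gcongr
    have hdm : ∀ h : ℂ → ℂ, Measurable fun z => ENNReal.ofReal (‖deriv h z‖ ^ 2) := fun h =>
      ((measurable_deriv h).norm.pow_const 2).ennreal_ofReal
    have hint : ENNReal.ofReal (2 * π) * (A + e ^ 2 * X)
        ≤ (∫⁻ z, W z * Mp z) + ENNReal.ofReal (2 * π) *
          (e ^ 2 * Z + ENNReal.ofReal C' * e ^ 3 * T) := by
      have hL : ENNReal.ofReal (2 * π) * (A + e ^ 2 * X) = ∫⁻ z in K, W z *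
          (ENNReal.ofReal (2 * π) * (p z + e ^ 2 * ENNReal.ofReal (‖deriv F z‖ ^ 2))) := by
        rw [hA, hX, ← lintegral_const_mul _ (hW.fun_mul (hdm F)), ← lintegral_add_left (hW.fun_mul hpm),
          ← lintegral_const_mul _ ((hW.fun_mul hpm).fun_add ((hW.fun_mul (hdm F)).const_mul _))]
        exact lintegral_congr fun z => by ring
      have hRr : ENNReal.ofReal (2 * π) * (e ^ 2 * Z + ENNReal.ofReal C' * e ^ 3 * T)
          = ∫⁻ z in K, W z * (ENNReal.ofReal (2 * π) *
          (e ^ 2 * ENNReal.ofReal (‖deriv f z‖ ^ 2) + ENNReal.ofReal C' * e ^ 3)) := by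
        rw [hZ, hT, ← lintegral_const_mul _ (hW.fun_mul (hdm f)), ← lintegral_const_mul _ hW,
          ← lintegral_add_left ((hW.fun_mul (hdm f)).const_mul _),
          ← lintegral_const_mul _ (((hW.fun_mul (hdm f)).const_mul _).fun_add (hW.const_mul _))]
        exact lintegral_congr fun z => by ring
      have hmR : Measurable fun z => W z * (ENNReal.ofReal (2 * π) *
          (e ^ 2 * ENNReal.ofReal (‖deriv f z‖ ^ 2) + ENNReal.ofReal C' * e ^ 3)) :=
        hW.fun_mul ((((hdm f).const_mul _).add_const _).const_mul _)
      rw [hL, hRr]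
      calc _ ≤ ∫⁻ z in K, (W z * Mp z + W z * (ENNReal.ofReal (2 * π) *
          (e ^ 2 * ENNReal.ofReal (‖deriv f z‖ ^ 2) + ENNReal.ofReal C' * e ^ 3))) := by
            refine setLIntegral_mono' hKm fun z hz => ?_
            rw [← mul_add]
            gcongr
            exact hpt z hz
        _ = (∫⁻ z in K, W z * Mp z) + _ := lintegral_add_right _ hmR
        _ ≤ _ := by gcongr; exact Measure.restrict_le_self
    have hswap : (∫⁻ z, W z * Mp z) + ENNReal.ofReal (2 * π) * (e ^ 2 * Y)
        ≤ ENNReal.ofReal (2 * π) * (A + C * e ^ 4 * P) := by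
      have hYe : Y = ∫⁻ z in K, p z * q z := by
        rw [hY, ← lintegral_indicator measurableSet_ball, ← lintegral_indicator hKm]
        refine lintegral_congr fun z => ?_
        by_cases hz : z ∈ K
        · simp [hz, hKsub hz]
        · simp [hz, hpK z hz]
      have hSe : (∫⁻ z, W z * Mp z) = ∫⁻ z in K, p z *
          ∫⁻ θ in Ioc (0 : ℝ) (2 * π), W (circleMap z ε θ) := by
        rw [hMp, lintegral_mul_circle_swap hW hpm, ← lintegral_indicator hKm]
        refine lintegral_congr fun z => ?_
        by_cases hz : z ∈ K
        · simp [hz]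
        · simp [hz, hpK z hz]
      have hPe : P = ∫⁻ z in K, p z := by
        rw [hP, ← lintegral_indicator measurableSet_ball, ← lintegral_indicator hKm]
        refine lintegral_congr fun z => ?_
        by_cases hz : z ∈ K
        · simp [hz, hKsub hz]
        · simp [hz, hpK z hz]
      rw [hSe, hYe, hPe, hA, ← lintegral_const_mul _ (hpm.fun_mul hq),
        ← lintegral_const_mul _ ((hpm.fun_mul hq).const_mul _),
        ← lintegral_add_right _ (((hpm.fun_mul hq).const_mul _).const_mul _),
        ← lintegral_const_mul _ hpm, ← lintegral_add_left (hW.fun_mul hpm),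
        ← lintegral_const_mul _ ((hW.fun_mul hpm).fun_add (hpm.const_mul _))]
      refine setLIntegral_mono' hKm fun z hz => ?_
      have hsub : closedBall z ε ⊆ unitDisk := by
        refine (closedBall_subset_closedBall' (ε₂ := r) ?_).trans hcb
        have := mem_closedBall.1 (hKr₁ hz)
        linarith
      calc _ = p z * ((∫⁻ θ in Ioc (0 : ℝ) (2 * π), W (circleMap z ε θ))
            + ENNReal.ofReal (2 * π) * (e ^ 2 * q z)) := by ring
        _ ≤ p z * (ENNReal.ofReal (2 * π) * (W z + C * e ^ 4)) := by
            gcongr; exact hWq z ε hε hsub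
        _ = _ := by ring
    have hcomb : ENNReal.ofReal (2 * π) * A + ENNReal.ofReal (2 * π) * (e ^ 2 * (X + Y))
        ≤ ENNReal.ofReal (2 * π) * A + ENNReal.ofReal (2 * π) *
          (e ^ 2 * (Z + e * (ENNReal.ofReal C' * T + C * P))) := by
      calc _ = ENNReal.ofReal (2 * π) * (A + e ^ 2 * X)
            + ENNReal.ofReal (2 * π) * (e ^ 2 * Y) := by ring
        _ ≤ (∫⁻ z, W z * Mp z) + ENNReal.ofReal (2 * π) *
          (e ^ 2 * Z + ENNReal.ofReal C' * e ^ 3 * T)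
            + ENNReal.ofReal (2 * π) * (e ^ 2 * Y) := by gcongr
        _ = ((∫⁻ z, W z * Mp z) + ENNReal.ofReal (2 * π) * (e ^ 2 * Y))
            + ENNReal.ofReal (2 * π) * (e ^ 2 * Z + ENNReal.ofReal C' * e ^ 3 * T) := by ring
        _ ≤ ENNReal.ofReal (2 * π) * (A + C * e ^ 4 * P)
            + ENNReal.ofReal (2 * π) * (e ^ 2 * Z + ENNReal.ofReal C' * e ^ 3 * T) := by
            gcongr
        _ ≤ ENNReal.ofReal (2 * π) * (A + C * (e ^ 3 * 1) * P)
            + ENNReal.ofReal (2 * π) * (e ^ 2 * Z + ENNReal.ofReal C' * e ^ 3 * T) := by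
            rw [pow_succ e 3]; gcongr
        _ = _ := by ring
    have h5 := (ENNReal.add_le_add_iff_left (ENNReal.mul_ne_top h2π' hAfin)).1 hcomb
    have h6 := (ENNReal.mul_le_mul_iff_right h2π h2π').1 h5
    exact (ENNReal.mul_le_mul_iff_right (pow_ne_zero 2 he0) (ENNReal.pow_ne_top het)).1 h6
  have hlim : X + Y ≤ Z := by
    have hD : ENNReal.ofReal C' * T + C * P ≠ ∞ :=
      ENNReal.add_ne_top.2 ⟨ENNReal.mul_ne_top ENNReal.ofReal_ne_top hTfin,
        ENNReal.mul_ne_top hC hPfin⟩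
    have ht : Tendsto (fun ε : ℝ => Z + ENNReal.ofReal ε * (ENNReal.ofReal C' * T + C * P))
        (𝓝[>] 0) (𝓝 (Z + ENNReal.ofReal 0 * (ENNReal.ofReal C' * T + C * P))) := by
      refine Tendsto.const_add _ (ENNReal.Tendsto.mul_const ?_ (Or.inr hD))
      exact (ENNReal.continuous_ofReal.tendsto 0).mono_left nhdsWithin_le_nhds
    rw [ENNReal.ofReal_zero, zero_mul, add_zero] at ht
    refine ge_of_tendsto ht ?_
    filter_upwards [Ioo_mem_nhdsGT hε₀0] with ε hε
    exact hmain ε hε.1 hε.2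
  have hY' : Y = ∫⁻ z in ball 0 r, ENNReal.ofReal (‖F z‖ ^ 2 - ‖f z‖ ^ 2 - δ) * q z :=
    setLIntegral_congr_fun measurableSet_ball fun z hz => by
      simp only [hpb z hz, hg]
  rw [← hY']
  exact hlim.trans (lintegral_mono_set hKsub)

lemma measurable_ofReal_norm_deriv_sq (h : ℂ → ℂ) :
    Measurable fun z => ENNReal.ofReal (‖deriv h z‖ ^ 2) :=
  ((measurable_deriv h).norm.pow_const 2).ennreal_ofReal

lemma lintegral_deriv_le_of_norm_lt (hW : Measurable W) (hq : Measurable q)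
    (hC : C ≠ ∞) (hq' : ∀ z, q z ≠ ∞) (hr0 : 0 < r) (hr : r < 1)
    (hWq : ∀ (z : ℂ) (ε : ℝ), 0 < ε → closedBall z ε ⊆ unitDisk →
      (∫⁻ θ in Ioc (0 : ℝ) (2 * π), W (circleMap z ε θ))
        + ENNReal.ofReal (2 * π) * (ENNReal.ofReal ε ^ 2 * q z)
        ≤ ENNReal.ofReal (2 * π) * (W z + C * ENNReal.ofReal ε ^ 4))
    (hWfin : ∫⁻ z in ball 0 r, W z ≠ ∞)
    (hf : DifferentiableOn ℂ f unitDisk) (hF : DifferentiableOn ℂ F unitDisk)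
    (hs : ∀ z ∈ sphere (0 : ℂ) r, ‖f z‖ = ‖F z‖) (hlt : ∀ z ∈ ball (0 : ℂ) r, ‖f z‖ < ‖F z‖) :
    (∫⁻ z in ball 0 r, W z * ENNReal.ofReal (‖deriv F z‖ ^ 2))
      + ∫⁻ z in ball 0 r, ENNReal.ofReal (‖F z‖ ^ 2 - ‖f z‖ ^ 2) * q z
      ≤ ∫⁻ z in ball 0 r, W z * ENNReal.ofReal (‖deriv f z‖ ^ 2) := by
  set g : ℂ → ℝ := fun z => ‖F z‖ ^ 2 - ‖f z‖ ^ 2 with hg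
  have hcb : ball (0 : ℂ) r ⊆ unitDisk := ball_subset_ball hr.le
  have hgc : ContinuousOn g (ball 0 r) :=
    ((hF.continuousOn.norm.pow 2).sub (hf.continuousOn.norm.pow 2)).mono hcb
  have hgpos : ∀ z ∈ ball (0 : ℂ) r, 0 < g z := fun z hz => by
    have := hlt z hz
    have h0 := norm_nonneg (f z)
    simp only [hg]
    nlinarith
  set S : ℕ → Set ℂ := fun n => ball 0 r ∩ {z | 1 / ((n : ℝ) + 1) < g z} with hS
  have hSm : ∀ n, MeasurableSet (S n) := fun n =>
    (hgc.isOpen_inter_preimage isOpen_ball isOpen_Ioi).measurableSet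
  have hWF : Measurable fun z => W z * ENNReal.ofReal (‖deriv F z‖ ^ 2) :=
    hW.fun_mul (measurable_ofReal_norm_deriv_sq F)
  set h : ℕ → ℂ → ℝ≥0∞ := fun n z =>
    (S n).indicator (fun z => W z * ENNReal.ofReal (‖deriv F z‖ ^ 2)) z
      + ENNReal.ofReal (g z - 1 / ((n : ℝ) + 1)) * q z with hh
  have hhm : ∀ n, AEMeasurable (h n) (volume.restrict (ball 0 r)) := fun n => by
    refine (hWF.indicator (hSm n)).aemeasurable.fun_add (AEMeasurable.fun_mul ?_ hq.aemeasurable)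
    refine ContinuousOn.aemeasurable ?_ measurableSet_ball
    exact ENNReal.continuous_ofReal.comp_continuousOn (hgc.sub continuousOn_const)
  have hle : ∀ n, ∫⁻ z in ball 0 r, h n z
      ≤ ∫⁻ z in ball 0 r, W z * ENNReal.ofReal (‖deriv f z‖ ^ 2) := fun n => by
    rw [hh, lintegral_add_left (hWF.indicator (hSm n)), lintegral_indicator (hSm n),
      Measure.restrict_restrict (hSm n), inter_eq_self_of_subset_left inter_subset_left]
    exact lintegral_deriv_superlevel_le hW hq hC hr0 hr hWq hWfin hf hF hs (by positivity)
  have htend : ∀ z ∈ ball (0 : ℂ) r, Tendsto (fun n => h n z) atTop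
      (𝓝 (W z * ENNReal.ofReal (‖deriv F z‖ ^ 2) + ENNReal.ofReal (g z) * q z)) := fun z hz => by
    have h0 : Tendsto (fun n : ℕ => 1 / ((n : ℝ) + 1)) atTop (𝓝 0) :=
      tendsto_one_div_add_atTop_nhds_zero_nat
    refine Tendsto.add ?_ ?_
    · refine tendsto_const_nhds.congr' ?_
      filter_upwards [h0.eventually_lt_const (hgpos z hz)] with n hn
      rw [indicator_of_mem]
      exact ⟨hz, hn⟩
    · refine ENNReal.Tendsto.mul_const ?_ (Or.inr (hq' z))
      have := (tendsto_const_nhds (x := g z)).sub h0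
      rw [sub_zero] at this
      exact (ENNReal.continuous_ofReal.tendsto _).comp this
  calc _ = ∫⁻ z in ball 0 r,
        (W z * ENNReal.ofReal (‖deriv F z‖ ^ 2) + ENNReal.ofReal (g z) * q z) :=
      (lintegral_add_left hWF _).symm
    _ = ∫⁻ z in ball 0 r, liminf (fun n => h n z) atTop :=
      setLIntegral_congr_fun measurableSet_ball fun z hz => (htend z hz).liminf_eq.symm
    _ ≤ liminf (fun n => ∫⁻ z in ball 0 r, h n z) atTop := lintegral_liminf_le' hhm
    _ ≤ _ := liminf_le_of_frequently_le' (Frequently.of_forall hle)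

/-- Replacing `f` by `F` decreases weighted Dirichlet integrals when `F` has no zeros in a disk,
dominates `f` there and has the same modulus as `f` on the boundary circle. -/
lemma lintegral_deriv_le_of_norm_le (hW : Measurable W) (hq : Measurable q)
    (hC : C ≠ ∞) (hq' : ∀ z, q z ≠ ∞) (hr0 : 0 < r) (hr : r < 1)
    (hWq : ∀ (z : ℂ) (ε : ℝ), 0 < ε → closedBall z ε ⊆ unitDisk →
      (∫⁻ θ in Ioc (0 : ℝ) (2 * π), W (circleMap z ε θ))
        + ENNReal.ofReal (2 * π) * (ENNReal.ofReal ε ^ 2 * q z)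
        ≤ ENNReal.ofReal (2 * π) * (W z + C * ENNReal.ofReal ε ^ 4))
    (hWfin : ∫⁻ z in ball 0 r, W z ≠ ∞)
    (hf : DifferentiableOn ℂ f unitDisk) (hF : DifferentiableOn ℂ F unitDisk)
    (hs : ∀ z ∈ sphere (0 : ℂ) r, ‖f z‖ = ‖F z‖) (hle : ∀ z ∈ ball (0 : ℂ) r, ‖f z‖ ≤ ‖F z‖)
    (hF0 : ∀ z ∈ ball (0 : ℂ) r, F z ≠ 0) :
    (∫⁻ z in ball 0 r, W z * ENNReal.ofReal (‖deriv F z‖ ^ 2))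
      + ∫⁻ z in ball 0 r, ENNReal.ofReal (‖F z‖ ^ 2 - ‖f z‖ ^ 2) * q z
      ≤ ∫⁻ z in ball 0 r, W z * ENNReal.ofReal (‖deriv f z‖ ^ 2) := by
  by_cases hlt : ∀ z ∈ ball (0 : ℂ) r, ‖f z‖ < ‖F z‖
  · exact lintegral_deriv_le_of_norm_lt hW hq hC hq' hr0 hr hWq hWfin hf hF hs hlt
  push Not at hlt
  obtain ⟨a, ha, hFa⟩ := hlt
  have hcb : ball (0 : ℂ) r ⊆ unitDisk := ball_subset_ball hr.le
  have hq1 : ∀ z ∈ ball (0 : ℂ) r, ‖f z / F z‖ ≤ 1 := fun z hz => by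
    rw [norm_div]; exact div_le_one_of_le₀ (hle z hz) (norm_nonneg _)
  have ha1 : ‖f a / F a‖ = 1 := by
    rw [norm_div, le_antisymm (hle a ha) hFa, div_self (norm_ne_zero_iff.2 (hF0 a ha))]
  have hEq := Complex.eqOn_of_isPreconnected_of_isMaxOn_norm
    (f := fun z => f z / F z) (convex_ball (0 : ℂ) r).isPreconnected isOpen_ball
    ((hf.mono hcb).div (hF.mono hcb) hF0) ha
    (fun z hz => by
      change ‖f z / F z‖ ≤ ‖f a / F a‖
      exact (hq1 z hz).trans ha1.ge)
  have hfF : ∀ z ∈ ball (0 : ℂ) r, f z = f a / F a * F z := fun z hz => by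
    rw [← show f z / F z = f a / F a from hEq hz, div_mul_cancel₀ _ (hF0 z hz)]
  have hd : ∀ z ∈ ball (0 : ℂ) r, ‖deriv f z‖ = ‖deriv F z‖ := fun z hz => by
    have : f =ᶠ[𝓝 z] fun z => f a / F a * F z := by
      filter_upwards [isOpen_ball.mem_nhds hz] with w hw using hfF w hw
    rw [this.deriv_eq, deriv_const_mul_field, norm_mul, ha1, one_mul]
  have hn : ∀ z ∈ ball (0 : ℂ) r, ‖f z‖ = ‖F z‖ := fun z hz => by
    rw [hfF z hz, norm_mul, ha1, one_mul]
  have h0 : ∫⁻ z in ball 0 r, ENNReal.ofReal (‖F z‖ ^ 2 - ‖f z‖ ^ 2) * q z = 0 := by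
    rw [setLIntegral_congr_fun measurableSet_ball (g := fun _ => 0)
      (fun z hz => by simp [hn z hz]), lintegral_zero]
  rw [h0, add_zero]
  refine le_of_eq (setLIntegral_congr_fun measurableSet_ball fun z hz => ?_)
  simp only [hd z hz]

end

/-! ### Removing the zeros in a disk -/

lemma norm_sq_sub_conj_mul_sub (r : ℝ) (a z : ℂ) :
    ‖(r : ℂ) ^ 2 - (starRingEnd ℂ) a * z‖ ^ 2 - r ^ 2 * ‖z - a‖ ^ 2
      = (r ^ 2 - ‖a‖ ^ 2) * (r ^ 2 - ‖z‖ ^ 2) := by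
  simp only [← Complex.normSq_eq_norm_sq, Complex.normSq_apply]
  simp [pow_two]
  ring

lemma norm_sub_le_div {r : ℝ} (hr : 0 < r) {a z : ℂ} (ha : ‖a‖ < r) (hz : ‖z‖ ≤ r) :
    ‖z - a‖ ≤ ‖((r : ℂ) ^ 2 - (starRingEnd ℂ) a * z) / r‖ := by
  rw [norm_div, Complex.norm_real, Real.norm_of_nonneg hr.le, le_div_iff₀ hr]
  refine le_of_sq_le_sq ?_ (norm_nonneg _)
  have h := norm_sq_sub_conj_mul_sub r a z
  have h1 : 0 ≤ (r ^ 2 - ‖a‖ ^ 2) * (r ^ 2 - ‖z‖ ^ 2) := by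
    refine mul_nonneg (sub_nonneg.2 ?_) (sub_nonneg.2 ?_)
    · gcongr
    · gcongr
  nlinarith

lemma norm_sub_eq_div {r : ℝ} (hr : 0 < r) {a z : ℂ} (hz : ‖z‖ = r) :
    ‖z - a‖ = ‖((r : ℂ) ^ 2 - (starRingEnd ℂ) a * z) / r‖ := by
  rw [norm_div, Complex.norm_real, Real.norm_of_nonneg hr.le, eq_div_iff hr.ne']
  refine (sq_eq_sq₀ (by positivity) (norm_nonneg _)).1 ?_
  have h := norm_sq_sub_conj_mul_sub r a z
  rw [hz, sub_self, mul_zero] at h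
  nlinarith

lemma exists_div_pow_of_zero {f : ℂ → ℂ} (hf : DifferentiableOn ℂ f unitDisk) {a : ℂ}
    (ha : a ∈ unitDisk) (h0 : ¬∀ᶠ z in 𝓝 a, f z = 0) :
    ∃ (n : ℕ) (G : ℂ → ℂ), DifferentiableOn ℂ G unitDisk ∧ G a ≠ 0 ∧
      ∀ z, f z = (z - a) ^ n * G z := by
  have hopen : IsOpen unitDisk := isOpen_ball
  obtain ⟨n, g, hg, hga, hfg⟩ :=
    ((hf.analyticAt (hopen.mem_nhds ha)).exists_eventuallyEq_pow_smul_nonzero_iff).2 h0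
  classical
  set G : ℂ → ℂ := Function.update (fun z => f z / (z - a) ^ n) a (g a) with hG
  have hGne : ∀ z, z ≠ a → G z = f z / (z - a) ^ n := fun z hz => by
    rw [hG, Function.update_of_ne hz]
  have hGa : G a = g a := by rw [hG, Function.update_self]
  refine ⟨n, G, fun z hz => ?_, by rwa [hGa], fun z => ?_⟩
  · by_cases hza : z = a
    · subst hza
      refine (hg.differentiableAt.congr_of_eventuallyEq ?_).differentiableWithinAt
      filter_upwards [hfg] with w hw
      by_cases hwa : w = z
      · rw [hwa, hGa]
      · rw [hGne w hwa, hw, smul_eq_mul,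
          mul_div_cancel_left₀ _ (pow_ne_zero n (sub_ne_zero.2 hwa))]
    · have hd : DifferentiableAt ℂ (fun w => f w / (w - a) ^ n) z :=
        (hf.differentiableAt (hopen.mem_nhds hz)).fun_div (by fun_prop)
          (pow_ne_zero n (sub_ne_zero.2 hza))
      refine (hd.congr_of_eventuallyEq ?_).differentiableWithinAt
      filter_upwards [isOpen_ne.mem_nhds hza] with w hw using hGne w hw
  · by_cases hza : z = a
    · subst hza
      have := hfg.self_of_nhds
      rw [smul_eq_mul] at this
      by_cases hn : n = 0
      · rw [this, hGa]
      · simp [this, hn]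
    · rw [hGne z hza, mul_div_cancel₀ _ (pow_ne_zero n (sub_ne_zero.2 hza))]

lemma exists_nonvanishing_of_zeros_subset {r : ℝ} (hr0 : 0 < r) (hr : r < 1) (S : Finset ℂ) :
    ∀ f : ℂ → ℂ, DifferentiableOn ℂ f unitDisk →
      (∀ a ∈ ball (0 : ℂ) r, ¬∀ᶠ z in 𝓝 a, f z = 0) →
      (∀ z ∈ ball (0 : ℂ) r, f z = 0 → z ∈ S) →
      ∃ F : ℂ → ℂ, DifferentiableOn ℂ F unitDisk ∧ (∀ z ∈ sphere (0 : ℂ) r, ‖f z‖ = ‖F z‖) ∧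
        (∀ z ∈ ball (0 : ℂ) r, ‖f z‖ ≤ ‖F z‖) ∧ ∀ z ∈ ball (0 : ℂ) r, F z ≠ 0 := by
  classical
  induction S using Finset.induction_on with
  | empty =>
    exact fun f hf _ hS => ⟨f, hf, fun _ _ => rfl, fun _ _ => le_rfl,
      fun z hz h => by simpa using hS z hz h⟩
  | insert a S _ ih =>
    intro f hf h0 hS
    by_cases ha : a ∈ ball (0 : ℂ) r
    swap
    · refine ih f hf h0 fun z hz hfz => ?_
      rcases Finset.mem_insert.1 (hS z hz hfz) with rfl | h
      · exact absurd hz ha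
      · exact h
    obtain ⟨n, G, hG, hGa, hfG'⟩ :=
      exists_div_pow_of_zero hf (ball_subset_ball hr.le ha) (h0 a ha)
    have ha' : ‖a‖ < r := by simpa using ha
    set B : ℂ → ℂ := fun z => ((r : ℂ) ^ 2 - (starRingEnd ℂ) a * z) / r with hB
    have hFd : DifferentiableOn ℂ (fun z => B z ^ n * G z) unitDisk := by
      refine DifferentiableOn.fun_mul (Differentiable.differentiableOn ?_) hG
      simp only [hB]
      fun_prop
    have hle : ∀ z ∈ ball (0 : ℂ) r, ‖f z‖ ≤ ‖B z ^ n * G z‖ := fun z hz => by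
      rw [hfG' z, norm_mul, norm_mul, norm_pow, norm_pow]
      gcongr
      exact norm_sub_le_div hr0 ha' (le_of_lt (by simpa using hz))
    have hB0 : ∀ z ∈ ball (0 : ℂ) r, B z ≠ 0 := fun z hz h => by
      have h1 := norm_sub_le_div hr0 ha' (le_of_lt (by simpa using hz : ‖z‖ < r))
      rw [show ((r : ℂ) ^ 2 - (starRingEnd ℂ) a * z) / r = 0 from h, norm_zero, norm_le_zero_iff,
        sub_eq_zero] at h1
      have h2 := norm_sq_sub_conj_mul_sub r a z
      have h3 : (r : ℂ) ^ 2 - (starRingEnd ℂ) a * z = 0 := by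
        simpa [hB, hr0.ne'] using h
      rw [h3, h1] at h2
      simp only [norm_zero, sub_self] at h2
      have : 0 < r ^ 2 - ‖a‖ ^ 2 := by
        have := norm_nonneg a; nlinarith
      nlinarith
    obtain ⟨F, hF, hFs, hFb, hF0⟩ := ih (fun z => B z ^ n * G z) hFd
      (fun b hb h => h0 b hb (by
        filter_upwards [h, isOpen_ball.mem_nhds hb] with z hz hzb
        simpa [hz] using hle z hzb))
      (fun z hz h => by
        have hGz : G z = 0 := by
          rcases mul_eq_zero.1 h with h | h
          · exact absurd (eq_zero_of_pow_eq_zero h) (hB0 z hz)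
          · exact h
        rcases Finset.mem_insert.1 (hS z hz (by simp [hfG' z, hGz])) with rfl | h'
        · exact absurd hGz hGa
        · exact h')
    refine ⟨F, hF, fun z hz => ?_, fun z hz => (hle z hz).trans (hFb z hz), hF0⟩
    rw [← hFs z hz, hfG' z, norm_mul, norm_mul, norm_pow, norm_pow,
      norm_sub_eq_div hr0 (by simpa using hz)]

lemma exists_nonvanishing_of_ball {r : ℝ} (hr0 : 0 < r) (hr : r < 1) {f : ℂ → ℂ}
    (hf : DifferentiableOn ℂ f unitDisk) (h0 : ∃ z ∈ unitDisk, f z ≠ 0) :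
    ∃ F : ℂ → ℂ, DifferentiableOn ℂ F unitDisk ∧ (∀ z ∈ sphere (0 : ℂ) r, ‖f z‖ = ‖F z‖) ∧
      (∀ z ∈ ball (0 : ℂ) r, ‖f z‖ ≤ ‖F z‖) ∧ ∀ z ∈ ball (0 : ℂ) r, F z ≠ 0 := by
  have hopen : IsOpen unitDisk := isOpen_ball
  have han : AnalyticOnNhd ℂ f unitDisk := hf.analyticOnNhd hopen
  have hpre : IsPreconnected unitDisk := (convex_ball (0 : ℂ) 1).isPreconnected
  obtain ⟨w, hw, hfw⟩ := h0
  have hne : ∀ a ∈ unitDisk, ∀ᶠ z in 𝓝[≠] a, f z ≠ 0 := fun a ha => by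
    rcases (han a ha).eventually_eq_zero_or_eventually_ne_zero with h | h
    · exact absurd (han.eqOn_zero_of_preconnected_of_eventuallyEq_zero hpre ha h hw) hfw
    · exact h
  have hcb : closedBall (0 : ℂ) r ⊆ unitDisk := closedBall_subset_ball hr
  have hfin : (closedBall (0 : ℂ) r ∩ f ⁻¹' {0}).Finite := by
    by_contra hinf
    obtain ⟨x, hx, hacc⟩ := Set.Infinite.exists_accPt_of_subset_isCompact hinf
      (isCompact_closedBall (0 : ℂ) r) inter_subset_left
    rw [accPt_iff_frequently_nhdsNE] at hacc
    obtain ⟨y, hy1, hy2⟩ := (hacc.and_eventually (hne x (hcb hx))).exists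
    exact hy2 hy1.2
  refine exists_nonvanishing_of_zeros_subset hr0 hr hfin.toFinset f hf (fun a ha h => ?_)
    fun z hz h => by simpa [h] using le_of_lt (by simpa using hz : ‖z‖ < r)
  obtain ⟨y, hy1, hy2⟩ := ((hne a (hcb (ball_subset_closedBall ha))).and
    (h.filter_mono nhdsWithin_le_nhds)).exists
  exact hy1 hy2

/-! ### Superharmonic weights -/

section

lemma circleAverage_norm_biquadratic (a b d : ℝ) (z : ℂ) (ε : ℝ) :
    Real.circleAverage (fun w => a + b * ‖w‖ ^ 2 + d * ‖w‖ ^ 4) z ε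
      = a + b * (‖z‖ ^ 2 + ε ^ 2) + d * (‖z‖ ^ 4 + ε ^ 2 * (4 * ‖z‖ ^ 2 + ε ^ 2)) := by
  have h1 : CircleIntegrable (fun _ : ℂ => a) z ε := continuousOn_const.circleIntegrable'
  have h2 : CircleIntegrable (fun w : ℂ => b * ‖w‖ ^ 2) z ε :=
    Continuous.continuousOn (by fun_prop) |>.circleIntegrable'
  have h3 : CircleIntegrable (fun w : ℂ => d * ‖w‖ ^ 4) z ε :=
    Continuous.continuousOn (by fun_prop) |>.circleIntegrable'
  have h12 : CircleIntegrable (fun w : ℂ => a + b * ‖w‖ ^ 2) z ε :=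
    Continuous.continuousOn (by fun_prop) |>.circleIntegrable'
  have e2 : Real.circleAverage (fun w : ℂ => b * ‖w‖ ^ 2) z ε = b * (‖z‖ ^ 2 + ε ^ 2) := by
    rw [← circleAverage_norm_sq_id]
    exact Real.circleAverage_fun_smul (a := b)
  have e3 : Real.circleAverage (fun w : ℂ => d * ‖w‖ ^ 4) z ε
      = d * (‖z‖ ^ 4 + ε ^ 2 * (4 * ‖z‖ ^ 2 + ε ^ 2)) := by
    rw [← circleAverage_norm_pow_four]
    exact Real.circleAverage_fun_smul (a := d)
  rw [Real.circleAverage_fun_add h12 h3, Real.circleAverage_fun_add h1 h2,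
    Real.circleAverage_const, e2, e3]

/-- The weight `ω`, extended by zero outside the unit disk. -/
def diskWeight (ω : ℂ → ℝ) : ℂ → ℝ≥0∞ := unitDisk.indicator fun z => ENNReal.ofReal (ω z)

lemma diskWeight_apply (ω : ℂ → ℝ) {z : ℂ} (hz : z ∈ unitDisk) :
    diskWeight ω z = ENNReal.ofReal (ω z) := indicator_of_mem hz _

variable {ω : ℂ → ℝ}

lemma SuperharmonicOn.measurable_diskWeight (hω : SuperharmonicOn ω) :
    Measurable (diskWeight ω) := by
  have hm : MeasurableSet unitDisk := measurableSet_ball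
  refine measurable_of_restrict_of_restrict_compl hm ?_ ?_
  · have : unitDisk.domRestrict (diskWeight ω)
        = fun z => ENNReal.ofReal (unitDisk.domRestrict ω z) := by
      ext z; exact diskWeight_apply ω z.2
    rw [this]
    exact (lowerSemicontinuous_restrict_iff.2 hω.1).measurable.ennreal_ofReal
  · have : unitDiskᶜ.domRestrict (diskWeight ω) = fun _ => 0 := by
      ext z
      exact indicator_of_notMem (s := unitDisk) z.2 fun z => ENNReal.ofReal (ω z)
    rw [this]
    exact measurable_const

lemma SuperharmonicOn.lintegral_circle_le (hω : SuperharmonicOn ω) {z : ℂ} {ε : ℝ} (hε : 0 < ε)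
    (hsub : closedBall z ε ⊆ unitDisk) :
    ∫⁻ θ in Ioc (0 : ℝ) (2 * π), diskWeight ω (circleMap z ε θ)
      ≤ ENNReal.ofReal (2 * π * ω z) := by
  refine (lintegral_congr fun θ => ?_).trans_le (hω.2 z ε hε hsub)
  exact diskWeight_apply ω (hsub (circleMap_mem_closedBall _ hε.le _))

lemma SuperharmonicOn.lintegral_ball_ne_top (hω : SuperharmonicOn ω) {r : ℝ} (hr : r < 1) :
    ∫⁻ z in ball 0 r, diskWeight ω z ≠ ∞ := by
  refine ne_top_of_le_ne_top ?_ (lintegral_mono_set ball_subset_closedBall)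
  refine (isCompact_closedBall (0 : ℂ) r).induction_on
    (p := fun s => ∫⁻ z in s, diskWeight ω z ≠ ∞) (by simp)
    (fun s t hst ht => ne_top_of_le_ne_top ht (lintegral_mono_set hst))
    (fun s t hs ht => ne_top_of_le_ne_top (ENNReal.add_ne_top.2 ⟨hs, ht⟩)
      (lintegral_union_le _ _ _)) fun z hz => ?_
  refine ⟨ball z (1 - r), mem_nhdsWithin_of_mem_nhds (ball_mem_nhds z (by linarith)), ?_⟩
  refine ne_top_of_le_ne_top ENNReal.ofReal_ne_top
    (lintegral_ball_le_of_circle_le hω.measurable_diskWeight (by linarith) (c := ω z)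
      fun ρ hρ => hω.lintegral_circle_le hρ.1 ?_)
  refine closedBall_subset_ball' ?_
  have := mem_closedBall.1 hz
  linarith [hρ.2]

/-- A positive superharmonic function on the disk is bounded below by a multiple of
`1 - ‖z‖ ^ 2`. -/
lemma SuperharmonicOn.exists_le (hωpos : ∀ z ∈ unitDisk, 0 < ω z) (hω : SuperharmonicOn ω) :
    ∃ c > 0, ∀ z ∈ unitDisk, c * (1 - ‖z‖ ^ 2) ≤ ω z := by
  have hKsub : closedBall (0 : ℂ) (9 / 10) ⊆ unitDisk := closedBall_subset_ball (by norm_num)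
  obtain ⟨z₁, hz₁, hmin⟩ := (hω.1.mono hKsub).exists_isMinOn
    (nonempty_closedBall.2 (by norm_num)) (isCompact_closedBall _ _)
  have hm : 0 < ω z₁ := hωpos z₁ (hKsub hz₁)
  set c := ω z₁ / 2 with hc
  have hc0 : 0 < c := by positivity
  set u : ℂ → ℝ := fun z => 2 + (-3) * ‖z‖ ^ 2 + 1 * ‖z‖ ^ 4 with hu
  have hu2 : ∀ z ∈ unitDisk, u z ≤ 2 := fun z hz => by
    have hz1 : ‖z‖ < 1 := by simpa [unitDisk] using hz
    have := norm_nonneg z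
    have h2 : ‖z‖ ^ 2 ≤ 1 := by nlinarith
    simp only [hu]
    nlinarith [sq_nonneg ‖z‖]
  have hucont : Continuous u := by simp only [hu]; fun_prop
  suffices h : ∀ z ∈ unitDisk, c * u z ≤ ω z by
    refine ⟨c, hc0, fun z hz => le_trans ?_ (h z hz)⟩
    gcongr
    simp only [hu]
    nlinarith [sq_nonneg (1 - ‖z‖ ^ 2)]
  have hK : ∀ z ∈ closedBall (0 : ℂ) (9 / 10), c * u z ≤ ω z := fun z hz => by
    have h1 : ω z₁ ≤ ω z := hmin hz
    have h2 := hu2 z (hKsub hz)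
    nlinarith
  by_contra! hcon
  obtain ⟨z, hz, hlt⟩ := hcon
  have hz1 : ‖z‖ < 1 := by simpa [unitDisk] using hz
  have hlim : Tendsto (fun ρ : ℝ => c * (2 + (-3) * ρ ^ 2 + 1 * ρ ^ 4)) (𝓝[<] 1) (𝓝 0) := by
    have : Continuous fun ρ : ℝ => c * (2 + (-3) * ρ ^ 2 + 1 * ρ ^ 4) := by fun_prop
    have := (this.tendsto 1).mono_left (nhdsWithin_le_nhds (s := Iio 1))
    convert this using 2
    norm_num
  obtain ⟨ρ, hρ, hρz, hρ1⟩ := ((hlim.eventually_lt_const (sub_pos.2 hlt)).and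
    (Ioo_mem_nhdsLT hz1)).exists
  have hρsub : closedBall (0 : ℂ) ρ ⊆ unitDisk := closedBall_subset_ball hρ1
  set v : ℂ → ℝ := fun z => ω z + -(c * u z) with hv
  have hvl : LowerSemicontinuousOn v (closedBall 0 ρ) :=
    (hω.1.mono hρsub).add (Continuous.continuousOn (by fun_prop)).lowerSemicontinuousOn
  obtain ⟨z₂, hz₂, hmin₂⟩ := hvl.exists_isMinOn
    (nonempty_closedBall.2 ((norm_nonneg z).trans hρz.le)) (isCompact_closedBall _ _)
  have hvz₂ : v z₂ ≤ v z := hmin₂ (by simpa using hρz.le)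
  have hz₂9 : 9 / 10 < ‖z₂‖ := by
    by_contra! h
    have := hK z₂ (by simpa using h)
    simp only [hv] at hvz₂
    linarith
  have hz₂ρ : ‖z₂‖ < ρ := by
    refine lt_of_le_of_ne (by simpa using hz₂) fun h => ?_
    have h1 := hωpos z₂ (hρsub hz₂)
    simp only [hv, hu, h] at hvz₂
    simp only [hu] at hρ
    linarith
  set ε := ρ - ‖z₂‖ with hε
  have hε0 : 0 < ε := sub_pos.2 hz₂ρ
  have hεsub : closedBall z₂ ε ⊆ closedBall 0 ρ :=
    closedBall_subset_closedBall' (by simp [hε])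
  have hci : CircleIntegrable (fun w => v z₂ + c * u w) z₂ ε :=
    Continuous.continuousOn (by fun_prop) |>.circleIntegrable'
  have hav : Real.circleAverage (fun w => v z₂ + c * u w) z₂ ε
      = v z₂ + c * (2 + (-3) * (‖z₂‖ ^ 2 + ε ^ 2)
        + 1 * (‖z₂‖ ^ 4 + ε ^ 2 * (4 * ‖z₂‖ ^ 2 + ε ^ 2))) := by
    have := circleAverage_norm_biquadratic (v z₂ + c * 2) (c * (-3)) (c * 1) z₂ ε
    have h2 : (fun w => v z₂ + c * u w)
        = fun w => v z₂ + c * 2 + c * (-3) * ‖w‖ ^ 2 + c * 1 * ‖w‖ ^ 4 := by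
      ext w; simp only [hu]; ring
    rw [h2, this]; ring
  have h1 : ENNReal.ofReal (2 * π * Real.circleAverage (fun w => v z₂ + c * u w) z₂ ε)
      ≤ ENNReal.ofReal (2 * π * ω z₂) := by
    refine (ofReal_circleAverage_le hci).trans
      (le_trans (lintegral_mono fun θ => ?_) (hω.lintegral_circle_le hε0 (hεsub.trans hρsub)))
    have hmem := hεsub (circleMap_mem_closedBall z₂ hε0.le θ)
    rw [diskWeight_apply ω (hρsub hmem)]
    refine ENNReal.ofReal_le_ofReal ?_
    have : v z₂ ≤ v (circleMap z₂ ε θ) := hmin₂ hmem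
    simp only [hv] at this ⊢
    linarith
  rw [ENNReal.ofReal_le_ofReal_iff
    (by have := hωpos z₂ (hρsub hz₂); positivity)] at h1
  have h2 := le_of_mul_le_mul_left h1 (by positivity)
  rw [hav] at h2
  have h3 : 0 < c * (ε ^ 2 * (4 * ‖z₂‖ ^ 2 + ε ^ 2 - 3)) := by
    have : 0 < 4 * ‖z₂‖ ^ 2 + ε ^ 2 - 3 := by nlinarith
    positivity
  simp only [hv, hu] at h2
  nlinarith

/-- The weight `s + s ^ 2 / 2` with `s = 1 - ‖z‖ ^ 2`. -/
def auxWeight (z : ℂ) : ℝ≥0∞ := ENNReal.ofReal (3 / 2 + (-2) * ‖z‖ ^ 2 + 1 / 2 * ‖z‖ ^ 4)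

lemma measurable_auxWeight : Measurable auxWeight := by
  unfold auxWeight; fun_prop

lemma auxWeight_le {z : ℂ} (hz : z ∈ unitDisk) :
    auxWeight z ≤ ENNReal.ofReal (3 / 2 * (1 - ‖z‖ ^ 2)) := by
  have hz1 : ‖z‖ < 1 := by simpa [unitDisk] using hz
  refine ENNReal.ofReal_le_ofReal ?_
  have := norm_nonneg z
  have h2 : ‖z‖ ^ 2 ≤ 1 := by nlinarith
  nlinarith [sq_nonneg ‖z‖]

lemma lintegral_circle_auxWeight {z : ℂ} {ε : ℝ} (hε : 0 < ε)
    (hsub : closedBall z ε ⊆ unitDisk) :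
    (∫⁻ θ in Ioc (0 : ℝ) (2 * π), auxWeight (circleMap z ε θ))
      + ENNReal.ofReal (2 * π) *
        (ENNReal.ofReal ε ^ 2 * ENNReal.ofReal (2 * (1 - ‖z‖ ^ 2)))
      ≤ ENNReal.ofReal (2 * π) * (auxWeight z + ENNReal.ofReal (1 / 2) * ENNReal.ofReal ε ^ 4) := by
  have hnn : ∀ w ∈ unitDisk, 0 ≤ 3 / 2 + (-2) * ‖w‖ ^ 2 + 1 / 2 * ‖w‖ ^ 4 := fun w hw => by
    have hw1 : ‖w‖ < 1 := by simpa [unitDisk] using hw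
    have := norm_nonneg w
    have h2 : ‖w‖ ^ 2 ≤ 1 := by nlinarith
    nlinarith
  have hz : z ∈ unitDisk := hsub (mem_closedBall_self hε.le)
  have hz1 : ‖z‖ < 1 := by simpa [unitDisk] using hz
  have hs0 : 0 ≤ 1 - ‖z‖ ^ 2 := by have := norm_nonneg z; nlinarith
  have hci : CircleIntegrable (fun w : ℂ => 3 / 2 + (-2) * ‖w‖ ^ 2 + 1 / 2 * ‖w‖ ^ 4) z ε :=
    Continuous.continuousOn (by fun_prop) |>.circleIntegrable'
  have hnn' : ∀ w ∈ sphere z |ε|, 0 ≤ 3 / 2 + (-2) * ‖w‖ ^ 2 + 1 / 2 * ‖w‖ ^ 4 := fun w hw =>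
    hnn w (hsub (sphere_subset_closedBall (by rwa [abs_of_pos hε] at hw)))
  have heq := ofReal_circleAverage_eq hci hnn'
  unfold auxWeight
  have hav0 : 0 ≤ Real.circleAverage
      (fun w : ℂ => 3 / 2 + (-2) * ‖w‖ ^ 2 + 1 / 2 * ‖w‖ ^ 4) z ε :=
    Real.circleAverage_nonneg_of_nonneg hnn'
  rw [← heq, ← ENNReal.ofReal_pow hε.le, ← ENNReal.ofReal_pow hε.le,
    ← ENNReal.ofReal_mul (by positivity), ← ENNReal.ofReal_mul (by positivity),
    ← ENNReal.ofReal_mul (by positivity), ← ENNReal.ofReal_add (by positivity) (by positivity),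
    ← ENNReal.ofReal_add (hnn z hz) (by positivity), ← ENNReal.ofReal_mul (by positivity),
    circleAverage_norm_biquadratic]
  refine ENNReal.ofReal_le_ofReal (le_of_eq ?_)
  ring

lemma lintegral_ball_auxWeight_ne_top {r : ℝ} (hr : r < 1) :
    ∫⁻ z in ball 0 r, auxWeight z ≠ ∞ := by
  refine ne_top_of_le_ne_top (b := ∫⁻ _ in ball (0 : ℂ) r, ENNReal.ofReal (3 / 2)) ?_
    (setLIntegral_mono' measurableSet_ball fun z hz =>
      (auxWeight_le (ball_subset_ball hr.le hz)).trans (ENNReal.ofReal_le_ofReal ?_))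
  · rw [setLIntegral_const]
    exact ENNReal.mul_ne_top ENNReal.ofReal_ne_top measure_ball_lt_top.ne
  · nlinarith [sq_nonneg ‖z‖]

end

/-! ### Growth of functions with finite weighted Dirichlet integral -/

lemma exists_norm_deriv_sq_le {f : ℂ → ℂ} (hf : DifferentiableOn ℂ f unitDisk)
    (hI : ∫⁻ z in unitDisk, ENNReal.ofReal (1 - ‖z‖ ^ 2) * ENNReal.ofReal (‖deriv f z‖ ^ 2) ≠ ∞) :
    ∃ B, 0 ≤ B ∧ ∀ z ∈ unitDisk, (1 - ‖z‖) ^ 3 * ‖deriv f z‖ ^ 2 ≤ B := by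
  set I := ∫⁻ z in unitDisk, ENNReal.ofReal (1 - ‖z‖ ^ 2) * ENNReal.ofReal (‖deriv f z‖ ^ 2) with hIdef
  refine ⟨8 * I.toReal, by positivity, fun z hz => ?_⟩
  have hz1 : ‖z‖ < 1 := by simpa [unitDisk] using hz
  set d := (1 - ‖z‖) / 2 with hd
  have hd0 : 0 < d := by simp only [hd]; linarith
  have hsub : ball z d ⊆ unitDisk := ball_subset_ball' (by simp [hd]; linarith)
  have hdf : DifferentiableOn ℂ (deriv f) unitDisk := hf.deriv isOpen_ball
  have h1 := norm_sq_mul_le_lintegral_ball hd0.le (hdf.mono hsub)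
  have h2 : ENNReal.ofReal d * ENNReal.ofReal (π * d ^ 2 * ‖deriv f z‖ ^ 2) ≤ I := by
    calc _ ≤ ENNReal.ofReal d * ∫⁻ w in ball z d, ENNReal.ofReal (‖deriv f w‖ ^ 2) := by gcongr
      _ = ∫⁻ w in ball z d, ENNReal.ofReal d * ENNReal.ofReal (‖deriv f w‖ ^ 2) :=
        (lintegral_const_mul _ (measurable_ofReal_norm_deriv_sq f)).symm
      _ ≤ ∫⁻ w in ball z d, ENNReal.ofReal (1 - ‖w‖ ^ 2) * ENNReal.ofReal (‖deriv f w‖ ^ 2) := by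
        refine setLIntegral_mono' measurableSet_ball fun w hw => ?_
        gcongr
        have hwz : ‖w‖ < ‖z‖ + d := by
          have h3 := norm_le_norm_add_norm_sub' w z
          have h4 : ‖w - z‖ < d := by simpa [dist_eq_norm] using hw
          linarith
        have hw0 := norm_nonneg w
        nlinarith
      _ ≤ I := lintegral_mono_set hsub
  rw [← ENNReal.ofReal_mul hd0.le, ENNReal.ofReal_le_iff_le_toReal hI] at h2
  have h3 : d * (π * d ^ 2 * ‖deriv f z‖ ^ 2) = π * ((1 - ‖z‖) ^ 3 * ‖deriv f z‖ ^ 2) / 8 := by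
    simp only [hd]; ring
  have h4 : 1 * ((1 - ‖z‖) ^ 3 * ‖deriv f z‖ ^ 2) ≤ π * ((1 - ‖z‖) ^ 3 * ‖deriv f z‖ ^ 2) := by
    have : 0 ≤ 1 - ‖z‖ := by linarith
    gcongr
    linarith [Real.pi_gt_three]
  linarith

lemma exists_norm_sq_le {f : ℂ → ℂ} (hf : DifferentiableOn ℂ f unitDisk)
    (hI : ∫⁻ z in unitDisk, ENNReal.ofReal (1 - ‖z‖ ^ 2) * ENNReal.ofReal (‖deriv f z‖ ^ 2) ≠ ∞) :
    ∃ B, 0 ≤ B ∧ ∀ z ∈ unitDisk, (1 - ‖z‖ ^ 2) * ‖f z‖ ^ 2 ≤ B := by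
  obtain ⟨B, hB0, hB⟩ := exists_norm_deriv_sq_le hf hI
  set D := ‖f 0‖ + 2 * √B with hD
  have hD0 : 0 ≤ D := by positivity
  refine ⟨2 * D ^ 2, by positivity, fun z hz => ?_⟩
  have hz1 : ‖z‖ < 1 := by simpa [unitDisk] using hz
  set a := ‖z‖ with ha
  have ha0 : 0 ≤ a := norm_nonneg z
  have hpos : ∀ t ∈ Icc (0 : ℝ) 1, 0 < 1 - t * a := fun t ht => by nlinarith [ht.1, ht.2]
  have hmem : ∀ t ∈ Icc (0 : ℝ) 1, (t : ℂ) * z ∈ unitDisk := fun t ht => by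
    have : ‖(t : ℂ) * z‖ = t * a := by rw [norm_mul, Complex.norm_real, Real.norm_of_nonneg ht.1]
    simp only [unitDisk, mem_ball, dist_zero_right, this]
    linarith [hpos t ht]
  have hder : ∀ t ∈ Icc (0 : ℝ) 1,
      HasDerivAt (fun t : ℝ => f ((t : ℂ) * z)) (deriv f ((t : ℂ) * z) * z) t := fun t ht => by
    have h1 := (hf.differentiableAt (isOpen_ball.mem_nhds (hmem t ht))).hasDerivAt
    have h2 : HasDerivAt (fun t : ℝ => (t : ℂ) * z) z t := by
      simpa using (Complex.ofRealCLM.hasDerivAt (x := t)).mul_const z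
    exact h1.comp t h2
  have hbd : ∀ t ∈ Icc (0 : ℝ) 1,
      HasDerivAt (fun t : ℝ => ‖f 0‖ + 2 * √B * (√(1 - t * a))⁻¹)
        (√B * a / √(1 - t * a) ^ 3) t := fun t ht => by
    have hy := Real.sqrt_pos.2 (hpos t ht)
    have h1 : HasDerivAt (fun t : ℝ => 1 - t * a) (-a) t := by
      simpa using ((hasDerivAt_id t).mul_const a).const_sub 1
    have h2 := (((h1.sqrt (hpos t ht).ne').inv hy.ne').const_mul (2 * √B)).const_add ‖f 0‖
    have h3 : √B * a / √(1 - t * a) ^ 3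
        = 2 * √B * (-(-a / (2 * √(1 - t * a))) / √(1 - t * a) ^ 2) := by
      field_simp
    rw [h3]
    exact h2
  have key := image_norm_le_of_norm_deriv_right_le_deriv_boundary' (a := 0) (b := 1)
    (f := fun t : ℝ => f ((t : ℂ) * z)) (f' := fun t : ℝ => deriv f ((t : ℂ) * z) * z)
    (B := fun t : ℝ => ‖f 0‖ + 2 * √B * (√(1 - t * a))⁻¹)
    (B' := fun t : ℝ => √B * a / √(1 - t * a) ^ 3)
    (fun t ht => (hder t ht).continuousAt.continuousWithinAt)
    (fun t ht => (hder t (Ico_subset_Icc_self ht)).hasDerivWithinAt)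
    (by simp)
    (fun t ht => (hbd t ht).continuousAt.continuousWithinAt)
    (fun t ht => (hbd t (Ico_subset_Icc_self ht)).hasDerivWithinAt)
    (fun t ht => by
      have ht' := Ico_subset_Icc_self ht
      have hy := Real.sqrt_pos.2 (hpos t ht')
      have h1 := hB _ (hmem t ht')
      have h2 : ‖(t : ℂ) * z‖ = t * a := by
        rw [norm_mul, Complex.norm_real, Real.norm_of_nonneg ht.1]
      rw [h2] at h1
      rw [norm_mul, ← ha, le_div_iff₀ (by positivity)]
      have h3 : √(1 - t * a) ^ 3 * ‖deriv f ((t : ℂ) * z)‖ ≤ √B := by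
        refine Real.le_sqrt_of_sq_le ?_
        calc _ = (√(1 - t * a) ^ 2) ^ 3 * ‖deriv f ((t : ℂ) * z)‖ ^ 2 := by ring
          _ ≤ B := by rwa [Real.sq_sqrt (hpos t ht').le]
      nlinarith)
  have hkey := key (right_mem_Icc.2 zero_le_one)
  simp only [Complex.ofReal_one, one_mul] at hkey
  have hy := Real.sqrt_pos.2 (sub_pos.2 hz1)
  have hy1 : √(1 - a) ≤ 1 := Real.sqrt_le_one.2 (by linarith)
  have h1 : √(1 - a) * ‖f z‖ ≤ D := by
    calc _ ≤ √(1 - a) * (‖f 0‖ + 2 * √B * (√(1 - a))⁻¹) := by gcongr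
      _ = √(1 - a) * ‖f 0‖ + 2 * √B := by field_simp
      _ ≤ 1 * ‖f 0‖ + 2 * √B := by gcongr
      _ = D := by rw [hD, one_mul]
  have h2 : (1 - a) * ‖f z‖ ^ 2 ≤ D ^ 2 := by
    calc _ = (√(1 - a) * ‖f z‖) ^ 2 := by rw [mul_pow, Real.sq_sqrt (by linarith)]
      _ ≤ _ := by gcongr
  have h3 : 1 - a ^ 2 ≤ 2 * (1 - a) := by nlinarith
  nlinarith [sq_nonneg ‖f z‖]

/-! ### Approximants without zeros -/

section

variable {ω : ℂ → ℝ} {f : ℂ → ℂ}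

lemma SuperharmonicOn.lintegral_one_sub_norm_sq_ne_top (hωpos : ∀ z ∈ unitDisk, 0 < ω z)
    (hω : SuperharmonicOn ω)
    (hI : ∫⁻ z in unitDisk, diskWeight ω z * ENNReal.ofReal (‖deriv f z‖ ^ 2) ≠ ∞) :
    ∫⁻ z in unitDisk, ENNReal.ofReal (1 - ‖z‖ ^ 2) * ENNReal.ofReal (‖deriv f z‖ ^ 2) ≠ ∞ := by
  obtain ⟨c, hc0, hc⟩ := hω.exists_le hωpos
  have h1 : ENNReal.ofReal c *
      ∫⁻ z in unitDisk, ENNReal.ofReal (1 - ‖z‖ ^ 2) * ENNReal.ofReal (‖deriv f z‖ ^ 2) ≠ ∞ := by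
    have hm : Measurable fun z : ℂ =>
        ENNReal.ofReal (1 - ‖z‖ ^ 2) * ENNReal.ofReal (‖deriv f z‖ ^ 2) :=
      Measurable.fun_mul (by fun_prop) (measurable_ofReal_norm_deriv_sq f)
    rw [← lintegral_const_mul _ hm]
    refine ne_top_of_le_ne_top hI (setLIntegral_mono' measurableSet_ball fun z hz => ?_)
    rw [← mul_assoc, ← ENNReal.ofReal_mul hc0.le, diskWeight_apply ω hz]
    gcongr
    exact hc z hz
  exact fun h => h1 (by rw [h, ENNReal.mul_top (by simpa using hc0)])

/-- Zero-free functions on the disks of radius `r < 1`, dominating `f`, with weighted Dirichlet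
integral not larger than that of `f` and with uniformly bounded weighted `L²` norm. -/
lemma exists_approximants (hωpos : ∀ z ∈ unitDisk, 0 < ω z) (hω : SuperharmonicOn ω)
    (hf : DifferentiableOn ℂ f unitDisk) (h0 : ∃ z ∈ unitDisk, f z ≠ 0)
    (hI : ∫⁻ z in unitDisk, diskWeight ω z * ENNReal.ofReal (‖deriv f z‖ ^ 2) ≠ ∞) :
    ∃ M : ℝ≥0∞, M ≠ ∞ ∧ ∀ r : ℝ, 0 < r → r < 1 → ∃ F : ℂ → ℂ, DifferentiableOn ℂ F unitDisk ∧
      (∀ z ∈ ball (0 : ℂ) r, ‖f z‖ ≤ ‖F z‖) ∧ (∀ z ∈ ball (0 : ℂ) r, F z ≠ 0) ∧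
      (∫⁻ z in ball 0 r, diskWeight ω z * ENNReal.ofReal (‖deriv F z‖ ^ 2)
        ≤ ∫⁻ z in unitDisk, diskWeight ω z * ENNReal.ofReal (‖deriv f z‖ ^ 2)) ∧
      ∫⁻ z in ball 0 r, ENNReal.ofReal (1 - ‖z‖ ^ 2) * ENNReal.ofReal (‖F z‖ ^ 2) ≤ M := by
  have hJ := hω.lintegral_one_sub_norm_sq_ne_top hωpos hI
  obtain ⟨B, hB0, hB⟩ := exists_norm_sq_le hf hJ
  set J := ∫⁻ z in unitDisk, ENNReal.ofReal (1 - ‖z‖ ^ 2) * ENNReal.ofReal (‖deriv f z‖ ^ 2)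
    with hJdef
  refine ⟨ENNReal.ofReal (3 / 2) * J + ENNReal.ofReal B * volume unitDisk,
    ENNReal.add_ne_top.2 ⟨ENNReal.mul_ne_top ENNReal.ofReal_ne_top hJ,
      ENNReal.mul_ne_top ENNReal.ofReal_ne_top measure_ball_lt_top.ne⟩, fun r hr0 hr => ?_⟩
  obtain ⟨F, hF, hFs, hFle, hF0⟩ := exists_nonvanishing_of_ball hr0 hr hf h0
  have hsub : ball (0 : ℂ) r ⊆ unitDisk := ball_subset_ball hr.le
  refine ⟨F, hF, hFle, hF0, ?_, ?_⟩
  · have := lintegral_deriv_le_of_norm_le (q := fun _ => 0) (C := 0) hω.measurable_diskWeight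
      measurable_const ENNReal.zero_ne_top (fun _ => ENNReal.zero_ne_top) hr0 hr
      (fun z ε hε hz => by
        have h1 := hω.lintegral_circle_le hε hz
        rw [ENNReal.ofReal_mul (by positivity),
          ← diskWeight_apply ω (hz (mem_closedBall_self hε.le))] at h1
        simpa using h1)
      (hω.lintegral_ball_ne_top hr) hf hF hFs hFle hF0
    exact (le_self_add.trans this).trans (lintegral_mono_set hsub)
  · have key := lintegral_deriv_le_of_norm_le (q := fun z => ENNReal.ofReal (2 * (1 - ‖z‖ ^ 2)))
      measurable_auxWeight (by fun_prop) (ENNReal.ofReal_ne_top (r := 1 / 2))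
      (fun _ => ENNReal.ofReal_ne_top) hr0 hr
      (fun z ε hε hz => lintegral_circle_auxWeight hε hz)
      (lintegral_ball_auxWeight_ne_top hr) hf hF hFs hFle hF0
    have h1 : ∫⁻ z in ball 0 r, auxWeight z * ENNReal.ofReal (‖deriv f z‖ ^ 2)
        ≤ ENNReal.ofReal (3 / 2) * J := by
      have hm : Measurable fun z : ℂ =>
          ENNReal.ofReal (1 - ‖z‖ ^ 2) * ENNReal.ofReal (‖deriv f z‖ ^ 2) :=
        Measurable.fun_mul (by fun_prop) (measurable_ofReal_norm_deriv_sq f)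
      rw [hJdef, ← lintegral_const_mul _ hm]
      refine (setLIntegral_mono' measurableSet_ball fun z hz => ?_).trans (lintegral_mono_set hsub)
      rw [← mul_assoc, ← ENNReal.ofReal_mul (by norm_num)]
      gcongr
      exact auxWeight_le (hsub hz)
    have h2 : ∫⁻ z in ball 0 r, ENNReal.ofReal (‖F z‖ ^ 2 - ‖f z‖ ^ 2)
        * ENNReal.ofReal (2 * (1 - ‖z‖ ^ 2)) ≤ ENNReal.ofReal (3 / 2) * J :=
      (le_add_self.trans key).trans h1
    calc _ ≤ ∫⁻ z in ball 0 r, (ENNReal.ofReal (‖F z‖ ^ 2 - ‖f z‖ ^ 2)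
        * ENNReal.ofReal (2 * (1 - ‖z‖ ^ 2)) + ENNReal.ofReal B) := by
          refine setLIntegral_mono' measurableSet_ball fun z hz => ?_
          have hz1 : ‖z‖ < 1 := by simpa [unitDisk] using hsub hz
          have hs0 : 0 ≤ 1 - ‖z‖ ^ 2 := by have := norm_nonneg z; nlinarith
          have hle : 0 ≤ ‖F z‖ ^ 2 - ‖f z‖ ^ 2 := by
            have h3 := hFle z hz
            have h4 := norm_nonneg (f z)
            nlinarith
          rw [← ENNReal.ofReal_mul hs0, ← ENNReal.ofReal_mul hle,
            ← ENNReal.ofReal_add (by positivity) hB0]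
          refine ENNReal.ofReal_le_ofReal ?_
          have := hB z (hsub hz)
          nlinarith [mul_nonneg hs0 hle]
      _ = (∫⁻ z in ball 0 r, ENNReal.ofReal (‖F z‖ ^ 2 - ‖f z‖ ^ 2)
        * ENNReal.ofReal (2 * (1 - ‖z‖ ^ 2))) + ENNReal.ofReal B * volume (ball (0 : ℂ) r) := by
          rw [lintegral_add_right _ measurable_const, setLIntegral_const]
      _ ≤ _ := by gcongr

lemma exists_norm_le_of_lintegral_le {M : ℝ≥0∞} (hM : M ≠ ∞) {ρ : ℝ} (hρ : ρ < 1) :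
    ∃ A : ℝ, 0 ≤ A ∧ ∀ (r : ℝ) (F : ℂ → ℂ), (1 + ρ) / 2 ≤ r → r < 1 →
      DifferentiableOn ℂ F unitDisk →
      ∫⁻ z in ball 0 r, ENNReal.ofReal (1 - ‖z‖ ^ 2) * ENNReal.ofReal (‖F z‖ ^ 2) ≤ M →
      ∀ z ∈ closedBall (0 : ℂ) ρ, ‖F z‖ ≤ A := by
  set d := (1 - ρ) / 2 with hd
  have hd0 : 0 < d := by simp only [hd]; linarith
  refine ⟨√(M.toReal / (d * (π * d ^ 2))), Real.sqrt_nonneg _, fun r F hr hr1 hF hFM z hz => ?_⟩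
  have hz' : ‖z‖ ≤ ρ := by simpa using hz
  have hsub : ball z d ⊆ ball 0 r :=
    ball_subset_ball' (by rw [dist_zero_right]; simp only [hd]; linarith)
  have hsub1 : ball z d ⊆ unitDisk := hsub.trans (ball_subset_ball hr1.le)
  have h1 := norm_sq_mul_le_lintegral_ball hd0.le (hF.mono hsub1)
  have h2 : ENNReal.ofReal d * ENNReal.ofReal (π * d ^ 2 * ‖F z‖ ^ 2) ≤ M := by
    calc _ ≤ ENNReal.ofReal d * ∫⁻ w in ball z d, ENNReal.ofReal (‖F w‖ ^ 2) := by gcongr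
      _ = ∫⁻ w in ball z d, ENNReal.ofReal d * ENNReal.ofReal (‖F w‖ ^ 2) :=
        (lintegral_const_mul' _ _ ENNReal.ofReal_ne_top).symm
      _ ≤ ∫⁻ w in ball z d, ENNReal.ofReal (1 - ‖w‖ ^ 2) * ENNReal.ofReal (‖F w‖ ^ 2) := by
        refine setLIntegral_mono' measurableSet_ball fun w hw => ?_
        gcongr
        have hwz : ‖w‖ < ‖z‖ + d := by
          have h3 := norm_le_norm_add_norm_sub' w z
          have h4 : ‖w - z‖ < d := by simpa [dist_eq_norm] using hw
          linarith
        have hw0 := norm_nonneg w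
        nlinarith
      _ ≤ M := (lintegral_mono_set hsub).trans hFM
  rw [← ENNReal.ofReal_mul hd0.le, ENNReal.ofReal_le_iff_le_toReal hM] at h2
  refine Real.le_sqrt_of_sq_le ((le_div_iff₀ (by positivity)).2 ?_)
  linarith

end

/-! ### Locally bounded sequences of holomorphic functions -/

lemma norm_sub_le_mul_norm_sub_of_norm_le {ρ A : ℝ} (hρ : ρ < 1) {F : ℂ → ℂ}
    (hF : DifferentiableOn ℂ F unitDisk)
    (hA : ∀ z ∈ closedBall (0 : ℂ) ((1 + ρ) / 2), ‖F z‖ ≤ A) {z w : ℂ}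
    (hz : z ∈ closedBall (0 : ℂ) ρ) (hw : w ∈ closedBall (0 : ℂ) ρ) :
    ‖F z - F w‖ ≤ A / ((1 - ρ) / 2) * ‖z - w‖ := by
  have hd : 0 < (1 - ρ) / 2 := by linarith
  refine (convex_closedBall (0 : ℂ) ρ).norm_image_sub_le_of_norm_deriv_le
    (fun x hx => hF.differentiableAt (isOpen_ball.mem_nhds (closedBall_subset_ball hρ hx)))
    (fun x hx => ?_) hw hz
  have hsub : closedBall x ((1 - ρ) / 2) ⊆ closedBall (0 : ℂ) ((1 + ρ) / 2) :=
    closedBall_subset_closedBall' (by have := mem_closedBall.1 hx; linarith)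
  refine Complex.norm_deriv_le_of_forall_mem_sphere_norm_le hd ?_
    fun y hy => hA y (hsub (sphere_subset_closedBall hy))
  refine DifferentiableOn.diffContOnCl_ball (U := unitDisk) hF
    (hsub.trans (closedBall_subset_ball (by linarith)))

lemma eventually_forall_norm_sub_lt_of_tendsto {ι : Type*} {l : Filter ι} [l.NeBot] {s : Set ℂ}
    (hs : IsCompact s) {Fs : ι → ℂ → ℂ} {G : ℂ → ℂ} {L : ℝ} (hL : 0 ≤ L)
    (hlip : ∀ᶠ n in l, ∀ z ∈ s, ∀ w ∈ s, ‖Fs n z - Fs n w‖ ≤ L * ‖z - w‖)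
    (hG : ∀ z ∈ s, Tendsto (fun n => Fs n z) l (𝓝 (G z))) {ε : ℝ} (hε : 0 < ε) :
    ∀ᶠ n in l, ∀ z ∈ s, ‖Fs n z - G z‖ < ε := by
  have hGl : ∀ z ∈ s, ∀ w ∈ s, ‖G z - G w‖ ≤ L * ‖z - w‖ := fun z hz w hw =>
    le_of_tendsto ((hG z hz).sub (hG w hw)).norm (hlip.mono fun n hn => hn z hz w hw)
  set δ := ε / (3 * (L + 1)) with hδ
  have hδ0 : 0 < δ := by positivity
  have hLδ : L * δ < ε / 3 := by
    rw [hδ, mul_div_assoc', div_lt_div_iff₀ (by positivity) (by norm_num)]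
    nlinarith
  obtain ⟨t, hts, htf, hst⟩ := hs.finite_cover_balls hδ0
  have ht : ∀ᶠ n in l, ∀ x ∈ t, ‖Fs n x - G x‖ < ε / 3 :=
    (eventually_all_finite htf).2 fun x hx => by
      have := (tendsto_iff_norm_sub_tendsto_zero.1 (hG x (hts hx)))
      exact this.eventually_lt_const (by positivity)
  filter_upwards [hlip, ht] with n hn hnt z hz
  obtain ⟨x, hx, hzx⟩ := mem_iUnion₂.1 (hst hz)
  have hzx' : ‖z - x‖ < δ := by simpa [dist_eq_norm] using hzx
  have h1 := hn z hz x (hts hx)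
  have h2 := hGl x (hts hx) z hz
  rw [norm_sub_rev x z] at h2
  have h3 := hnt x hx
  have h4 : L * ‖z - x‖ ≤ L * δ := by gcongr
  calc ‖Fs n z - G z‖ = ‖(Fs n z - Fs n x) + (Fs n x - G x) + (G x - G z)‖ := by congr 1; ring
    _ ≤ ‖Fs n z - Fs n x‖ + ‖Fs n x - G x‖ + ‖G x - G z‖ := norm_add₃_le
    _ < ε := by linarith

/-- Montel's theorem for the unit disk. -/
lemma exists_tendstoLocallyUniformlyOn_of_norm_le {Fs : ℕ → ℂ → ℂ}
    (hF : ∀ n, DifferentiableOn ℂ (Fs n) unitDisk)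
    (hb : ∀ ρ < 1, ∃ A : ℝ, 0 ≤ A ∧ ∀ᶠ n in atTop, ∀ z ∈ closedBall (0 : ℂ) ρ, ‖Fs n z‖ ≤ A) :
    ∃ (G : ℂ → ℂ) (φ : ℕ → ℕ), StrictMono φ ∧
      TendstoLocallyUniformlyOn (fun k => Fs (φ k)) G atTop unitDisk := by
  have hU : (hyperfilter ℕ : Filter ℕ) ≤ atTop := Nat.hyperfilter_le_atTop
  have hlim : ∀ z ∈ unitDisk, ∃ y, Tendsto (fun n => Fs n z) (hyperfilter ℕ : Filter ℕ) (𝓝 y) := by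
    intro z hz
    obtain ⟨A, -, hA⟩ := hb ‖z‖ (by simpa [unitDisk] using hz)
    obtain ⟨y, -, hy⟩ := (isCompact_closedBall (0 : ℂ) A).ultrafilter_le_nhds
      ((hyperfilter ℕ).map fun n => Fs n z) (by
        rw [le_principal_iff]
        change ∀ᶠ n in (hyperfilter ℕ : Filter ℕ), Fs n z ∈ closedBall (0 : ℂ) A
        filter_upwards [hA.filter_mono hU] with n hn
        simpa using hn z (by simp))
    exact ⟨y, hy⟩
  choose! G hG using hlim
  have hunif : ∀ ρ < 1, ∀ ε > 0, ∀ᶠ n in (hyperfilter ℕ : Filter ℕ),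
      ∀ z ∈ closedBall (0 : ℂ) ρ, ‖Fs n z - G z‖ < ε := by
    intro ρ hρ ε hε
    obtain ⟨A, hA0, hA⟩ := hb ((1 + ρ) / 2) (by linarith)
    refine eventually_forall_norm_sub_lt_of_tendsto (isCompact_closedBall 0 ρ)
      (L := A / ((1 - ρ) / 2)) (div_nonneg hA0 (by linarith)) ?_
      (fun z hz => hG z (closedBall_subset_ball hρ hz)) hε
    filter_upwards [hU hA] with n hn z hz w hw
    exact norm_sub_le_mul_norm_sub_of_norm_le hρ (hF n) hn hz hw
  have hk : ∀ k : ℕ, (0 : ℝ) < 1 / ((k : ℝ) + 1) := fun k => by positivity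
  obtain ⟨φ, hφ, hφP⟩ := extraction_forall_of_frequently
    (P := fun k n => ∀ z ∈ closedBall (0 : ℂ) (1 - 1 / ((k : ℝ) + 1)),
      ‖Fs n z - G z‖ < 1 / ((k : ℝ) + 1))
    fun k => ((hunif _ (by linarith [hk k]) _ (hk k)).frequently).filter_mono hU
  refine ⟨G, φ, hφ, (tendstoLocallyUniformlyOn_iff_forall_isCompact isOpen_ball).2
    fun K hK1 hK => ?_⟩
  obtain ⟨ρ, hρ, hKρ⟩ := exists_lt_subset_ball hK.isClosed hK1
  rw [Metric.tendstoUniformlyOn_iff]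
  intro ε hε
  have h0 := tendsto_one_div_add_atTop_nhds_zero_nat (𝕜 := ℝ)
  filter_upwards [h0.eventually_lt_const hε, h0.eventually_lt_const (sub_pos.2 hρ)] with k h1 h2 z hz
  rw [dist_comm, dist_eq_norm]
  refine (hφP k z (closedBall_subset_closedBall ?_ (ball_subset_closedBall (hKρ hz)))).trans h1
  linarith

/-! ### The dominating zero-free function -/

lemma le_norm_of_forall_mem_sphere {F : ℂ → ℂ} (hF : DifferentiableOn ℂ F unitDisk) {z₀ : ℂ}
    {s m : ℝ} (hs : 0 < s) (hm : 0 < m) (hsub : closedBall z₀ s ⊆ unitDisk)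
    (h0 : ∀ z ∈ closedBall z₀ s, F z ≠ 0) (hle : ∀ z ∈ sphere z₀ s, m ≤ ‖F z‖) :
    m ≤ ‖F z₀‖ := by
  have hd : DiffContOnCl ℂ (fun z => (F z)⁻¹) (ball z₀ s) :=
    (hF.diffContOnCl_ball hsub).inv fun z hz =>
      h0 z (closure_ball_subset_closedBall hz)
  have h1 : ‖(F z₀)⁻¹‖ ≤ m⁻¹ := by
    refine Complex.norm_le_of_forall_mem_frontier_norm_le isBounded_ball hd (fun z hz => ?_)
      (subset_closure (mem_ball_self hs))
    rw [norm_inv]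
    exact inv_anti₀ hm (hle z (frontier_ball_subset_sphere hz))
  rw [norm_inv] at h1
  exact (inv_le_inv₀ (norm_pos_iff.2 (h0 z₀ (mem_closedBall_self hs.le))) hm).1 h1

lemma exists_sphere_forall_ne_zero {f : ℂ → ℂ} (hf : DifferentiableOn ℂ f unitDisk)
    (h0 : ∃ z ∈ unitDisk, f z ≠ 0) {z₀ : ℂ} (hz₀ : z₀ ∈ unitDisk) :
    ∃ s > 0, closedBall z₀ s ⊆ unitDisk ∧ ∀ z ∈ sphere z₀ s, f z ≠ 0 := by
  have hopen : IsOpen unitDisk := isOpen_ball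
  have han : AnalyticOnNhd ℂ f unitDisk := hf.analyticOnNhd hopen
  obtain ⟨w, hw, hfw⟩ := h0
  have hne : ∀ᶠ z in 𝓝[≠] z₀, f z ≠ 0 :=
    (han z₀ hz₀).eventually_eq_zero_or_eventually_ne_zero.resolve_left fun h =>
      hfw (han.eqOn_zero_of_preconnected_of_eventuallyEq_zero
        (convex_ball (0 : ℂ) 1).isPreconnected hz₀ h hw)
  rw [eventually_nhdsWithin_iff] at hne
  obtain ⟨s, hs, h⟩ := nhds_basis_closedBall.eventually_iff.1 (hne.and (hopen.mem_nhds hz₀))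
  exact ⟨s, hs, fun z hz => (h hz).2, fun z hz =>
    (h (sphere_subset_closedBall hz)).1 (ne_of_mem_sphere hz hs.ne')⟩

lemma lintegral_deriv_le_of_tendsto {W : ℂ → ℝ≥0∞} (hW : Measurable W) {C : ℝ≥0∞}
    {Fs : ℕ → ℂ → ℂ} {G : ℂ → ℂ} {r : ℕ → ℝ} (hr : Tendsto r atTop (𝓝 1))
    (hF : ∀ n, DifferentiableOn ℂ (Fs n) unitDisk)
    (hG : TendstoLocallyUniformlyOn Fs G atTop unitDisk)
    (hC : ∀ n, ∫⁻ z in ball 0 (r n), W z * ENNReal.ofReal (‖deriv (Fs n) z‖ ^ 2) ≤ C)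
    (hWt : ∀ z, W z ≠ ∞) :
    ∫⁻ z in unitDisk, W z * ENNReal.ofReal (‖deriv G z‖ ^ 2) ≤ C := by
  have hopen : IsOpen unitDisk := isOpen_ball
  set u : ℕ → ℂ → ℝ≥0∞ := fun n =>
    (ball (0 : ℂ) (r n)).indicator fun z => W z * ENNReal.ofReal (‖deriv (Fs n) z‖ ^ 2) with hu
  have hum : ∀ n, Measurable (u n) := fun n =>
    (hW.fun_mul (measurable_ofReal_norm_deriv_sq (Fs n))).indicator measurableSet_ball
  have huC : ∀ n, ∫⁻ z in unitDisk, u n z ≤ C := fun n =>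
    (setLIntegral_le_lintegral _ _).trans
      ((lintegral_indicator measurableSet_ball _).le.trans (hC n))
  have hD : TendstoLocallyUniformlyOn (deriv ∘ Fs) (deriv G) atTop unitDisk :=
    hG.deriv (Eventually.of_forall hF) hopen
  calc ∫⁻ z in unitDisk, W z * ENNReal.ofReal (‖deriv G z‖ ^ 2)
      ≤ ∫⁻ z in unitDisk, liminf (fun n => u n z) atTop := by
        refine setLIntegral_mono' measurableSet_ball fun z hz => ?_
        have h1 : Tendsto (fun n => deriv (Fs n) z) atTop (𝓝 (deriv G z)) := hD.tendsto_at hz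
        have h2 : Tendsto (fun n => W z * ENNReal.ofReal (‖deriv (Fs n) z‖ ^ 2)) atTop
            (𝓝 (W z * ENNReal.ofReal (‖deriv G z‖ ^ 2))) :=
          ENNReal.Tendsto.const_mul (ENNReal.tendsto_ofReal (h1.norm.pow 2)) (Or.inr (hWt z))
        refine (Tendsto.liminf_eq (h2.congr' ?_)).ge
        filter_upwards [hr.eventually_const_lt (show ‖z‖ < 1 by simpa [unitDisk] using hz)]
          with n hn
        simp only [hu]
        rw [indicator_of_mem (by simpa using hn)]
    _ ≤ liminf (fun n => ∫⁻ z in unitDisk, u n z) atTop := lintegral_liminf_le hum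
    _ ≤ C := by
        refine (liminf_le_liminf (Eventually.of_forall huC)).trans ?_
        simp

lemma exists_nonvanishing_dominating {ω : ℂ → ℝ} {f : ℂ → ℂ} (hωpos : ∀ z ∈ unitDisk, 0 < ω z)
    (hω : SuperharmonicOn ω) (hf : DifferentiableOn ℂ f unitDisk) (h0 : ∃ z ∈ unitDisk, f z ≠ 0)
    (hI : ∫⁻ z in unitDisk, diskWeight ω z * ENNReal.ofReal (‖deriv f z‖ ^ 2) ≠ ∞) :
    ∃ G : ℂ → ℂ, DifferentiableOn ℂ G unitDisk ∧ (∀ z ∈ unitDisk, ‖f z‖ ≤ ‖G z‖) ∧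
      (∀ z ∈ unitDisk, G z ≠ 0) ∧
      ∫⁻ z in unitDisk, diskWeight ω z * ENNReal.ofReal (‖deriv G z‖ ^ 2)
        ≤ ∫⁻ z in unitDisk, diskWeight ω z * ENNReal.ofReal (‖deriv f z‖ ^ 2) := by
  have hopen : IsOpen unitDisk := isOpen_ball
  obtain ⟨M, hM, happ⟩ := exists_approximants hωpos hω hf h0 hI
  set r : ℕ → ℝ := fun n => 1 - 1 / (((n + 1 : ℕ) : ℝ) + 1) with hr
  have hr0 : ∀ n, 0 < r n := fun n => by
    have h1 : 1 / (((n + 1 : ℕ) : ℝ) + 1) < 1 := by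
      rw [div_lt_one (by positivity)]
      push_cast
      linarith [(Nat.cast_nonneg n : (0 : ℝ) ≤ n)]
    simp only [hr]
    linarith
  have hr1 : ∀ n, r n < 1 := fun n => sub_lt_self _ (by positivity)
  have hrt : Tendsto r atTop (𝓝 1) := by
    simpa [hr] using (((tendsto_add_atTop_iff_nat 1).2
      (tendsto_one_div_add_atTop_nhds_zero_nat (𝕜 := ℝ))).const_sub 1)
  choose Fs hF hfF hF0 hFD hFM using fun n => happ (r n) (hr0 n) (hr1 n)
  obtain ⟨G, φ, hφ, hFG⟩ := exists_tendstoLocallyUniformlyOn_of_norm_le hF fun ρ hρ => by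
    obtain ⟨A, hA0, hA⟩ := exists_norm_le_of_lintegral_le hM hρ
    refine ⟨A, hA0, ?_⟩
    filter_upwards [hrt.eventually_const_le (show (1 + ρ) / 2 < 1 by linarith)] with n hn
    exact hA (r n) (Fs n) hn (hr1 n) (hF n) (hFM n)
  have hrφ : Tendsto (fun k => r (φ k)) atTop (𝓝 1) := hrt.comp hφ.tendsto_atTop
  have hlim : ∀ z ∈ unitDisk, Tendsto (fun k => ‖Fs (φ k) z‖) atTop (𝓝 ‖G z‖) :=
    fun z hz => (hFG.tendsto_at hz).norm
  refine ⟨G, hFG.differentiableOn (Eventually.of_forall fun k => hF (φ k)) hopen,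
    fun z hz => ?_, fun z hz => ?_, ?_⟩
  · refine ge_of_tendsto (hlim z hz) ?_
    filter_upwards [hrφ.eventually_const_lt (show ‖z‖ < 1 by simpa [unitDisk] using hz)] with k hk
    exact hfF (φ k) z (by simpa using hk)
  · obtain ⟨s, hs, hsub, hsf⟩ := exists_sphere_forall_ne_zero hf h0 hz
    have hcont : ContinuousOn (fun w => ‖f w‖) (sphere z s) :=
      (hf.continuousOn.mono (sphere_subset_closedBall.trans hsub)).norm
    obtain ⟨x, hx, hmin⟩ := (isCompact_sphere z s).exists_isMinOn
      (NormedSpace.sphere_nonempty.2 hs.le) hcont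
    have hm : 0 < ‖f x‖ := norm_pos_iff.2 (hsf x hx)
    obtain ⟨ρ, hρ, hsubρ⟩ := exists_lt_subset_ball isClosed_closedBall hsub
    refine norm_pos_iff.1 (hm.trans_le (ge_of_tendsto (hlim z hz) ?_))
    filter_upwards [hrφ.eventually_const_lt hρ] with k hk
    have hsubk : closedBall z s ⊆ ball 0 (r (φ k)) := hsubρ.trans (ball_subset_ball hk.le)
    exact le_norm_of_forall_mem_sphere (hF _) hs hm hsub (fun w hw => hF0 _ w (hsubk hw))
      fun w hw => (hmin hw).trans (hfF _ w (hsubk (sphere_subset_closedBall hw)))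
  · refine lintegral_deriv_le_of_tendsto hω.measurable_diskWeight hrφ (fun k => hF (φ k)) hFG
      (fun k => hFD (φ k)) fun z => ?_
    rw [diskWeight]
    by_cases hz : z ∈ unitDisk <;> simp [hz]

lemma lintegral_mul_ofReal_norm_deriv_sq {ω : ℂ → ℝ} (F : ℂ → ℂ) :
    ∫⁻ z in unitDisk, ENNReal.ofReal (‖deriv F z‖ ^ 2 * ω z)
      = ∫⁻ z in unitDisk, diskWeight ω z * ENNReal.ofReal (‖deriv F z‖ ^ 2) := by
  refine setLIntegral_congr_fun measurableSet_ball fun z hz => ?_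
  rw [ENNReal.ofReal_mul (by positivity), diskWeight_apply ω hz, mul_comm]

lemma lintegral_norm_deriv_add_const_mul_ne_top {W : ℂ → ℝ≥0∞} (hW : Measurable W)
    {F G : ℂ → ℂ} (hF : DifferentiableOn ℂ F unitDisk) (hG : DifferentiableOn ℂ G unitDisk)
    (hFI : ∫⁻ z in unitDisk, W z * ENNReal.ofReal (‖deriv F z‖ ^ 2) ≠ ∞)
    (hGI : ∫⁻ z in unitDisk, W z * ENNReal.ofReal (‖deriv G z‖ ^ 2) ≠ ∞) (a b : ℂ) :
    ∫⁻ z in unitDisk, W z * ENNReal.ofReal (‖deriv (fun w => a * F w + b * G w) z‖ ^ 2) ≠ ∞ := by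
  have hm : ∀ (c : ℂ) (h : ℂ → ℂ), Measurable fun z =>
      ENNReal.ofReal (2 * ‖c‖ ^ 2) * (W z * ENNReal.ofReal (‖deriv h z‖ ^ 2)) := fun c h =>
    (hW.fun_mul (measurable_ofReal_norm_deriv_sq h)).const_mul _
  have hle : ∫⁻ z in unitDisk, W z * ENNReal.ofReal (‖deriv (fun w => a * F w + b * G w) z‖ ^ 2)
      ≤ ∫⁻ z in unitDisk,
        (ENNReal.ofReal (2 * ‖a‖ ^ 2) * (W z * ENNReal.ofReal (‖deriv F z‖ ^ 2))
        + ENNReal.ofReal (2 * ‖b‖ ^ 2) * (W z * ENNReal.ofReal (‖deriv G z‖ ^ 2))) := by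
    refine setLIntegral_mono' measurableSet_ball fun z hz => ?_
    have hFz := hF.differentiableAt (isOpen_ball.mem_nhds hz)
    have hGz := hG.differentiableAt (isOpen_ball.mem_nhds hz)
    rw [deriv_fun_add (hFz.const_mul a) (hGz.const_mul b), deriv_const_mul_field,
      deriv_const_mul_field, mul_left_comm, mul_left_comm _ (W z), ← mul_add,
      ← ENNReal.ofReal_mul (by positivity), ← ENNReal.ofReal_mul (by positivity),
      ← ENNReal.ofReal_add (by positivity) (by positivity)]
    gcongr
    have h1 := norm_add_le (a * deriv F z) (b * deriv G z)
    rw [norm_mul, norm_mul] at h1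
    have h2 := norm_nonneg (a * deriv F z + b * deriv G z)
    nlinarith [sq_nonneg (‖a‖ * ‖deriv F z‖ - ‖b‖ * ‖deriv G z‖)]
  refine ne_top_of_le_ne_top ?_ hle
  rw [lintegral_add_left (hm a F), lintegral_const_mul' _ _ ENNReal.ofReal_ne_top,
    lintegral_const_mul' _ _ ENNReal.ofReal_ne_top]
  exact ENNReal.add_ne_top.2 ⟨ENNReal.mul_ne_top ENNReal.ofReal_ne_top hFI,
    ENNReal.mul_ne_top ENNReal.ofReal_ne_top hGI⟩

/-- Let `ω` be a positive superharmonic function on the unit disk.  Every `f ∈ 𝒟_ω` is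
the sum of two nowhere-vanishing functions in `𝒟_ω`. -/
theorem dirichlet_sum_of_nonvanishing (ω : ℂ → ℝ)
    (hωpos : ∀ z ∈ unitDisk, 0 < ω z) (hω : SuperharmonicOn ω)
    (f : unitDisk → ℂ) (hf : dirichletMem ω f) :
    ∃ g₁ g₂ : unitDisk → ℂ, dirichletMem ω g₁ ∧ dirichletMem ω g₂ ∧
      (∀ z : unitDisk, g₁ z ≠ 0) ∧ (∀ z : unitDisk, g₂ z ≠ 0) ∧ f = g₁ + g₂ := by
  have hWm : Measurable (diskWeight ω) := hω.measurable_diskWeight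
  obtain ⟨F, hF, hfF, hFI⟩ := hf
  rw [lintegral_mul_ofReal_norm_deriv_sq] at hFI
  by_cases h0 : ∃ z ∈ unitDisk, F z ≠ 0
  · obtain ⟨G, hG, hFG, hG0, hGI⟩ := exists_nonvanishing_dominating hωpos hω hF h0 hFI.ne
    have hmem : ∀ a b : ℂ, dirichletMem ω fun z => a * F z + b * G z := fun a b =>
      ⟨fun z => a * F z + b * G z, (hF.const_mul a).fun_add (hG.const_mul b), fun _ => rfl, by
        rw [lintegral_mul_ofReal_norm_deriv_sq]
        exact (lintegral_norm_deriv_add_const_mul_ne_top hWm hF hG hFI.ne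
          (hGI.trans_lt hFI).ne a b).lt_top⟩
    refine ⟨fun z => 1 * F z + 2 * G z, fun z => 0 * F z + -2 * G z, hmem 1 2, hmem 0 (-2),
      fun z h => ?_, fun z h => ?_, ?_⟩
    · have h1 : ‖F z‖ = 2 * ‖G z‖ := by
        rw [show F z = -2 * G z by linear_combination h]
        simp
      have h2 : 0 < ‖G z‖ := norm_pos_iff.2 (hG0 z z.2)
      linarith [hFG z z.2]
    · exact hG0 z z.2 (by simpa using h)
    · ext z
      simp only [Pi.add_apply, hfF z]
      ring
  · have hconst : ∀ c : ℂ, dirichletMem ω fun _ => c := fun c =>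
      ⟨fun _ => c, differentiableOn_const c, fun _ => rfl, by simp⟩
    refine ⟨fun _ => 1, fun _ => -1, hconst 1, hconst (-1), by simp, by simp, ?_⟩
    push Not at h0
    ext z
    simp [hfF z, h0 z z.2]
end
end

section
/- Let X be a complex Banach space of holomorphic functions on the open unit disk 𝔻 satisfying conditions (X1), (X2), (X3), and let Y ⊆ X satisfy conditions (Y1), (Y2). Let Λ : X → ℂ be a continuous ℂ-linear functional such that Λ(1) = 1 and Λ(g) ≠ 0 for all g ∈ Y. Then there exists w ∈ 𝔻 such that Λ(f) = f(w) for all f ∈ X. -/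
open scoped ENNReal

noncomputable section

/-- Twice the second elementary symmetric function is the difference between the square of the sum
and the sum of the squares. -/
lemma two_mul_esymm_two {R : Type*} [CommRing R] (s : Multiset R) :
    2 * s.esymm 2 = s.sum ^ 2 - (s.map fun a => a ^ 2).sum := by
  induction s using Multiset.induction_on with
  | empty => simp [Multiset.esymm, Multiset.powersetCard_zero_right]
  | cons a s ih =>
    have h : (a ::ₘ s).esymm 2 = s.esymm 2 + a * s.sum := by
      simpa [Multiset.esymm, Multiset.powersetCard_cons, Multiset.powersetCard_one] using
        Multiset.sum_map_mul_left (s := s) (a := a) (f := id)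
    rw [h, mul_add, ih, Multiset.sum_cons, Multiset.map_cons, Multiset.sum_cons]
    ring

/-- The polynomial in `t` whose values are `L ((t + g) ^ n)`. -/
def powPoly {A : Type*} [CommRing A] [Algebra ℂ A] (L : A →ₗ[ℂ] ℂ) (g : A) (n : ℕ) :
    Polynomial ℂ :=
  ∑ m ∈ Finset.range (n + 1), Polynomial.monomial m (n.choose m * L (g ^ (n - m)))

section

variable {A : Type*} [CommRing A] [Algebra ℂ A] (L : A →ₗ[ℂ] ℂ) (g : A) (n : ℕ)

lemma eval_powPoly (t : ℂ) : (powPoly L g n).eval t = L ((algebraMap ℂ A t + g) ^ n) := by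
  rw [powPoly, add_pow, map_sum, Polynomial.eval_finsetSum]
  refine Finset.sum_congr rfl fun m _ => ?_
  have : algebraMap ℂ A t ^ m * g ^ (n - m) * (n.choose m : A)
      = (t ^ m * n.choose m) • g ^ (n - m) := by
    rw [Algebra.smul_def, map_mul, map_pow, map_natCast]
    ring
  rw [this, map_smul, Polynomial.eval_monomial, smul_eq_mul]
  ring

lemma coeff_powPoly {m : ℕ} (hm : m ≤ n) :
    (powPoly L g n).coeff m = n.choose m * L (g ^ (n - m)) := by
  simp [powPoly, Polynomial.coeff_monomial, hm]

lemma natDegree_powPoly_le : (powPoly L g n).natDegree ≤ n :=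
  Polynomial.natDegree_sum_le_of_forall_le _ _ fun _ hm =>
    (Polynomial.natDegree_monomial_le _).trans (Nat.lt_succ_iff.1 (Finset.mem_range.1 hm))

lemma natDegree_powPoly (h1 : L 1 = 1) : (powPoly L g n).natDegree = n :=
  le_antisymm (natDegree_powPoly_le L g n) <| Polynomial.le_natDegree_of_ne_zero <| by
    simp [coeff_powPoly L g n le_rfl, h1]

lemma monic_powPoly (h1 : L 1 = 1) : (powPoly L g n).Monic := by
  rw [Polynomial.Monic, Polynomial.leadingCoeff, natDegree_powPoly L g n h1,
    coeff_powPoly L g n le_rfl]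
  simp [h1]

/-- A normalized functional that vanishes at no power of `t + g` for large `t` satisfies
`L (g ^ 2) = L g ^ 2`. -/
theorem map_sq_of_forall_pow_ne_zero (h1 : L 1 = 1) (R : ℝ)
    (hR : ∀ t : ℂ, R < ‖t‖ → ∀ n : ℕ, L ((algebraMap ℂ A t + g) ^ n) ≠ 0) :
    L (g ^ 2) = L g ^ 2 := by
  have key : ∀ n : ℕ, (n + 2 : ℝ) * ‖L g ^ 2 - L (g ^ 2)‖ ≤ ‖L (g ^ 2)‖ + R ^ 2 := by
    intro k
    set n := k + 2 with hn
    set P := powPoly L g n with hP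
    have hdeg : P.natDegree = n := natDegree_powPoly L g n h1
    have hmonic : P.Monic := monic_powPoly L g n h1
    have hcard : P.roots.card = P.natDegree :=
      (Polynomial.splits_iff_card_roots.1 (IsAlgClosed.splits P))
    have hlead : P.leadingCoeff = 1 := hmonic
    have hc1 : n * L g = -P.roots.sum := by
      have := Polynomial.coeff_eq_esymm_roots_of_card hcard (k := n - 1) (by omega)
      rw [hdeg, hlead, coeff_powPoly L g n (by omega), show n - (n - 1) = 1 by omega,
        Nat.choose_symm (show 1 ≤ n by omega)] at this
      simpa [Multiset.esymm, Multiset.powersetCard_one] using this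
    have hc2 : (n : ℂ) * (n - 1) * L (g ^ 2) = 2 * P.roots.esymm 2 := by
      have := Polynomial.coeff_eq_esymm_roots_of_card hcard (k := n - 2) (by omega)
      rw [hdeg, hlead, coeff_powPoly L g n (by omega), show n - (n - 2) = 2 by omega,
        Nat.choose_symm (show 2 ≤ n by omega), Nat.cast_choose_two] at this
      linear_combination 2 * this
    have hsum : (n : ℂ) * (n * (L g ^ 2 - L (g ^ 2)))
        = (P.roots.map fun a => a ^ 2).sum - n * L (g ^ 2) := by
      rw [two_mul_esymm_two] at hc2
      linear_combination (n * L g - P.roots.sum) * hc1 - hc2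
    have hroots : ∀ a ∈ P.roots, ‖a‖ ≤ R := by
      intro a ha
      by_contra! h
      exact hR a h n ((eval_powPoly L g n a).symm.trans (Polynomial.isRoot_of_mem_roots ha))
    have hbound : ‖(P.roots.map fun a => a ^ 2).sum‖ ≤ n * R ^ 2 := by
      refine (norm_multiset_sum_le _).trans ?_
      rw [Multiset.map_map]
      refine (Multiset.sum_le_card_nsmul _ (R ^ 2) ?_).trans_eq ?_
      · intro x hx
        obtain ⟨a, ha, rfl⟩ := Multiset.mem_map.1 hx
        simpa using pow_le_pow_left₀ (norm_nonneg a) (hroots a ha) 2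
      · simp [hcard, hdeg]
    have hn0 : (0 : ℝ) < n := by positivity
    have hnorm := congrArg norm hsum
    rw [norm_mul, norm_mul, Complex.norm_natCast] at hnorm
    have htri := norm_sub_le (P.roots.map fun a => a ^ 2).sum (n * L (g ^ 2))
    rw [← hnorm, norm_mul, Complex.norm_natCast] at htri
    have : (n : ℝ) * (n * ‖L g ^ 2 - L (g ^ 2)‖) ≤ n * (‖L (g ^ 2)‖ + R ^ 2) := by linarith
    have := le_of_mul_le_mul_left this hn0
    simpa [hn] using this
  by_contra hne
  have hpos : 0 < ‖L g ^ 2 - L (g ^ 2)‖ := norm_pos_iff.2 (sub_ne_zero.2 (Ne.symm hne))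
  obtain ⟨N, hN⟩ := exists_nat_gt ((‖L (g ^ 2)‖ + R ^ 2) / ‖L g ^ 2 - L (g ^ 2)‖)
  rw [div_lt_iff₀ hpos] at hN
  linarith [key N]

end

/-- A linear functional with `L (f ^ 2) = L f ^ 2` is multiplicative. -/
lemma map_mul_of_map_sq {A : Type*} [CommRing A] [Algebra ℂ A] (L : A →ₗ[ℂ] ℂ)
    (h : ∀ f, L (f ^ 2) = L f ^ 2) (f g : A) : L (f * g) = L f * L g := by
  have h2 := h (f + g)
  rw [show (f + g) ^ 2 = f ^ 2 + (2 : ℂ) • (f * g) + g ^ 2 by rw [two_smul]; ring, map_add, map_add,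
    map_smul, h f, h g, map_add, smul_eq_mul] at h2
  linear_combination h2 / 2

lemma exists_norm_eval_le (q : Polynomial ℂ) :
    ∃ M : ℝ, ∀ z : unitDisk, ‖q.eval (z : ℂ)‖ ≤ M := by
  obtain ⟨M, hM⟩ := (isCompact_closedBall (0 : ℂ) 1).exists_bound_of_continuousOn
    q.continuous.continuousOn
  exact ⟨M, fun z => hM z (Metric.ball_subset_closedBall z.2)⟩

/-- **GKZ theorem in general function spaces.** Let `X` be a complex Banach space of
holomorphic functions on the unit disk (presented via an injective linear embedding
`ι : X →ₗ[ℂ] (𝔻 → ℂ)`), satisfying (X1) point evaluations are continuous, (X2) `X`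
contains the polynomials and they are dense, (X3) `X` is shift-invariant.  Let `Y ⊆ X`
satisfy (Y1) every `g ∈ X` with `0 < inf_𝔻 |g| ≤ sup_𝔻 |g| < ∞` is in `Y`, and (Y2)
every function `z ↦ z - λ` with `|λ| = 1` is in `Y`.  If `Λ : X → ℂ` is a *continuous*
linear functional with `Λ 1 = 1` and `Λ g ≠ 0` for all `g ∈ Y`, then `Λ` is evaluation
at some point `w ∈ 𝔻`. -/
theorem gkz_function_space {X : Type*} [NormedAddCommGroup X] [NormedSpace ℂ X]
    [CompleteSpace X]
    (ι : X →ₗ[ℂ] (unitDisk → ℂ)) (hinj : Function.Injective ι)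
    (hhol : ∀ f : X, HolOn (ι f))
    (hX1 : ∀ w : unitDisk, Continuous fun f : X => ι f w)
    (hX2a : ∀ q : Polynomial ℂ, ∃ f : X, ι f = fun z : unitDisk => q.eval (z : ℂ))
    (hX2b : Dense {f : X | ∃ q : Polynomial ℂ, ι f = fun z : unitDisk => q.eval (z : ℂ)})
    (hX3 : ∀ f : X, ∃ g : X, ι g = fun z : unitDisk => (z : ℂ) * ι f z)
    (Y : Set X)
    (hY1 : ∀ g : X, (∃ c : ℝ, 0 < c ∧ ∀ z : unitDisk, c ≤ ‖ι g z‖) →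
      (∃ C : ℝ, ∀ z : unitDisk, ‖ι g z‖ ≤ C) → g ∈ Y)
    (hY2 : ∀ lam : ℂ, ‖lam‖ = 1 →
      ∀ g : X, (ι g = fun z : unitDisk => (z : ℂ) - lam) → g ∈ Y)
    (Λ : X →L[ℂ] ℂ)
    (h1 : ∀ e : X, (ι e = fun _ => 1) → Λ e = 1)
    (hY : ∀ g ∈ Y, Λ g ≠ 0) :
    ∃ w : unitDisk, ∀ f : X, Λ f = ι f w := by
  choose E hE using hX2a
  let El : Polynomial ℂ →ₗ[ℂ] X :=
    { toFun := E
      map_add' := fun p q => hinj <| by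
        rw [map_add]
        ext z
        simp [hE]
      map_smul' := fun c p => hinj <| by
        rw [map_smul]
        ext z
        simp [hE] }
  let L : Polynomial ℂ →ₗ[ℂ] ℂ := Λ.toLinearMap ∘ₗ El
  have hL : ∀ q, L q = Λ (E q) := fun _ => rfl
  have hL1 : L 1 = 1 := h1 _ (by simp [El, hE])
  have hne : ∀ q : Polynomial ℂ, (∃ c : ℝ, 0 < c ∧ ∀ z : unitDisk, c ≤ ‖q.eval (z : ℂ)‖) →
      L q ≠ 0 := by
    rintro q ⟨c, hc, hq⟩
    obtain ⟨M, hM⟩ := exists_norm_eval_le q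
    exact hY _ (hY1 (E q) ⟨c, hc, fun z => by simpa [hE] using hq z⟩
      ⟨M, fun z => by simpa [hE] using hM z⟩)
  have hsq : ∀ f : Polynomial ℂ, L (f ^ 2) = L f ^ 2 := by
    intro f
    obtain ⟨M, hM⟩ := exists_norm_eval_le f
    refine map_sq_of_forall_pow_ne_zero L f hL1 M fun t ht n => hne _ ?_
    refine ⟨(‖t‖ - M) ^ n, pow_pos (sub_pos.2 ht) n, fun z => ?_⟩
    rw [Polynomial.eval_pow, norm_pow]
    refine pow_le_pow_left₀ (sub_pos.2 ht).le ?_ n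
    have h := norm_sub_le_norm_add t (f.eval (z : ℂ))
    simp only [Polynomial.algebraMap_eq, Polynomial.eval_add, Polynomial.eval_C]
    linarith [hM z]
  let φ : Polynomial ℂ →ₐ[ℂ] ℂ := AlgHom.ofLinearMap L hL1 (map_mul_of_map_sq L hsq)
  set w := L Polynomial.X with hw
  have hLq : ∀ q : Polynomial ℂ, L q = q.eval w := by
    intro q
    have : φ = Polynomial.aeval w := Polynomial.algHom_ext (by simp [φ, hw])
    have h := DFunLike.congr_fun this q
    rwa [Polynomial.coe_aeval_eq_eval] at h
  have hXw : L (Polynomial.X - Polynomial.C w) = 0 := by simp [hLq]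
  have hw1 : ‖w‖ < 1 := by
    by_contra! h
    rcases h.eq_or_lt with h | h
    · exact hY _ (hY2 w h.symm (E (Polynomial.X - Polynomial.C w)) (by simp [hE])) hXw
    · refine hne _ ⟨‖w‖ - 1, sub_pos.2 h, fun z => ?_⟩ hXw
      have hz : ‖(z : ℂ)‖ < 1 := by simpa [unitDisk] using z.2
      have := norm_sub_norm_le w (z : ℂ)
      rw [norm_sub_rev] at this
      simp only [Polynomial.eval_sub, Polynomial.eval_X, Polynomial.eval_C]
      linarith
  let w' : unitDisk := ⟨w, by simpa [unitDisk] using hw1⟩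
  refine ⟨w', congrFun (Continuous.ext_on hX2b Λ.continuous (hX1 w') ?_)⟩
  rintro f ⟨q, hq⟩
  have hf : f = E q := hinj (hq.trans (hE q).symm)
  simpa [hf, hE, hL] using hLq q
end
end

section
/- Let X be a complex Banach space of holomorphic functions on the open unit disk 𝔻 satisfying conditions (X1), (X2), (X3), and let Y ⊆ X satisfy conditions (Y1), (Y2). Let T : X → hol(𝔻) be a continuous ℂ-linear map (hol(𝔻) carrying the topology of locally uniform convergence on 𝔻) such that (Tg)(z) ≠ 0 for all g ∈ Y and all z ∈ 𝔻. Then there exist holomorphic functions φ : 𝔻 → 𝔻 and ψ : 𝔻 → ℂ∖{0} such that Tf = ψ·(f∘φ) for all f ∈ X. -/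
open scoped ENNReal

noncomputable section

/-- A solution of the linear equation `G' = h' G` on `ℂ` is a multiple of `exp h`. -/
theorem eq_mul_exp_of_hasDerivAt {G h h' : ℂ → ℂ} (hh : ∀ s, HasDerivAt h (h' s) s)
    (hG : ∀ s, HasDerivAt G (h' s * G s) s) (h0 : h 0 = 0) (s : ℂ) :
    G s = G 0 * Complex.exp (h s) := by
  have hd : ∀ s, HasDerivAt (fun s => G s * Complex.exp (-h s)) 0 s := fun s =>
    ((hG s).mul (hh s).neg.cexp).congr_deriv (by simp only [Pi.neg_apply]; ring)
  have hc := is_const_of_deriv_eq_zero (fun s => (hd s).differentiableAt)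
    (fun s => (hd s).deriv) s 0
  simp only [h0, neg_zero, Complex.exp_zero, mul_one] at hc
  rw [← hc, mul_assoc, ← Complex.exp_add, neg_add_cancel, Complex.exp_zero, mul_one]

/-- An entire function vanishing at `0` whose real part grows at most linearly is linear. -/
theorem exists_eq_mul_of_re_le {g : ℂ → ℂ} (hg : Differentiable ℂ g) (h0 : g 0 = 0)
    {A K : ℝ} (hA : 0 < A) (hK : 0 ≤ K) (hre : ∀ s, (g s).re ≤ A + K * ‖s‖) :
    ∃ b : ℂ, ∀ s, g s = b * s := by
  have hbound : ∀ s, ‖g s‖ ≤ 2 * (A + K * (2 * ‖s‖ + 1)) := fun s => by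
    have hs := norm_nonneg s
    have hM : 0 < A + K * (2 * ‖s‖ + 1) := by positivity
    refine (Complex.borelCaratheodory_zero (R := 2 * ‖s‖ + 1) hM hg.differentiableOn
      (fun x hx => (hre x).trans ?_) (by positivity) (by simp; linarith) h0).trans ?_
    · have := (mem_ball_zero_iff.mp hx).le
      gcongr
    · rw [div_le_iff₀ (by linarith)]
      gcongr
      linarith
  have hderiv : ∀ c, ‖deriv g c‖ ≤ 2 * A + 8 * K := fun c => by
    have hc := norm_nonneg c
    refine (Complex.norm_deriv_le_of_forall_mem_sphere_norm_le (R := ‖c‖ + 1) (by positivity)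
      hg.diffContOnCl
      (C := 2 * (A + K * (2 * (2 * ‖c‖ + 1) + 1))) fun z hz => (hbound z).trans ?_).trans ?_
    · have : ‖z‖ ≤ 2 * ‖c‖ + 1 := by
        have h1 := mem_sphere_iff_norm.mp hz
        have h2 := norm_sub_norm_le z c
        linarith
      gcongr
    · rw [div_le_iff₀ (by positivity)]
      nlinarith [mul_nonneg hA.le hc, mul_nonneg hK hc]
  have hconst : ∀ s, deriv g s = deriv g 0 := fun s =>
    hg.deriv.apply_eq_apply_of_bounded
      (isBounded_iff_forall_norm_le.mpr ⟨_, by rintro _ ⟨c, rfl⟩; exact hderiv c⟩) s 0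
  refine ⟨deriv g 0, fun s => ?_⟩
  have hd : ∀ s, HasDerivAt (fun s => g s - deriv g 0 * s) 0 s := fun s =>
    ((hg s).hasDerivAt.sub ((hasDerivAt_id s).const_mul (deriv g 0))).congr_deriv
      (by simp [hconst s])
  have := is_const_of_deriv_eq_zero (fun s => (hd s).differentiableAt)
    (fun s => (hd s).deriv) s 0
  simpa [h0, sub_eq_zero] using this

/-- A nowhere vanishing entire function of exponential type is an exponential. -/
theorem exists_eq_mul_exp_of_norm_le {F : ℂ → ℂ} (hF : Differentiable ℂ F)
    (hne : ∀ s, F s ≠ 0) {C K : ℝ} (hK : 0 ≤ K)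
    (hle : ∀ s, ‖F s‖ ≤ C * Real.exp (K * ‖s‖)) :
    ∃ b : ℂ, ∀ s, F s = F 0 * Complex.exp (b * s) := by
  obtain ⟨g, g0, hg⟩ := (hF.deriv.div hF hne).isExactOn_univ.with_val_at 0 0
  have hg' : ∀ s, HasDerivAt g (deriv F s / F s) s := fun s => hg s (Set.mem_univ s)
  have hFg := eq_mul_exp_of_hasDerivAt hg' (G := F)
    (fun s => by rw [div_mul_cancel₀ _ (hne s)]; exact (hF s).hasDerivAt) g0
  have hF0 : 0 < ‖F 0‖ := norm_pos_iff.mpr (hne 0)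
  have hC : 0 < C := hF0.trans_le (by simpa using hle 0)
  obtain ⟨b, hb⟩ := exists_eq_mul_of_re_le (fun s => (hg' s).differentiableAt) g0
    (A := |Real.log (C / ‖F 0‖)| + 1) (by positivity) hK fun s => by
      have h1 : Real.exp (g s).re ≤ Real.exp (Real.log (C / ‖F 0‖) + K * ‖s‖) := by
        rw [Real.exp_add, Real.exp_log (by positivity), div_mul_eq_mul_div,
          le_div_iff₀ hF0, mul_comm, ← Complex.norm_exp, ← norm_mul, ← hFg]
        exact hle s
      linarith [Real.exp_le_exp.mp h1, le_abs_self (Real.log (C / ‖F 0‖))]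
  exact ⟨b, fun s => by rw [← hb]; exact hFg s⟩

section OperatorExponential

variable {X : Type*} [NormedAddCommGroup X] [NormedSpace ℂ X]

theorem apply_aeval_eq_of_apply_pow_eq {M : X →L[ℂ] X} {L : X →L[ℂ] ℂ} {x : X} {b : ℂ}
    (h : ∀ n : ℕ, L ((M ^ n) x) = L x * b ^ n) (q : Polynomial ℂ) :
    L (Polynomial.aeval M q x) = L x * q.eval b := by
  induction q using Polynomial.induction_on' with
  | add p q hp hq => simp [hp, hq, mul_add]
  | monomial n a =>
    have : Polynomial.aeval M (Polynomial.monomial n a) x = a • (M ^ n) x := by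
      rw [Polynomial.aeval_monomial, ← Algebra.smul_def]
      rfl
    rw [this, map_smul, h, Polynomial.eval_monomial, smul_eq_mul]
    ring

theorem apply_pow_of_eigen {M : X →L[ℂ] X} {L : X →L[ℂ] ℂ} {w : ℂ}
    (h : ∀ x, L (M x) = w * L x) (x : X) (n : ℕ) : L ((M ^ n) x) = L x * w ^ n := by
  induction n with
  | zero => simp
  | succ n ih =>
    have hs : (M ^ (n + 1)) x = M ((M ^ n) x) := by rw [pow_succ']; rfl
    rw [hs, h, ih, pow_succ]
    ring

variable [CompleteSpace X]

theorem norm_exp_le_exp_norm (M : X →L[ℂ] X) : ‖NormedSpace.exp M‖ ≤ Real.exp ‖M‖ := by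
  have h := (NormedSpace.exp_series_hasSum_exp' (𝕂 := ℂ) M)
  have h' := (NormedSpace.exp_series_hasSum_exp' (𝕂 := ℝ) ‖M‖)
  rw [← Real.exp_eq_exp_ℝ] at h'
  rw [← h.tsum_eq]
  refine tsum_of_norm_bounded h' fun n => ?_
  rw [norm_smul, smul_eq_mul, norm_inv, Complex.norm_natCast]
  gcongr
  rcases Nat.eq_zero_or_pos n with rfl | hn
  · rw [pow_zero, pow_zero]
    exact ContinuousLinearMap.norm_id_le
  · exact norm_pow_le' M hn

theorem hasDerivAt_apply_exp_smul (M : X →L[ℂ] X) (L : X →L[ℂ] ℂ) (x : X) (s : ℂ) :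
    HasDerivAt (fun s : ℂ => L (NormedSpace.exp (s • M) x))
      (L (NormedSpace.exp (s • M) (M x))) s := by
  have h := hasDerivAt_exp_smul_const (𝕂 := ℂ) M s
  exact (L.hasFDerivAt.comp_hasDerivAt s
    ((ContinuousLinearMap.apply ℂ X x).hasFDerivAt.comp_hasDerivAt s h))

/-- On an eigenvector of the adjoint the operator exponential acts as a scalar exponential. -/
theorem apply_exp_smul_of_eigen {M : X →L[ℂ] X} {L : X →L[ℂ] ℂ} {w : ℂ}
    (h : ∀ x, L (M x) = w * L x) (x : X) (s : ℂ) :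
    L (NormedSpace.exp (s • M) x) = L x * Complex.exp (w * s) := by
  have hcomm : ∀ s : ℂ, NormedSpace.exp (s • M) (M x) = M (NormedSpace.exp (s • M) x) :=
    fun s => by
      have : Commute (NormedSpace.exp (s • M)) M :=
        (((Commute.refl M).smul_left s).exp_left)
      exact DFunLike.congr_fun this.eq x
  have := eq_mul_exp_of_hasDerivAt (h := fun s => w * s) (h' := fun _ => w)
    (G := fun s : ℂ => L (NormedSpace.exp (s • M) x))
    (fun s => by simpa using (hasDerivAt_id s).const_mul w)
    (fun s => by
      have := hasDerivAt_apply_exp_smul M L x s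
      rwa [hcomm, h] at this) (by simp) s
  simpa using this

/-- If a functional does not vanish on the orbit `exp (s M) x`, then it is multiplicative along
the powers of `M`. -/
theorem exists_apply_pow_eq (M : X →L[ℂ] X) (L : X →L[ℂ] ℂ) (x : X)
    (hne : ∀ s : ℂ, L (NormedSpace.exp (s • M) x) ≠ 0) :
    ∃ b : ℂ, ∀ n : ℕ, L ((M ^ n) x) = L x * b ^ n := by
  obtain ⟨b, hb⟩ := exists_eq_mul_exp_of_norm_le
    (fun s => (hasDerivAt_apply_exp_smul M L x s).differentiableAt) hne
    (C := ‖L‖ * ‖x‖) (norm_nonneg M) fun s => by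
      calc ‖L (NormedSpace.exp (s • M) x)‖
          ≤ ‖L‖ * (‖NormedSpace.exp (s • M)‖ * ‖x‖) :=
            L.le_opNorm_of_le (ContinuousLinearMap.le_opNorm _ _)
        _ ≤ ‖L‖ * (Real.exp ‖s • M‖ * ‖x‖) := by gcongr; exact norm_exp_le_exp_norm _
        _ = ‖L‖ * ‖x‖ * Real.exp (‖M‖ * ‖s‖) := by rw [norm_smul, mul_comm ‖s‖]; ring
  refine ⟨b, fun n => ?_⟩
  have key : ∀ n : ℕ, ∀ s : ℂ,
      L (NormedSpace.exp (s • M) ((M ^ n) x)) = L x * b ^ n * Complex.exp (b * s) := by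
    intro n
    induction n with
    | zero => intro s; simpa using hb s
    | succ n ih =>
      intro s
      have h1 := hasDerivAt_apply_exp_smul M L ((M ^ n) x) s
      have h2 : HasDerivAt (fun s => L x * b ^ n * Complex.exp (b * s))
          (L x * b ^ (n + 1) * Complex.exp (b * s)) s :=
        ((((hasDerivAt_id s).const_mul b).cexp).const_mul (L x * b ^ n)).congr_deriv
          (by simp only [id]; ring)
      rw [funext ih] at h1
      rw [← h1.unique h2, pow_succ']
      rfl
  simpa using key n 0

end OperatorExponential

section FunctionSpace

variable {X : Type*} [NormedAddCommGroup X] [NormedSpace ℂ X] [CompleteSpace X]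

/-- If `X` is invariant under multiplication by the coordinate, this multiplication is a bounded
operator on `X`. -/
theorem exists_mulCoord (ι : X →ₗ[ℂ] (unitDisk → ℂ)) (hinj : Function.Injective ι)
    (hX1 : ∀ w : unitDisk, Continuous fun f : X => ι f w)
    (hX3 : ∀ f : X, ∃ g : X, ι g = fun z : unitDisk => (z : ℂ) * ι f z) :
    ∃ M : X →L[ℂ] X, ∀ (f : X) (z : unitDisk), ι (M f) z = (z : ℂ) * ι f z := by
  choose m hm using hX3
  let M₀ : X →ₗ[ℂ] X :=
    { toFun := m
      map_add' := fun f g => hinj (by ext z; simp [hm, mul_add])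
      map_smul' := fun c f => hinj (by ext z; simp [hm, mul_left_comm]) }
  have hM₀ : ∀ (f : X) (z : unitDisk), ι (M₀ f) z = (z : ℂ) * ι f z := fun f z =>
    congrFun (hm f) z
  refine ⟨ContinuousLinearMap.ofSeqClosedGraph (g := M₀) fun u x y hu hMu => hinj ?_, hM₀⟩
  ext z
  rw [hM₀]
  refine tendsto_nhds_unique (((hX1 z).tendsto y).comp hMu) ?_
  simpa [Function.comp_def, hM₀] using (((hX1 z).tendsto x).comp hu).const_mul (z : ℂ)

/-- A continuous functional that vanishes nowhere on `Y` is a nonzero multiple of a point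
evaluation. -/
theorem exists_eq_apply_one_mul_eval (ι : X →ₗ[ℂ] (unitDisk → ℂ)) (hinj : Function.Injective ι)
    (hX1 : ∀ w : unitDisk, Continuous fun f : X => ι f w)
    (hX2a : ∀ q : Polynomial ℂ, ∃ f : X, ι f = fun z : unitDisk => q.eval (z : ℂ))
    (hX2b : Dense {f : X | ∃ q : Polynomial ℂ, ι f = fun z : unitDisk => q.eval (z : ℂ)})
    (hX3 : ∀ f : X, ∃ g : X, ι g = fun z : unitDisk => (z : ℂ) * ι f z)
    (Y : Set X)
    (hY1 : ∀ g : X, (∃ c : ℝ, 0 < c ∧ ∀ z : unitDisk, c ≤ ‖ι g z‖) →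
      (∃ C : ℝ, ∀ z : unitDisk, ‖ι g z‖ ≤ C) → g ∈ Y)
    (hY2 : ∀ lam : ℂ, ‖lam‖ = 1 →
      ∀ g : X, (ι g = fun z : unitDisk => (z : ℂ) - lam) → g ∈ Y)
    (L : X →L[ℂ] ℂ) (hL : ∀ g ∈ Y, L g ≠ 0) {e : X} (he : ∀ z, ι e z = 1) :
    ∃ w : unitDisk, ∀ f : X, L f = L e * ι f w := by
  obtain ⟨M, hM⟩ := exists_mulCoord ι hinj hX1 hX3
  let ev : unitDisk → (X →L[ℂ] ℂ) := fun w => ⟨(LinearMap.proj w).comp ι, hX1 w⟩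
  have hz : ∀ z : unitDisk, ‖(z : ℂ)‖ ≤ 1 := fun z => (mem_ball_zero_iff.mp z.2).le
  have hexp : ∀ (s : ℂ) (z : unitDisk),
      ι (NormedSpace.exp (s • M) e) z = Complex.exp (z * s) := fun s z => by
    have h : ι (NormedSpace.exp (s • M) e) z = ι e z * Complex.exp (z * s) :=
      apply_exp_smul_of_eigen (L := ev z) (fun f => hM f z) e s
    rw [h, he, one_mul]
  have hre : ∀ (s : ℂ) (z : unitDisk), |((z : ℂ) * s).re| ≤ ‖s‖ := fun s z =>
    (Complex.abs_re_le_norm _).trans (by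
      rw [norm_mul]; exact mul_le_of_le_one_left (norm_nonneg s) (hz z))
  have hne : ∀ s : ℂ, L (NormedSpace.exp (s • M) e) ≠ 0 := fun s => by
    refine hL _ (hY1 _ ⟨Real.exp (-‖s‖), Real.exp_pos _, fun z => ?_⟩
      ⟨Real.exp ‖s‖, fun z => ?_⟩) <;> rw [hexp, Complex.norm_exp, Real.exp_le_exp]
    · exact (abs_le.mp (hre s z)).1
    · exact (abs_le.mp (hre s z)).2
  obtain ⟨b, hb⟩ := exists_apply_pow_eq M L e hne
  have hpoly : ∀ (q : Polynomial ℂ) (f : X), (ι f = fun z : unitDisk => q.eval (z : ℂ)) →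
      L f = L e * q.eval b := fun q f hf => by
    have hfe : f = Polynomial.aeval M q e := hinj (by
      ext z
      have h : ι (Polynomial.aeval M q e) z = ι e z * q.eval (z : ℂ) :=
        apply_aeval_eq_of_apply_pow_eq (L := ev z)
          (apply_pow_of_eigen (L := ev z) (fun f => hM f z) e) q
      rw [h, he, one_mul, hf])
    rw [hfe, apply_aeval_eq_of_apply_pow_eq hb]
  have hb1 : ‖b‖ < 1 := by
    by_contra! hb1
    obtain ⟨g, hg⟩ := hX2a (Polynomial.X - Polynomial.C b)
    have hg' : ι g = fun z : unitDisk => (z : ℂ) - b := by simpa using hg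
    refine hL g ?_ (by simpa using hpoly _ g hg)
    rcases hb1.eq_or_lt with hb1 | hb1
    · exact hY2 b hb1.symm g hg'
    · refine hY1 g ⟨‖b‖ - 1, sub_pos.mpr hb1, fun z => ?_⟩ ⟨1 + ‖b‖, fun z => ?_⟩ <;> rw [hg']
      · have := norm_sub_norm_le b (z : ℂ)
        rw [norm_sub_rev] at this
        linarith [hz z]
      · exact (norm_sub_le _ _).trans (by linarith [hz z])
  let w : unitDisk := ⟨b, mem_ball_zero_iff.mpr hb1⟩
  refine ⟨w, congrFun (Continuous.ext_on hX2b L.continuous ((hX1 w).const_mul (L e)) ?_)⟩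
  rintro f ⟨q, hq⟩
  simp only [hq, w]
  exact hpoly q f hq

end FunctionSpace

/-- **Weighted composition operators on general function spaces.** Let `X` be a complex
Banach space of holomorphic functions on the unit disk (presented via an injective
linear embedding `ι : X →ₗ[ℂ] (𝔻 → ℂ)`), satisfying (X1), (X2), (X3), and let `Y ⊆ X`
satisfy (Y1), (Y2).  If `T : X → hol(𝔻)` is a continuous linear map (continuity with
respect to the topology of locally uniform convergence on `𝔻`, expressed below as an
`ε`–`δ` condition at `0` on compact subsets) such that `(Tg)(z) ≠ 0` for all `g ∈ Y`
and `z ∈ 𝔻`, then `Tf = ψ · (f ∘ φ)` for holomorphic `φ : 𝔻 → 𝔻`, `ψ : 𝔻 → ℂ∖{0}`. -/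
theorem function_space_weighted_composition {X : Type*} [NormedAddCommGroup X]
    [NormedSpace ℂ X] [CompleteSpace X]
    (ι : X →ₗ[ℂ] (unitDisk → ℂ)) (hinj : Function.Injective ι)
    (hhol : ∀ f : X, HolOn (ι f))
    (hX1 : ∀ w : unitDisk, Continuous fun f : X => ι f w)
    (hX2a : ∀ q : Polynomial ℂ, ∃ f : X, ι f = fun z : unitDisk => q.eval (z : ℂ))
    (hX2b : Dense {f : X | ∃ q : Polynomial ℂ, ι f = fun z : unitDisk => q.eval (z : ℂ)})
    (hX3 : ∀ f : X, ∃ g : X, ι g = fun z : unitDisk => (z : ℂ) * ι f z)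
    (Y : Set X)
    (hY1 : ∀ g : X, (∃ c : ℝ, 0 < c ∧ ∀ z : unitDisk, c ≤ ‖ι g z‖) →
      (∃ C : ℝ, ∀ z : unitDisk, ‖ι g z‖ ≤ C) → g ∈ Y)
    (hY2 : ∀ lam : ℂ, ‖lam‖ = 1 →
      ∀ g : X, (ι g = fun z : unitDisk => (z : ℂ) - lam) → g ∈ Y)
    (T : X →ₗ[ℂ] (unitDisk → ℂ))
    (hThol : ∀ f : X, HolOn (T f))
    (hTcont : ∀ K : Set ℂ, IsCompact K → K ⊆ unitDisk → ∀ ε : ℝ, 0 < ε →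
      ∃ δ : ℝ, 0 < δ ∧ ∀ f : X, ‖f‖ ≤ δ →
        ∀ z : unitDisk, (z : ℂ) ∈ K → ‖T f z‖ ≤ ε)
    (hne : ∀ g ∈ Y, ∀ z : unitDisk, T g z ≠ 0) :
    ∃ (φ : unitDisk → unitDisk) (ψ : unitDisk → ℂ),
      HolOn (fun z => (φ z : ℂ)) ∧ HolOn ψ ∧ (∀ z : unitDisk, ψ z ≠ 0) ∧
      ∀ (f : X) (z : unitDisk), T f z = ψ z * ι f (φ z) := by
  obtain ⟨e, he⟩ := hX2a 1
  have he1 : ∀ z, ι e z = 1 := fun z => by simp [he]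
  obtain ⟨j, hj⟩ := hX2a Polynomial.X
  have hcont : ∀ z : unitDisk, Continuous fun f : X => T f z := fun z => by
    refine continuous_of_continuousAt_zero ((LinearMap.proj z).comp T : X →ₗ[ℂ] ℂ) ?_
    refine Metric.continuousAt_iff.mpr fun ε hε => ?_
    obtain ⟨δ, hδ, h⟩ := hTcont {(z : ℂ)} isCompact_singleton (by simp) (ε / 2) (half_pos hε)
    refine ⟨δ, hδ, fun {f} hf => ?_⟩
    rw [map_zero, dist_zero_right]
    rw [dist_zero_right] at hf
    exact (h f hf.le z rfl).trans_lt (half_lt_self hε)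
  have hψ : ∀ z, T e z ≠ 0 := hne e (hY1 e ⟨1, one_pos, by simp [he1]⟩ ⟨1, by simp [he1]⟩)
  have hw : ∀ z : unitDisk, ∃ w : unitDisk, ∀ f : X, T f z = T e z * ι f w := fun z =>
    exists_eq_apply_one_mul_eval ι hinj hX1 hX2a hX2b hX3 Y hY1 hY2
      ⟨(LinearMap.proj z).comp T, hcont z⟩ (fun g hg => hne g hg z) he1
  choose φ hφ using hw
  refine ⟨φ, T e, ?_, hThol e, hψ, fun f z => hφ z f⟩
  obtain ⟨E, hE, hTE⟩ := hThol e
  obtain ⟨J, hJ, hTJ⟩ := hThol j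
  refine ⟨fun z => J z / E z, hJ.div hE fun z hz => ?_, fun z => ?_⟩
  · rw [← hTE ⟨z, hz⟩]
    exact hψ _
  · simp only [← hTE, ← hTJ]
    rw [eq_div_iff (hψ z), hφ z j, hj, mul_comm]
    simp only [Polynomial.eval_X]
end
end

section
/- Let X be a complex Banach space of holomorphic functions on the open unit disk 𝔻 satisfying conditions (X1), (X2), (X3), and assume in addition that limsup_{n→∞} ‖u^n‖_X^{1/n} ≤ 1, where u(z) := z (this guarantees that every finite Blaschke product belongs to X). Let T : X → hol(𝔻) be a continuous ℂ-linear map (hol(𝔻) carrying the topology of locally uniform convergence on 𝔻) such that T(B) is an inner function for every finite Blaschke product B, and suppose the range T(X) has ℂ-dimension strictly greater than 1. Then there exist inner functions φ and ψ, with φ non-constant, such that Tf = ψ·(f∘φ) for all f ∈ X. -/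
open scoped ENNReal

noncomputable section

/-- A holomorphic function on the unit disk is *inner* if it is bounded by `1` in
modulus and its radial limits have modulus `1` for almost every `θ ∈ [0, 2π)`. -/
def IsInner (h : unitDisk → ℂ) : Prop :=
  ∃ F : ℂ → ℂ, DifferentiableOn ℂ F unitDisk ∧ (∀ z : unitDisk, h z = F z) ∧
    (∀ z : unitDisk, ‖h z‖ ≤ 1) ∧
    ∀ᵐ θ : ℝ ∂(MeasureTheory.volume.restrict (Set.Ico (0 : ℝ) (2 * Real.pi))),
      Filter.Tendsto (fun r : ℝ => ‖F ((r : ℂ) * Complex.exp ((θ : ℂ) * Complex.I))‖)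
        (nhdsWithin 1 (Set.Iio 1)) (nhds 1)

/-- A *finite Blaschke product*: `z ↦ c · ∏_{j=1}^n (z - aⱼ)/(1 - conj(aⱼ) z)` with
`|c| = 1`, `n ≥ 0` and `a₁, …, aₙ` in the unit disk. -/
def IsFiniteBlaschke (b : unitDisk → ℂ) : Prop :=
  ∃ (n : ℕ) (c : ℂ) (a : Fin n → ℂ), ‖c‖ = 1 ∧ (∀ j, ‖a j‖ < 1) ∧
    ∀ z : unitDisk,
      b z = c * ∏ j, (((z : ℂ) - a j) / (1 - (starRingEnd ℂ) (a j) * (z : ℂ)))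

/-- A unimodular sequence whose pairing with all small Blaschke factors is unimodular is
geometric. -/
theorem geometric_of_norm_blaschke_pairing_eq_one {w : ℕ → ℂ} (hw : ∀ n, ‖w n‖ = 1) {ρ : ℝ}
    (hρ : 0 < ρ) (hρ1 : ρ < 1) {D : Set ℂ} (hD : Dense D)
    (h : ∀ t ∈ D, ‖t‖ < ρ →
      ‖-(starRingEnd ℂ) t * w 0 + (1 - (‖t‖ : ℂ) ^ 2) * ∑' n, t ^ n * w (n + 1)‖ = 1) (n : ℕ) :
    w (n + 1) * w 0 = w n * w 1 := by
  set G : ℂ → ℂ := fun t => ∑' n, t ^ n * w (n + 1) with hG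
  have hsum : ∀ t : ℂ, ‖t‖ < ρ → ∀ k, Summable fun n => t ^ n * w (n + k) := by
    intro t ht k
    refine Summable.of_norm_bounded (summable_geometric_of_lt_one (norm_nonneg t)
      (ht.trans hρ1)) fun n => ?_
    simp [hw]
  have hGd : DifferentiableOn ℂ G (Metric.ball 0 ρ) := by
    refine Complex.differentiableOn_tsum_of_summable_norm
      (summable_geometric_of_lt_one hρ.le hρ1) (fun n => by fun_prop) Metric.isOpen_ball ?_
    intro n t ht
    have ht' : ‖t‖ < ρ := by simpa using ht
    simp only [norm_mul, norm_pow, hw, mul_one]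
    gcongr
  have hone : ∀ t ∈ Metric.ball (0 : ℂ) ρ,
      ‖-(starRingEnd ℂ) t * w 0 + (1 - (‖t‖ : ℂ) ^ 2) * G t‖ = 1 := by
    have hcl := hD.open_subset_closure_inter (Metric.isOpen_ball (x := (0 : ℂ)) (ε := ρ))
    refine Set.EqOn.of_subset_closure (s := Metric.ball (0 : ℂ) ρ ∩ D) ?_ ?_
      continuousOn_const Set.inter_subset_left hcl
    · intro t ht
      exact h t ht.2 (by simpa using ht.1)
    · refine ContinuousOn.norm (ContinuousOn.add ?_ (ContinuousOn.mul ?_ hGd.continuousOn))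
      · exact (((Complex.continuous_conj).neg).mul continuous_const).continuousOn
      · fun_prop
  have hnorm : ∀ t ∈ Metric.ball (0 : ℂ) ρ, ‖G t‖ = ‖w 0 + t * G t‖ := by
    intro t ht
    have ht' : ‖t‖ < ρ := by simpa using ht
    have h1 := hone t ht
    have h0 := hw 0
    have hs : ‖t‖ ^ 2 < 1 := by nlinarith [norm_nonneg t]
    have e1 : ‖-(starRingEnd ℂ) t * w 0 + (1 - (‖t‖ : ℂ) ^ 2) * G t‖ ^ 2 = 1 := by rw [h1]; norm_num
    have e0 : ‖w 0‖ ^ 2 = 1 := by rw [h0]; norm_num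
    rw [← sq_eq_sq₀ (norm_nonneg _) (norm_nonneg _)]
    have et : (‖t‖ : ℂ) ^ 2 = ((t.re * t.re + t.im * t.im : ℝ) : ℂ) := by
      rw [← Complex.normSq_apply, Complex.normSq_eq_norm_sq]; push_cast; rfl
    rw [et] at e1
    rw [← Complex.normSq_eq_norm_sq, Complex.normSq_apply] at e1 e0 hs
    rw [← Complex.normSq_eq_norm_sq, ← Complex.normSq_eq_norm_sq, Complex.normSq_apply,
      Complex.normSq_apply]
    simp only [Complex.add_re, Complex.mul_re, Complex.neg_re, Complex.conj_re, Complex.neg_im,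
      Complex.conj_im, Complex.sub_re, Complex.one_re, Complex.ofReal_re, Complex.sub_im,
      Complex.one_im, Complex.ofReal_im, Complex.add_im, Complex.mul_im] at e1 e0 ⊢
    have hne : 1 - (t.re * t.re + t.im * t.im) ≠ 0 := by linarith
    apply mul_left_cancel₀ hne
    linear_combination e1 - (t.re * t.re + t.im * t.im) * e0 - (1 - (t.re * t.re + t.im * t.im)) * e0
  have hne : ∀ t ∈ Metric.ball (0 : ℂ) ρ, w 0 + t * G t ≠ 0 := by
    intro t ht h0
    have h1 := hnorm t ht
    rw [h0, norm_zero, norm_eq_zero] at h1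
    rw [h1, mul_zero, add_zero] at h0
    have := hw 0
    simp [h0] at this
  have h0mem : (0 : ℂ) ∈ Metric.ball (0 : ℂ) ρ := by simpa using hρ
  have hK := Complex.eqOn_of_isPreconnected_of_isMaxOn_norm (F := ℂ)
    (f := fun t => G t / (w 0 + t * G t)) (c := 0)
    (convex_ball (0 : ℂ) ρ).isPreconnected Metric.isOpen_ball
    (hGd.div ((differentiableOn_const _).add (differentiableOn_id.mul hGd)) hne) h0mem
    (by
      intro t ht
      have a1 : ‖G t / (w 0 + t * G t)‖ = 1 := by
        rw [norm_div, hnorm t ht, div_self (norm_ne_zero_iff.2 (hne t ht))]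
      have a2 : ‖G 0 / (w 0 + 0 * G 0)‖ = 1 := by
        rw [norm_div, hnorm 0 h0mem, div_self (norm_ne_zero_iff.2 (hne 0 h0mem))]
      simp only [Set.mem_ofPred_eq, Function.comp]
      rw [a1, a2])
  have hG0 : G 0 = w 1 := by
    rw [hG]
    simp only
    rw [tsum_eq_single 0 (fun n hn => by simp [hn])]
    simp
  have hw0 : w 0 ≠ 0 := by simpa using hne 0 h0mem
  have hps : HasFPowerSeriesAt (0 : ℂ → ℂ)
      (FormalMultilinearSeries.ofScalars ℂ fun n => w (n + 1) * w 0 - w n * w 1) 0 := by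
    rw [hasFPowerSeriesAt_iff]
    filter_upwards [Metric.ball_mem_nhds (0 : ℂ) hρ] with t ht
    have ht' : ‖t‖ < ρ := by simpa using ht
    have s1 := (hsum t ht' 1).hasSum.mul_right (w 0)
    have s2 := (hsum t ht' 0).hasSum.mul_right (w 1)
    have s3 := s1.sub s2
    have hval : (∑' n, t ^ n * w (n + 0)) = w 0 + t * G t := by
      rw [(hsum t ht' 0).tsum_eq_zero_add, hG]
      simp only
      rw [← tsum_mul_left]
      simp [pow_succ', mul_assoc]
    have hk := hK ht
    simp only [Function.const_apply, zero_mul, add_zero, hG0] at hk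
    rw [div_eq_div_iff (hne t ht) hw0] at hk
    rw [hval, show (∑' n, t ^ n * w (n + 1)) = G t from rfl, hk] at s3
    convert s3 using 1
    · funext k
      simp [FormalMultilinearSeries.coeff_ofScalars]
      ring
    · simp; ring
  have hz := hps.eq_zero
  have := congrArg (fun p => FormalMultilinearSeries.coeff p n) hz
  simp only [FormalMultilinearSeries.coeff_ofScalars] at this
  exact sub_eq_zero.1 (this.trans (by simp [FormalMultilinearSeries.coeff]))

/-- A bounded holomorphic function on the disk whose radial limits vanish almost everywhere
vanishes identically. -/
theorem eqOn_zero_of_radial_limit_zero {F : ℂ → ℂ} (hF : DifferentiableOn ℂ F unitDisk) {C : ℝ}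
    (hC : ∀ z ∈ unitDisk, ‖F z‖ ≤ C)
    (hlim : ∀ᵐ θ : ℝ ∂(MeasureTheory.volume.restrict (Set.Ico (0 : ℝ) (2 * Real.pi))),
      Filter.Tendsto (fun r : ℝ => F ((r : ℂ) * Complex.exp ((θ : ℂ) * Complex.I)))
        (nhdsWithin 1 (Set.Iio 1)) (nhds 0)) {z : ℂ} (hz : z ∈ unitDisk) : F z = 0 := by
  have hz1 : ‖z‖ < 1 := by simpa [unitDisk] using hz
  obtain ⟨s, hs, hs1⟩ := exists_between hz1
  have hs0 : 0 < s := (norm_nonneg z).trans_lt hs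
  have hev : ∀ᶠ r : ℝ in nhdsWithin 1 (Set.Iio 1), s < r ∧ r < 1 := by
    filter_upwards [mem_nhdsWithin_of_mem_nhds (lt_mem_nhds hs1), self_mem_nhdsWithin] with r h1 h2
    exact ⟨h1, h2⟩
  have hmem : ∀ r : ℝ, s < r → r < 1 → ∀ θ : ℝ, circleMap 0 r θ ∈ unitDisk := by
    intro r h1 h2 θ
    simp [unitDisk, abs_of_pos (hs0.trans h1), h2]
  have hval : ∀ᶠ r : ℝ in nhdsWithin 1 (Set.Iio 1),
      (∮ w in C(0, r), (w - z)⁻¹ • F w) = (2 * Real.pi * Complex.I : ℂ) • F z := by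
    filter_upwards [hev] with r hr
    refine DiffContOnCl.circleIntegral_sub_inv_smul (DifferentiableOn.diffContOnCl ?_) ?_
    · refine hF.mono fun w hw => ?_
      rw [closure_ball _ (hs0.trans hr.1).ne'] at hw
      simp only [unitDisk, mem_ball_zero_iff, mem_closedBall_zero_iff] at *
      linarith
    · simpa using hs.trans hr.1
  have hto : Filter.Tendsto (fun r : ℝ => ∮ w in C(0, r), (w - z)⁻¹ • F w)
      (nhdsWithin 1 (Set.Iio 1)) (nhds (∫ _ in (0 : ℝ)..2 * Real.pi, (0 : ℂ))) := by
    simp only [circleIntegral]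
    refine intervalIntegral.tendsto_integral_filter_of_dominated_convergence
      (fun _ => (s - ‖z‖)⁻¹ * C) ?_ ?_ ?_ ?_
    · filter_upwards [hev] with r hr
      have hcF : Continuous fun θ => F (circleMap 0 r θ) :=
        hF.continuousOn.comp_continuous (continuous_circleMap 0 r) (hmem r hr.1 hr.2)
      refine Continuous.aestronglyMeasurable ?_
      simp only [deriv_circleMap]
      refine ((continuous_circleMap 0 r).mul continuous_const).smul (Continuous.smul (f := fun θ => (circleMap 0 r θ - z)⁻¹) ?_ hcF)
      refine ((continuous_circleMap 0 r).sub continuous_const).inv₀ fun θ h0 => ?_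
      have := congrArg norm (sub_eq_zero.1 h0)
      simp [abs_of_pos (hs0.trans hr.1)] at this
      linarith [hr.1]
    · filter_upwards [hev] with r hr
      refine Filter.Eventually.of_forall fun θ _ => ?_
      have hr0 := hs0.trans hr.1
      have h1 : ‖deriv (circleMap 0 r) θ‖ ≤ 1 := by
        simp [deriv_circleMap, abs_of_pos hr0, hr.2.le]
      have h2 : s - ‖z‖ ≤ ‖circleMap 0 r θ - z‖ := by
        have := norm_sub_norm_le (circleMap 0 r θ) z
        simp [abs_of_pos hr0] at this
        linarith [hr.1]
      have h3 := hC _ (hmem r hr.1 hr.2 θ)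
      have h4 : 0 < s - ‖z‖ := by linarith
      rw [norm_smul, norm_smul, norm_inv]
      calc _ ≤ 1 * ((s - ‖z‖)⁻¹ * C) := by gcongr
        _ = _ := one_mul _
    · exact intervalIntegrable_const
    · rw [MeasureTheory.ae_restrict_iff' measurableSet_Ico] at hlim
      have hne : ∀ᵐ θ : ℝ, θ ≠ 2 * Real.pi := by
        simp [MeasureTheory.ae_iff]
      filter_upwards [hlim, hne] with θ hθ hθ2 hmemθ
      rw [Set.uIoc_of_le Real.two_pi_pos.le] at hmemθ
      have hl := hθ ⟨hmemθ.1.le, lt_of_le_of_ne hmemθ.2 hθ2⟩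
      have hb : Filter.IsBoundedUnder (· ≤ ·) (nhdsWithin 1 (Set.Iio 1)) (norm ∘ fun r : ℝ =>
          deriv (circleMap 0 r) θ * (circleMap 0 r θ - z)⁻¹) := by
        refine Filter.isBoundedUnder_of_eventually_le (a := 1 * (s - ‖z‖)⁻¹) ?_
        filter_upwards [hev] with r hr
        have hr0 := hs0.trans hr.1
        have h1 : ‖deriv (circleMap 0 r) θ‖ ≤ 1 := by
          simp [deriv_circleMap, abs_of_pos hr0, hr.2.le]
        have h2 : s - ‖z‖ ≤ ‖circleMap 0 r θ - z‖ := by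
          have := norm_sub_norm_le (circleMap 0 r θ) z
          simp [abs_of_pos hr0] at this
          linarith [hr.1]
        have h4 : 0 < s - ‖z‖ := by linarith
        simp only [Function.comp, norm_mul, norm_inv]
        gcongr
      have := hl.zero_mul_isBoundedUnder_le hb
      refine this.congr fun r => ?_
      simp only [smul_eq_mul, circleMap, zero_add]
      ring
  have huniq := tendsto_nhds_unique (hto.congr' hval) tendsto_const_nhds
  simpa [Real.pi_ne_zero, eq_comm] using huniq

/-- A holomorphic function on the disk dominated by another one is divisible by it. -/
theorem exists_holomorphic_quotient {F G : ℂ → ℂ} (hF : DifferentiableOn ℂ F unitDisk)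
    (hG : DifferentiableOn ℂ G unitDisk) (hle : ∀ z ∈ unitDisk, ‖F z‖ ≤ ‖G z‖)
    (hne : ∃ z ∈ unitDisk, G z ≠ 0) :
    ∃ H : ℂ → ℂ, DifferentiableOn ℂ H unitDisk ∧ (∀ z ∈ unitDisk, F z = G z * H z) ∧
      (∀ z ∈ unitDisk, ‖H z‖ ≤ 1) ∧
      ∀ P : ℂ → ℂ, ContinuousOn P unitDisk → (∀ z ∈ unitDisk, G z ≠ 0 → P z = 0) →
        ∀ z ∈ unitDisk, P z = 0 := by
  have hopen : IsOpen unitDisk := Metric.isOpen_ball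
  have hGne : ∀ z ∈ unitDisk, ∀ᶠ w in nhdsWithin z {z}ᶜ, G w ≠ 0 := by
    intro z hz
    obtain ⟨z₁, hz₁, h₁⟩ := hne
    rcases (hG.analyticAt (hopen.mem_nhds hz)).eventually_eq_zero_or_eventually_ne_zero with h | h
    · exact absurd ((hG.analyticOnNhd hopen).eqOn_zero_of_preconnected_of_eventuallyEq_zero
        (convex_ball (0 : ℂ) 1).isPreconnected hz h hz₁) h₁
    · exact h
  have hident : ∀ P : ℂ → ℂ, ContinuousOn P unitDisk → (∀ z ∈ unitDisk, G z ≠ 0 → P z = 0) →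
      ∀ z ∈ unitDisk, P z = 0 := by
    intro P hP h z hz
    have h1 : Filter.Tendsto P (nhdsWithin z {z}ᶜ) (nhds (P z)) :=
      (hP.continuousAt (hopen.mem_nhds hz)).tendsto.mono_left nhdsWithin_le_nhds
    refine tendsto_nhds_unique (h1.congr' ?_) tendsto_const_nhds
    filter_upwards [hGne z hz, mem_nhdsWithin_of_mem_nhds (hopen.mem_nhds hz)] with w h2 h3
    exact h w h3 h2
  have hquot : ∀ z ∈ unitDisk, ‖F z / G z‖ ≤ 1 := by
    intro z hz
    rw [norm_div]
    exact div_le_one_of_le₀ (hle z hz) (norm_nonneg _)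
  set H : ℂ → ℂ := fun z => (nhdsWithin z {z}ᶜ).limUnder fun w => F w / G w with hH
  have hHeq : ∀ z ∈ unitDisk, G z ≠ 0 → H z = F z / G z := by
    intro z hz h0
    refine Filter.Tendsto.limUnder_eq ?_
    have : ContinuousAt (fun w => F w / G w) z :=
      (hF.continuousOn.continuousAt (hopen.mem_nhds hz)).div
        (hG.continuousOn.continuousAt (hopen.mem_nhds hz)) h0
    exact this.tendsto.mono_left nhdsWithin_le_nhds
  have hHd : DifferentiableOn ℂ H unitDisk := by
    intro z hz
    have hev : ∀ᶠ w in nhdsWithin z {z}ᶜ, G w ≠ 0 ∧ w ∈ unitDisk :=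
      (hGne z hz).and (mem_nhdsWithin_of_mem_nhds (hopen.mem_nhds hz))
    rw [eventually_nhdsWithin_iff] at hev
    have hs : {w | w ∈ ({z}ᶜ : Set ℂ) → G w ≠ 0 ∧ w ∈ unitDisk} ∈ nhds z := hev
    have hd := Complex.differentiableOn_update_limUnder_of_bddAbove
      (f := fun w => F w / G w) hs
      (fun w hw => by
        have := hw.1 hw.2
        exact ((hF.differentiableAt (hopen.mem_nhds this.2)).div
          (hG.differentiableAt (hopen.mem_nhds this.2)) this.1).differentiableWithinAt)
      ⟨1, by
        rintro _ ⟨w, hw, rfl⟩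
        exact hquot w (hw.1 hw.2).2⟩
    refine DifferentiableAt.differentiableWithinAt ?_
    refine (hd.differentiableAt hs).congr_of_eventuallyEq ?_
    filter_upwards [hs] with w hw
    by_cases hwz : w = z
    · subst hwz
      simp [hH]
    · rw [Function.update_of_ne hwz]
      exact hHeq w (hw hwz).2 (hw hwz).1
  refine ⟨H, hHd, fun z hz => sub_eq_zero.1 ?_, fun z hz => ?_, hident⟩
  · refine hident (fun z => F z - G z * H z) ?_ ?_ z hz
    · exact hF.continuousOn.sub (hG.continuousOn.mul hHd.continuousOn)
    · intro w hw h0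
      rw [hHeq w hw h0]
      field_simp
      ring
  · have := hident (fun z => ((max ‖H z‖ 1 - 1 : ℝ) : ℂ)) ?_ ?_ z hz
    · have h2 : max ‖H z‖ 1 - 1 = 0 := by exact_mod_cast this
      linarith [le_max_left ‖H z‖ 1]
    · exact Complex.continuous_ofReal.comp_continuousOn
        ((hHd.continuousOn.norm.sup continuousOn_const).sub continuousOn_const)
    · intro w hw h0
      rw [hHeq w hw h0, max_eq_right (hquot w hw)]
      simp

/-- The extension by zero of a function on the unit disk to the complex plane. -/
def diskExtend (h : unitDisk → ℂ) : ℂ → ℂ := Function.extend Subtype.val h 0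

theorem diskExtend_apply (h : unitDisk → ℂ) (z : unitDisk) : diskExtend h z = h z :=
  Subtype.val_injective.extend_apply h 0 z

theorem HolOn.differentiableOn_diskExtend {h : unitDisk → ℂ} (hh : HolOn h) :
    DifferentiableOn ℂ (diskExtend h) unitDisk := by
  obtain ⟨F, hF, hFh⟩ := hh
  refine hF.congr fun z hz => ?_
  rw [diskExtend_apply h ⟨z, hz⟩, hFh]

theorem eventually_radial_mem_unitDisk (θ : ℝ) :
    ∀ᶠ r : ℝ in nhdsWithin 1 (Set.Iio 1),
      (r : ℂ) * Complex.exp ((θ : ℂ) * Complex.I) ∈ unitDisk := by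
  filter_upwards [mem_nhdsWithin_of_mem_nhds (lt_mem_nhds zero_lt_one), self_mem_nhdsWithin]
    with r h1 h2
  simpa [unitDisk, Complex.norm_exp_ofReal_mul_I, abs_of_pos h1] using h2

theorem IsInner.ae_tendsto_diskExtend {h : unitDisk → ℂ} (hh : IsInner h) :
    ∀ᵐ θ : ℝ ∂(MeasureTheory.volume.restrict (Set.Ico (0 : ℝ) (2 * Real.pi))),
      Filter.Tendsto (fun r : ℝ => ‖diskExtend h ((r : ℂ) * Complex.exp ((θ : ℂ) * Complex.I))‖)
        (nhdsWithin 1 (Set.Iio 1)) (nhds 1) := by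
  obtain ⟨F, -, hFh, -, hlim⟩ := hh
  filter_upwards [hlim] with θ hθ
  refine hθ.congr' ?_
  filter_upwards [eventually_radial_mem_unitDisk θ] with r hr
  rw [diskExtend_apply h ⟨_, hr⟩, hFh]

theorem IsInner.norm_diskExtend_le {h : unitDisk → ℂ} (hh : IsInner h) (z : ℂ) :
    ‖diskExtend h z‖ ≤ 1 := by
  obtain ⟨F, -, -, hb, -⟩ := hh
  by_cases hz : z ∈ unitDisk
  · rw [diskExtend_apply h ⟨z, hz⟩]
    exact hb _
  · rw [diskExtend, Function.extend_apply']
    · simp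
    · rintro ⟨w, rfl⟩
      exact hz w.2

/-- In a Banach space of functions on the disk that is stable under multiplication by the
coordinate, the norms of the monomials grow at most geometrically. -/
theorem exists_norm_monomial_le {X : Type*} [NormedAddCommGroup X] [NormedSpace ℂ X]
    [CompleteSpace X] (ι : X →ₗ[ℂ] (unitDisk → ℂ)) (hinj : Function.Injective ι)
    (hX1 : ∀ w : unitDisk, Continuous fun f : X => ι f w)
    (hX3 : ∀ f : X, ∃ g : X, ι g = fun z : unitDisk => (z : ℂ) * ι f z)
    {e : ℕ → X} (he : ∀ n, ι (e n) = fun z : unitDisk => (z : ℂ) ^ n) :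
    ∃ C : ℝ, 0 < C ∧ ∀ n, ‖e n‖ ≤ C ^ n * ‖e 0‖ := by
  choose M hM using hX3
  let L : X →ₗ[ℂ] X :=
    { toFun := M
      map_add' := fun f g => hinj (by
        funext z
        simp only [map_add, hM, Pi.add_apply]
        ring)
      map_smul' := fun c f => hinj (by
        funext z
        simp only [map_smul, hM, Pi.smul_apply, smul_eq_mul, RingHom.id_apply]
        ring) }
  have hL : Continuous L := by
    refine LinearMap.continuous_of_seq_closed_graph L fun u x y hu hLu => hinj ?_
    funext z
    have h1 := ((hX1 z).tendsto y).comp hLu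
    have h2 := (((hX1 z).tendsto x).comp hu).const_mul (z : ℂ)
    have h3 : ι (L x) z = z * ι x z := congrFun (hM x) z
    rw [h3]
    refine tendsto_nhds_unique h1 (h2.congr fun n => ?_)
    exact (congrFun (hM (u n)) z).symm
  let L' : X →L[ℂ] X := ⟨L, hL⟩
  have hLe : ∀ n, e (n + 1) = L' (e n) := fun n => hinj (by
    rw [he]
    refine Eq.trans ?_ (hM (e n)).symm
    funext z
    rw [he, pow_succ'])
  refine ⟨‖L'‖ + 1, by positivity, fun n => ?_⟩
  induction n with
  | zero => simp
  | succ n ih =>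
    rw [hLe, pow_succ', mul_assoc]
    calc ‖L' (e n)‖ ≤ ‖L'‖ * ‖e n‖ := L'.le_opNorm _
      _ ≤ (‖L'‖ + 1) * ((‖L'‖ + 1) ^ n * ‖e 0‖) := by gcongr; linarith

/-- The expansion of a Blaschke factor with zero at `conj t` converges in `X` when `t` is small. -/
theorem exists_blaschke_factor {X : Type*} [NormedAddCommGroup X] [NormedSpace ℂ X]
    [CompleteSpace X] (ι : X →ₗ[ℂ] (unitDisk → ℂ))
    (hX1 : ∀ w : unitDisk, Continuous fun f : X => ι f w)
    {e : ℕ → X} (he : ∀ n, ι (e n) = fun z : unitDisk => (z : ℂ) ^ n) {C : ℝ} (hC : 0 < C)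
    (hCe : ∀ n, ‖e n‖ ≤ C ^ n * ‖e 0‖) {t : ℂ} (ht : C * ‖t‖ < 1) (ht1 : ‖t‖ < 1) :
    ∃ g : X, IsFiniteBlaschke (ι g) ∧ ∀ l : X →ₗ[ℂ] ℂ, Continuous l →
      l g = -(starRingEnd ℂ) t * l (e 0) + (1 - (‖t‖ : ℂ) ^ 2) * ∑' n, t ^ n * l (e (n + 1)) := by
  have hs : Summable fun n => t ^ n • e (n + 1) := by
    refine Summable.of_norm_bounded
      ((summable_geometric_of_lt_one (by positivity) ht).mul_right (C * ‖e 0‖)) fun n => ?_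
    rw [norm_smul, norm_pow, mul_pow]
    calc ‖t‖ ^ n * ‖e (n + 1)‖ ≤ ‖t‖ ^ n * (C ^ (n + 1) * ‖e 0‖) := by gcongr; exact hCe _
      _ = _ := by ring
  have hl : ∀ l : X →ₗ[ℂ] ℂ, Continuous l →
      l (-(starRingEnd ℂ) t • e 0 + (1 - (‖t‖ : ℂ) ^ 2) • ∑' n, t ^ n • e (n + 1)) =
        -(starRingEnd ℂ) t * l (e 0) + (1 - (‖t‖ : ℂ) ^ 2) * ∑' n, t ^ n * l (e (n + 1)) := by
    intro l hlc
    have h1 := (hs.hasSum.map l hlc).tsum_eq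
    rw [map_add, map_smul, map_smul, ← h1]
    simp
  refine ⟨_, ⟨1, 1, fun _ => (starRingEnd ℂ) t, by simp, fun _ => by simpa using ht1,
    fun z => ?_⟩, hl⟩
  have h1 := hl ((LinearMap.proj z).comp ι) (hX1 z)
  simp only [LinearMap.comp_apply, LinearMap.proj_apply, he] at h1
  rw [h1]
  have hz : ‖(z : ℂ)‖ < 1 := by simpa [unitDisk] using z.2
  have htz : ‖t * (z : ℂ)‖ < 1 := by
    rw [norm_mul]
    nlinarith [norm_nonneg t, norm_nonneg (z : ℂ)]
  have hne : 1 - t * (z : ℂ) ≠ 0 := by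
    intro h0
    rw [← sub_eq_zero.1 h0] at htz
    simp at htz
  have hgeo : ∑' n, t ^ n * (z : ℂ) ^ (n + 1) = z * (1 - t * z)⁻¹ := by
    rw [← tsum_geometric_of_norm_lt_one htz, ← tsum_mul_left]
    congr 1
    funext n
    rw [mul_pow]
    ring
  rw [hgeo, ← Complex.mul_conj']
  simp only [Finset.univ_unique, Finset.prod_const, Finset.card_singleton, pow_one, one_mul,
    Complex.conj_conj, pow_zero]
  field_simp
  ring

/-- Along the radius at which all the relevant inner functions have unimodular radial limits, the
images of the monomials become geometric. -/
theorem tendsto_radial_of_unimodular {f : ℕ → ℂ → ℂ} (hf : ∀ n z, ‖f n z‖ ≤ 1) {ρ : ℝ}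
    (hρ : 0 < ρ) (hρ1 : ρ < 1) {D : Set ℂ} (hD : Dense D) {α : Type*} {l : Filter α} {p : α → ℂ}
    (hlim : ∀ n, Filter.Tendsto (fun r => ‖f n (p r)‖) l (nhds 1))
    (hB : ∀ t ∈ D, ‖t‖ < ρ → Filter.Tendsto (fun r => ‖-(starRingEnd ℂ) t * f 0 (p r) +
      (1 - (‖t‖ : ℂ) ^ 2) * ∑' n, t ^ n * f (n + 1) (p r)‖) l (nhds 1)) (n : ℕ) :
    Filter.Tendsto (fun r => f (n + 1) (p r) * f 0 (p r) - f n (p r) * f 1 (p r)) l (nhds 0) := by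
  rw [Filter.tendsto_iff_ultrafilter]
  intro U hU
  have hex : ∀ k, ∃ c : ℂ, Filter.Tendsto (fun r => f k (p r)) U (nhds c) := by
    intro k
    obtain ⟨c, -, hc⟩ := (isCompact_closedBall (0 : ℂ) 1).ultrafilter_le_nhds'
      (U.map fun r => f k (p r))
      (Ultrafilter.mem_map.2 (Filter.univ_mem' fun r => by simpa using hf k (p r)))
    exact ⟨c, hc⟩
  choose w hw using hex
  have hw1 : ∀ k, ‖w k‖ = 1 := fun k =>
    tendsto_nhds_unique (hw k).norm ((hlim k).mono_left hU)
  have hgeo := geometric_of_norm_blaschke_pairing_eq_one hw1 hρ hρ1 hD (fun t htD ht => by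
    refine tendsto_nhds_unique (Filter.Tendsto.norm ?_) ((hB t htD ht).mono_left hU)
    refine ((hw 0).const_mul _).add (Filter.Tendsto.const_mul _ ?_)
    refine tendsto_tsum_of_dominated_convergence
      (summable_geometric_of_lt_one (norm_nonneg t) (ht.trans hρ1))
      (fun k => (hw (k + 1)).const_mul _) (Filter.Eventually.of_forall fun r k => ?_)
    rw [norm_mul, norm_pow]
    exact mul_le_of_le_one_right (by positivity) (hf _ _)) n
  have := ((hw (n + 1)).mul (hw 0)).sub ((hw n).mul (hw 1))
  rwa [hgeo, sub_self] at this

/-- **Maps preserving inner functions.** Let `X` be a complex Banach space of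
holomorphic functions on the unit disk (presented via an injective linear embedding
`ι : X →ₗ[ℂ] (𝔻 → ℂ)`), satisfying (X1), (X2), (X3), and such that
`limsup_n ‖z^n‖_X^{1/n} ≤ 1`.  Let `T : X → hol(𝔻)` be a continuous linear map
(continuity with respect to locally uniform convergence on `𝔻`, expressed as an
`ε`–`δ` condition at `0` on compact sets) mapping finite Blaschke products to inner
functions, whose range has dimension `> 1`.  Then there are inner functions `φ, ψ`,
with `φ` non-constant and `φ` mapping `𝔻` to `𝔻`, such that `Tf = ψ · (f ∘ φ)`. -/
theorem inner_preserving_weighted_composition {X : Type*} [NormedAddCommGroup X]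
    [NormedSpace ℂ X] [CompleteSpace X]
    (ι : X →ₗ[ℂ] (unitDisk → ℂ)) (hinj : Function.Injective ι)
    (hhol : ∀ f : X, HolOn (ι f))
    (hX1 : ∀ w : unitDisk, Continuous fun f : X => ι f w)
    (hX2a : ∀ q : Polynomial ℂ, ∃ f : X, ι f = fun z : unitDisk => q.eval (z : ℂ))
    (hX2b : Dense {f : X | ∃ q : Polynomial ℂ, ι f = fun z : unitDisk => q.eval (z : ℂ)})
    (hX3 : ∀ f : X, ∃ g : X, ι g = fun z : unitDisk => (z : ℂ) * ι f z)
    (hpow : ∀ e : ℕ → X, (∀ n : ℕ, ι (e n) = fun z : unitDisk => (z : ℂ) ^ n) →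
      Filter.limsup (fun n : ℕ => ‖e n‖ ^ ((n : ℝ)⁻¹)) Filter.atTop ≤ 1)
    (T : X →ₗ[ℂ] (unitDisk → ℂ))
    (hThol : ∀ f : X, HolOn (T f))
    (hTcont : ∀ K : Set ℂ, IsCompact K → K ⊆ unitDisk → ∀ ε : ℝ, 0 < ε →
      ∃ δ : ℝ, 0 < δ ∧ ∀ f : X, ‖f‖ ≤ δ →
        ∀ z : unitDisk, (z : ℂ) ∈ K → ‖T f z‖ ≤ ε)
    (hblaschke : ∀ g : X, IsFiniteBlaschke (ι g) → IsInner (T g))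
    (hrank : 1 < Module.rank ℂ (LinearMap.range T)) :
    ∃ (φ : unitDisk → unitDisk) (ψ : unitDisk → ℂ),
      IsInner (fun z => (φ z : ℂ)) ∧ IsInner ψ ∧
      (∃ z₁ z₂ : unitDisk, φ z₁ ≠ φ z₂) ∧
      ∀ (f : X) (z : unitDisk), T f z = ψ z * ι f (φ z) := by
  have hopen : IsOpen unitDisk := Metric.isOpen_ball
  choose e he' using fun n : ℕ => hX2a (Polynomial.X ^ n)
  have he : ∀ n, ι (e n) = fun z : unitDisk => (z : ℂ) ^ n := fun n => by simp [he']
  obtain ⟨C, hC, hCe⟩ := exists_norm_monomial_le ι hinj hX1 hX3 he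
  have hTc : ∀ z : unitDisk, Continuous fun f : X => T f z := fun z => by
    refine continuous_of_continuousAt_zero ((LinearMap.proj z).comp T : X →ₗ[ℂ] ℂ) ?_
    rw [Metric.continuousAt_iff]
    intro ε hε
    obtain ⟨δ, hδ, hT⟩ := hTcont {(z : ℂ)} isCompact_singleton (by simp) (ε / 2) (half_pos hε)
    refine ⟨δ, hδ, fun {f} hf => ?_⟩
    have := hT f (by simpa using hf.le) z rfl
    simp only [LinearMap.comp_apply, LinearMap.proj_apply, map_zero, dist_zero_right]
    linarith
  set F : ℕ → ℂ → ℂ := fun n => diskExtend (T (e n)) with hF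
  have hFd : ∀ n, DifferentiableOn ℂ (F n) unitDisk := fun n =>
    (hThol _).differentiableOn_diskExtend
  have hFi : ∀ n, IsInner (T (e n)) := fun n =>
    hblaschke _ ⟨n, 1, fun _ => 0, by simp, by simp, fun z => by simp [he]⟩
  have hFle : ∀ n z, ‖F n z‖ ≤ 1 := fun n => (hFi n).norm_diskExtend_le
  obtain ⟨ρ, hρ, hρ1, hρC⟩ : ∃ ρ : ℝ, 0 < ρ ∧ ρ < 1 ∧ C * ρ < 1 := by
    refine ⟨1 / (C + 1) / 2, by positivity, ?_, ?_⟩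
    · rw [div_div, div_lt_one (by positivity)]
      linarith
    · rw [div_div, mul_one_div, div_lt_one (by positivity)]
      linarith
  have hB : ∀ t : ℂ, ‖t‖ < ρ →
      ∀ᵐ θ : ℝ ∂(MeasureTheory.volume.restrict (Set.Ico (0 : ℝ) (2 * Real.pi))),
      Filter.Tendsto (fun r : ℝ => ‖-(starRingEnd ℂ) t *
          F 0 ((r : ℂ) * Complex.exp ((θ : ℂ) * Complex.I)) + (1 - (‖t‖ : ℂ) ^ 2) *
          ∑' n, t ^ n * F (n + 1) ((r : ℂ) * Complex.exp ((θ : ℂ) * Complex.I))‖)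
        (nhdsWithin 1 (Set.Iio 1)) (nhds 1) := by
    intro t ht
    obtain ⟨g, hg, hgl⟩ := exists_blaschke_factor ι hX1 he hC hCe
      (t := t) ((mul_le_mul_of_nonneg_left ht.le hC.le).trans_lt hρC) (ht.trans hρ1)
    filter_upwards [(hblaschke g hg).ae_tendsto_diskExtend] with θ hθ
    refine hθ.congr' ?_
    filter_upwards [eventually_radial_mem_unitDisk θ] with r hr
    let p : unitDisk := ⟨_, hr⟩
    have h1 := hgl ((LinearMap.proj p).comp T) (hTc p)
    simp only [LinearMap.comp_apply, LinearMap.proj_apply] at h1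
    rw [diskExtend_apply _ p, h1]
    simp only [hF, show (r : ℂ) * Complex.exp ((θ : ℂ) * Complex.I) = (p : ℂ) from rfl,
      diskExtend_apply]
  obtain ⟨D, hDc, hDd⟩ := TopologicalSpace.exists_countable_dense ℂ
  have hall : ∀ᵐ θ : ℝ ∂(MeasureTheory.volume.restrict (Set.Ico (0 : ℝ) (2 * Real.pi))),
      ∀ n, Filter.Tendsto (fun r : ℝ => ‖F n ((r : ℂ) * Complex.exp ((θ : ℂ) * Complex.I))‖)
        (nhdsWithin 1 (Set.Iio 1)) (nhds 1) :=
    MeasureTheory.ae_all_iff.2 fun n => (hFi n).ae_tendsto_diskExtend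
  have hallB := (MeasureTheory.ae_ball_iff hDc).2 fun t _ => MeasureTheory.ae_all_iff.2 (hB t)
  have hrec : ∀ n, ∀ z ∈ unitDisk, F (n + 1) z * F 0 z - F n z * F 1 z = 0 := by
    intro n z hz
    refine eqOn_zero_of_radial_limit_zero
      (F := fun z => F (n + 1) z * F 0 z - F n z * F 1 z) (C := 2)
      (((hFd _).mul (hFd _)).sub ((hFd _).mul (hFd _))) (fun z _ => ?_) ?_ hz
    · refine (norm_sub_le _ _).trans ?_
      rw [norm_mul, norm_mul]
      linarith [mul_le_one₀ (hFle (n + 1) z) (norm_nonneg _) (hFle 0 z),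
        mul_le_one₀ (hFle n z) (norm_nonneg _) (hFle 1 z)]
    · filter_upwards [hall, hallB] with θ h1 h2
      exact tendsto_radial_of_unimodular hFle hρ hρ1 hDd h1 h2 n
  have hpowrec : ∀ n, ∀ z ∈ unitDisk, F n z * F 0 z ^ n = F 1 z ^ n * F 0 z := by
    intro n z hz
    induction n with
    | zero => simp
    | succ n ih => linear_combination F 0 z ^ n * hrec n z hz + F 1 z * ih
  have hle : ∀ z ∈ unitDisk, ‖F 1 z‖ ≤ ‖F 0 z‖ := by
    intro z hz
    have hb : ∀ n, ‖F 1 z‖ ^ n * ‖F 0 z‖ ≤ ‖F 0 z‖ ^ n := fun n => by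
      have := congrArg norm (hpowrec n z hz)
      simp only [norm_mul, norm_pow] at this
      rw [← this]
      exact mul_le_of_le_one_left (by positivity) (hFle n z)
    by_cases h0 : F 0 z = 0
    · have := hrec 1 z hz
      simp only [h0, mul_zero, zero_sub, neg_eq_zero, mul_self_eq_zero] at this
      simp [this]
    · by_contra! hlt
      have h0' : 0 < ‖F 0 z‖ := norm_pos_iff.2 h0
      obtain ⟨n, hn⟩ := pow_unbounded_of_one_lt (1 / ‖F 0 z‖) ((one_lt_div h0').2 hlt)
      have := hb n
      rw [div_pow, div_lt_div_iff₀ h0' (by positivity), one_mul] at hn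
      linarith
  have hne0 : (MeasureTheory.ae (MeasureTheory.volume.restrict
      (Set.Ico (0 : ℝ) (2 * Real.pi)))).NeBot := by
    rw [MeasureTheory.ae_neBot, Ne, MeasureTheory.Measure.restrict_eq_zero, Real.volume_Ico]
    simp [Real.pi_pos]
  have hF0 : ∃ z ∈ unitDisk, F 0 z ≠ 0 := by
    obtain ⟨θ, hθ⟩ := hall.exists
    by_contra! hzero
    refine one_ne_zero (α := ℝ) (tendsto_nhds_unique (hθ 0) (tendsto_const_nhds.congr' ?_))
    filter_upwards [eventually_radial_mem_unitDisk θ] with r hr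
    rw [hzero _ hr, norm_zero]
  obtain ⟨H, hHd, hHq, hHle, hident⟩ := exists_holomorphic_quotient (hFd 1) (hFd 0) hle hF0
  have hFn : ∀ n, ∀ z ∈ unitDisk, F n z = F 0 z * H z ^ n := by
    intro n
    induction n with
    | zero => simp
    | succ n ih =>
      intro z hz
      rw [← sub_eq_zero]
      refine hident (fun z => F (n + 1) z - F 0 z * H z ^ (n + 1)) ?_ ?_ z hz
      · exact (hFd _).continuousOn.sub ((hFd 0).continuousOn.mul (hHd.continuousOn.pow _))
      · intro w hw h0
        apply mul_left_cancel₀ h0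
        linear_combination hrec n w hw + F 1 w * ih w hw + F 0 w * H w ^ n * hHq w hw
  have hpoly : ∀ q : Polynomial ℂ, ∀ f : X, (ι f = fun z : unitDisk => q.eval (z : ℂ)) →
      ∀ z : unitDisk, T f z = F 0 z * q.eval (H z) := by
    intro q f hf z
    have hfe : f = ∑ i ∈ Finset.range (q.natDegree + 1), q.coeff i • e i := hinj (by
      rw [hf, map_sum]
      funext z
      simp [he, Polynomial.eval_eq_sum_range])
    have hTe : ∀ i, T (e i) z = F 0 z * H z ^ i := fun i => by
      rw [← hFn i z z.2]
      exact (diskExtend_apply _ z).symm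
    rw [hfe, map_sum, Polynomial.eval_eq_sum_range, Finset.mul_sum, Finset.sum_apply]
    refine Finset.sum_congr rfl fun i _ => ?_
    rw [map_smul, Pi.smul_apply, hTe, smul_eq_mul]
    ring
  have hnc : ¬ ∃ c, ∀ z ∈ unitDisk, H z = c := by
    rintro ⟨c, hc⟩
    obtain ⟨z₀, hz₀, h₀⟩ := hF0
    have hT : ∀ z : unitDisk, ∀ f : X, T f z * F 0 z₀ = T f ⟨z₀, hz₀⟩ * F 0 z := by
      intro z f
      refine hX2b.induction (P := fun f => T f z * F 0 z₀ = T f ⟨z₀, hz₀⟩ * F 0 z) ?_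
        (isClosed_eq ((hTc z).mul continuous_const) ((hTc _).mul continuous_const)) f
      rintro f ⟨q, hq⟩
      rw [hpoly q f hq, hpoly q f hq, hc _ z.2, hc _ hz₀]
      ring
    refine hrank.not_ge ((rank_submodule_le_one_iff' _).2 ⟨fun z => F 0 z, ?_⟩)
    rintro _ ⟨f, rfl⟩
    refine Submodule.mem_span_singleton.2 ⟨T f ⟨z₀, hz₀⟩ / F 0 z₀, ?_⟩
    funext z
    rw [Pi.smul_apply, smul_eq_mul, div_mul_eq_mul_div, ← hT z f, mul_div_cancel_right₀ _ h₀]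
  have hHmem : ∀ z ∈ unitDisk, H z ∈ unitDisk := by
    intro z hz
    by_contra hcon
    have h1 : 1 ≤ ‖H z‖ := by simpa [unitDisk] using hcon
    exact hnc ⟨H z, Complex.eqOn_of_isPreconnected_of_isMaxOn_norm
      (convex_ball (0 : ℂ) 1).isPreconnected hopen hHd hz fun w hw => (hHle w hw).trans h1⟩
  refine ⟨fun z => ⟨H z, hHmem z z.2⟩, T (e 0), ⟨H, hHd, fun _ => rfl, fun z => hHle z z.2, ?_⟩,
    hFi 0, ?_, fun f z => ?_⟩
  · filter_upwards [hall] with θ hθ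
    have := (hθ 1).div (hθ 0) one_ne_zero
    rw [div_one] at this
    refine this.congr' ?_
    filter_upwards [eventually_radial_mem_unitDisk θ,
      (hθ 0).eventually_ne one_ne_zero] with r hr h0
    simp only [Pi.div_apply]
    rw [hHq _ hr, norm_mul, mul_div_cancel_left₀ _ h0]
  · by_contra! hcon
    exact hnc ⟨H 0, fun z hz => congrArg Subtype.val (hcon ⟨z, hz⟩ ⟨0, by simp [unitDisk]⟩)⟩
  · refine hX2b.induction (P := fun f => T f z = T (e 0) z * ι f ⟨H z, hHmem z z.2⟩) ?_
      (isClosed_eq (hTc z) (continuous_const.mul (hX1 _))) f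
    rintro f ⟨q, hq⟩
    rw [hpoly q f hq, hq, ← diskExtend_apply (T (e 0)) z]
end
end
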